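/- Suppose m, n are natural numbers and x_1, …, x_m, y_1, …, y_n are positive real numbers such that P_Λ(t) · ∏_{j=1}^n (1 − y_j t) = ∏_{i=1}^m (1 + x_i t) as formal power series over ℝ. Write ∏_{i=1}^m (1 + x_i t) = ∑_{i=0}^m a_i t^i =: P(t) and ∏_{j=1}^n (1 − y_j t) = ∑_{j=0}^n (−1)^j b_j t^j =: Q(t), and let P̃(t) = ∑_{i=0}^m a_{m−i} t^i and Q̃(t) = ∑_{j=0}^n (−1)^j b_{n−j} t^j denote the reversed polynomials. Then the polynomial identity b_n · P̃(t) · Q(t) = a_m · Q̃(t) · P(t) holds. -/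

import Mathlib

open TensorProduct Polynomial

noncomputable section

/-- The linear map `V ⊗ V → T(V)` sending `v ⊗ w` to `ι v * ι w`. -/
def mulTwo (K : Type) [Field K] (V : Type) [AddCommGroup V] [Module K V] :
    V ⊗[K] V →ₗ[K] TensorAlgebra K V :=
  TensorProduct.lift
    ((LinearMap.mul K (TensorAlgebra K V)).compl₁₂ (TensorAlgebra.ι K) (TensorAlgebra.ι K))

/-- `R : V ⊗ V → V ⊗ V` is a Hecke symmetry with parameter `q`:
it is invertible, satisfies the braid relation, the Hecke relation
`(R + 1)(R - q) = 0`, and its half adjoint `R♯ : V* ⊗ V → V ⊗ V*`,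
characterized by `⟨R♯(ξ ⊗ v), w⟩ = ⟨ξ, R(v ⊗ w)⟩`, is invertible. -/
def IsHeckeSymmetry (K : Type) [Field K] (V : Type) [AddCommGroup V] [Module K V]
    (q : K) (R : V ⊗[K] V →ₗ[K] V ⊗[K] V) : Prop :=
  Function.Bijective R ∧
  (TensorProduct.map R LinearMap.id ∘ₗ
      ((TensorProduct.assoc K V V V).symm.toLinearMap ∘ₗ
        TensorProduct.map LinearMap.id R ∘ₗ (TensorProduct.assoc K V V V).toLinearMap) ∘ₗ
      TensorProduct.map R LinearMap.id =
    ((TensorProduct.assoc K V V V).symm.toLinearMap ∘ₗ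
        TensorProduct.map LinearMap.id R ∘ₗ (TensorProduct.assoc K V V V).toLinearMap) ∘ₗ
      TensorProduct.map R LinearMap.id ∘ₗ
      ((TensorProduct.assoc K V V V).symm.toLinearMap ∘ₗ
        TensorProduct.map LinearMap.id R ∘ₗ (TensorProduct.assoc K V V V).toLinearMap)) ∧
  ((R + LinearMap.id) ∘ₗ (R - q • LinearMap.id) = 0) ∧
  (∃ Rs : Module.Dual K V ⊗[K] V →ₗ[K] V ⊗[K] Module.Dual K V,
    Function.Bijective Rs ∧
    ∀ (ξ : Module.Dual K V) (v w : V),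
      dualTensorHom K V V ((TensorProduct.comm K V (Module.Dual K V)) (Rs (ξ ⊗ₜ[K] v))) w =
        TensorProduct.lid K V (TensorProduct.map ξ LinearMap.id (R (v ⊗ₜ[K] w))))

/-- The relation on `T(V)` whose closure cuts out the exterior algebra `Λ` of `R`:
all elements of the image of `R + 1` in degree two are set to zero. -/
def lambdaRel (K : Type) [Field K] (V : Type) [AddCommGroup V] [Module K V]
    (R : V ⊗[K] V →ₗ[K] V ⊗[K] V) :
    TensorAlgebra K V → TensorAlgebra K V → Prop :=
  fun a b => b = 0 ∧ ∃ u : V ⊗[K] V, a = mulTwo K V ((R + (LinearMap.id : V ⊗[K] V →ₗ[K] V ⊗[K] V)) u)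

/-- The `l`-th homogeneous component of the exterior algebra `Λ = T(V)/(im(R+1))`,
as the image of the `l`-th graded piece of the tensor algebra. -/
def lambdaGrade (K : Type) [Field K] (V : Type) [AddCommGroup V] [Module K V]
    (R : V ⊗[K] V →ₗ[K] V ⊗[K] V) (l : ℕ) :
    Submodule K (RingQuot (lambdaRel K V R)) :=
  Submodule.map (RingQuot.mkAlgHom K (lambdaRel K V R)).toLinearMap
    (LinearMap.range (TensorAlgebra.ι K : V →ₗ[K] TensorAlgebra K V) ^ l)

/-- The Poincaré series `P_Λ(t) = ∑ (dim Λ_l) t^l` of the exterior algebra,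
as a formal power series over `ℝ`. -/
def poincareLambda (K : Type) [Field K] (V : Type) [AddCommGroup V] [Module K V]
    (R : V ⊗[K] V →ₗ[K] V ⊗[K] V) : PowerSeries ℝ :=
  PowerSeries.mk fun l => (Module.finrank K (lambdaGrade K V R l) : ℝ)

set_option linter.unusedSectionVars false

namespace HS

inductive HRel (K : Type) [Field K] (q : K) : FreeAlgebra K ℕ → FreeAlgebra K ℕ → Prop
  | far (i j : ℕ) (h : i + 2 ≤ j) : HRel K q (FreeAlgebra.ι K i * FreeAlgebra.ι K j)
      (FreeAlgebra.ι K j * FreeAlgebra.ι K i)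
  | braid (i : ℕ) : HRel K q (FreeAlgebra.ι K i * FreeAlgebra.ι K (i+1) * FreeAlgebra.ι K i)
      (FreeAlgebra.ι K (i+1) * FreeAlgebra.ι K i * FreeAlgebra.ι K (i+1))
  | quad (i : ℕ) : HRel K q (FreeAlgebra.ι K i * FreeAlgebra.ι K i)
      ((q - 1) • FreeAlgebra.ι K i + algebraMap K _ q)

def H (K : Type) [Field K] (q : K) : Type := RingQuot (HRel K q)
instance (K : Type) [Field K] (q : K) : Ring (H K q) := inferInstanceAs (Ring (RingQuot (HRel K q)))
instance (K : Type) [Field K] (q : K) : Algebra K (H K q) := inferInstanceAs (Algebra K (RingQuot (HRel K q)))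

def mkH (K : Type) [Field K] (q : K) : FreeAlgebra K ℕ →ₐ[K] H K q := RingQuot.mkAlgHom K (HRel K q)
theorem mkH_surj (K : Type) [Field K] (q : K) : Function.Surjective (mkH K q) :=
  RingQuot.mkAlgHom_surjective K (HRel K q)
theorem mkH_rel {K : Type} [Field K] {q : K} {a b} (h : HRel K q a b) : mkH K q a = mkH K q b :=
  RingQuot.mkAlgHom_rel K h

variable {K : Type} [Field K] {q : K}

def T (i : ℕ) : H K q := mkH K q (FreeAlgebra.ι K i)

theorem T_far {i j : ℕ} (h : i + 2 ≤ j) : (T i * T j : H K q) = T j * T i := by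
  have := mkH_rel (HRel.far (K := K) (q := q) i j h)
  simpa [T] using this

theorem T_braid (i : ℕ) : (T i * T (i+1) * T i : H K q) = T (i+1) * T i * T (i+1) := by
  have := mkH_rel (HRel.braid (K := K) (q := q) i)
  simpa [T] using this

theorem T_quad (i : ℕ) : (T i * T i : H K q) = (q - 1) • T i + algebraMap K _ q := by
  have := mkH_rel (HRel.quad (K := K) (q := q) i)
  rw [map_mul, map_add, map_smul, AlgHom.commutes] at this
  exact this

theorem lft_aux {A : Type} [Ring A] [Algebra K A] (f : ℕ → A)
    (h1 : ∀ i j, i + 2 ≤ j → f i * f j = f j * f i)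
    (h2 : ∀ i, f i * f (i+1) * f i = f (i+1) * f i * f (i+1))
    (h3 : ∀ i, f i * f i = (q - 1) • f i + algebraMap K A q) ⦃x y⦄ (h : HRel K q x y) :
    FreeAlgebra.lift K f x = FreeAlgebra.lift K f y := by
  cases h with
  | far i j h => simpa using h1 i j h
  | braid i => simpa using h2 i
  | quad i => simpa using h3 i

def lft {A : Type} [Ring A] [Algebra K A] (f : ℕ → A)
    (h1 : ∀ i j, i + 2 ≤ j → f i * f j = f j * f i)
    (h2 : ∀ i, f i * f (i+1) * f i = f (i+1) * f i * f (i+1))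
    (h3 : ∀ i, f i * f i = (q - 1) • f i + algebraMap K A q) : H K q →ₐ[K] A :=
  RingQuot.liftAlgHom K ⟨FreeAlgebra.lift K f, lft_aux f h1 h2 h3⟩

@[simp] theorem lft_T {A : Type} [Ring A] [Algebra K A] (f : ℕ → A) (h1 h2 h3) (i : ℕ) :
    lft (q := q) f h1 h2 h3 (T i) = f i := by
  have := RingQuot.liftAlgHom_mkAlgHom_apply K (FreeAlgebra.lift K f) (lft_aux f h1 h2 h3) (FreeAlgebra.ι K i)
  rw [FreeAlgebra.lift_ι_apply] at this
  exact this

theorem hom_ext {A : Type} [Ring A] [Algebra K A] {f g : H K q →ₐ[K] A}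
    (h : ∀ i, f (T i) = g (T i)) : f = g := by
  apply RingQuot.ringQuot_ext'
  apply FreeAlgebra.hom_ext
  funext i
  exact h i

/-- strand shift -/
def sh (n : ℕ) : H K q →ₐ[K] H K q :=
  lft (fun i => T (i + n)) (fun i j h => T_far (by omega))
    (fun i => by have := T_braid (K := K) (q := q) (i + n); rwa [show i + n + 1 = i + 1 + n by ring] at this)
    (fun i => T_quad _)

@[simp] theorem sh_T (n i : ℕ) : sh n (T i : H K q) = T (i + n) := lft_T _ _ _ _ _

theorem sh_sh (a b : ℕ) (x : H K q) : sh a (sh b x) = sh (a + b) x := by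
  have : (sh a).comp (sh b) = (sh (a+b) : H K q →ₐ[K] H K q) :=
    hom_ext (fun i => by simp [show i + b + a = i + (a + b) by ring])
  exact DFunLike.congr_fun this x

theorem sh_zero (x : H K q) : sh 0 x = x := by
  have : (sh 0) = (AlgHom.id K (H K q)) := hom_ext (fun i => by simp)
  rw [this]; rfl

/-- anti-automorphism -/
def ant0 : H K q →ₐ[K] (H K q)ᵐᵒᵖ :=
  lft (fun i => MulOpposite.op (T i))
    (fun i j h => by rw [← MulOpposite.op_mul, ← MulOpposite.op_mul, T_far h])
    (fun i => by
      simp only [← MulOpposite.op_mul]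
      rw [← mul_assoc, T_braid, mul_assoc])
    (fun i => by
      rw [← MulOpposite.op_mul, T_quad]; rfl)

def ant (x : H K q) : H K q := MulOpposite.unop (ant0 x)
@[simp] theorem ant_T (i : ℕ) : ant (T i : H K q) = T i := by simp [ant, ant0]
@[simp] theorem ant_mul (x y : H K q) : ant (x * y) = ant y * ant x := by simp [ant]
@[simp] theorem ant_add (x y : H K q) : ant (x + y) = ant x + ant y := by simp [ant]
@[simp] theorem ant_one : ant (1 : H K q) = 1 := by simp [ant]
@[simp] theorem ant_zero : ant (0 : H K q) = 0 := by simp [ant]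
@[simp] theorem ant_smul (c : K) (x : H K q) : ant (c • x) = c • ant x := by simp [ant]
@[simp] theorem ant_algebraMap (c : K) : ant (algebraMap K (H K q) c) = algebraMap K _ c := by
  simp [Algebra.algebraMap_eq_smul_one]

/-- strands `0..n-1` -/
def HN (n : ℕ) : Subalgebra K (H K q) := Algebra.adjoin K {x | ∃ i, i + 1 < n ∧ x = T i}

theorem T_mem {i n : ℕ} (h : i + 1 < n) : (T i : H K q) ∈ HN n :=
  Algebra.subset_adjoin ⟨i, h, rfl⟩

theorem HN_mono {m n : ℕ} (h : m ≤ n) : (HN m : Subalgebra K (H K q)) ≤ HN n :=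
  Algebra.adjoin_mono (by rintro x ⟨i, hi, rfl⟩; exact ⟨i, by omega, rfl⟩)

theorem sh_mem {n m : ℕ} {x : H K q} (h : x ∈ HN n) : sh m x ∈ HN (K := K) (q := q) (n + m) := by
  induction h using Algebra.adjoin_induction with
  | mem x hx => obtain ⟨i, hi, rfl⟩ := hx; rw [sh_T]; exact T_mem (by omega)
  | algebraMap r => rw [AlgHom.commutes]; exact Subalgebra.algebraMap_mem _ _
  | add x y _ _ hx hy => rw [map_add]; exact add_mem hx hy
  | mul x y _ _ hx hy => rw [map_mul]; exact mul_mem hx hy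

theorem ant_mem {n : ℕ} {x : H K q} (h : x ∈ HN n) : ant x ∈ HN (K := K) (q := q) n := by
  induction h using Algebra.adjoin_induction with
  | mem x hx => obtain ⟨i, hi, rfl⟩ := hx; rw [ant_T]; exact T_mem (by omega)
  | algebraMap r => rw [ant_algebraMap]; exact Subalgebra.algebraMap_mem _ _
  | add x y _ _ hx hy => rw [ant_add]; exact add_mem hx hy
  | mul x y _ _ hx hy => rw [ant_mul]; exact mul_mem hy hx

theorem ant_ant (x : H K q) : ant (ant x) = x := by
  have : ∀ x ∈ (⊤ : Subalgebra K (H K q)), ant (ant x) = x := by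
    have htop : Algebra.adjoin K (Set.range (T : ℕ → H K q)) = ⊤ := by
      rw [eq_top_iff]
      intro x _
      obtain ⟨y, rfl⟩ := mkH_surj K q x
      induction y using FreeAlgebra.induction with
      | grade0 r => rw [AlgHom.commutes]; exact Subalgebra.algebraMap_mem _ _
      | grade1 i => exact Algebra.subset_adjoin ⟨i, rfl⟩
      | mul a b ha hb => rw [map_mul]; exact mul_mem (ha trivial) (hb trivial)
      | add a b ha hb => rw [map_add]; exact add_mem (ha trivial) (hb trivial)
    rw [← htop]
    intro x h
    induction h using Algebra.adjoin_induction with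
    | mem x hx => obtain ⟨i, rfl⟩ := hx; simp
    | algebraMap r => simp
    | add x y _ _ hx hy => simp [hx, hy]
    | mul x y _ _ hx hy => simp [hx, hy]
  exact this x trivial

theorem exists_HN (x : H K q) : ∃ n, x ∈ HN (K := K) (q := q) n := by
  obtain ⟨y, rfl⟩ := mkH_surj K q x
  induction y using FreeAlgebra.induction with
  | grade0 r => rw [AlgHom.commutes]; exact ⟨0, Subalgebra.algebraMap_mem _ _⟩
  | grade1 i => exact ⟨i + 2, T_mem (by omega)⟩
  | mul a b ha hb =>
    obtain ⟨m, hm⟩ := ha; obtain ⟨n, hn⟩ := hb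
    rw [map_mul]
    exact ⟨max m n, mul_mem (HN_mono (le_max_left _ _) hm) (HN_mono (le_max_right _ _) hn)⟩
  | add a b ha hb =>
    obtain ⟨m, hm⟩ := ha; obtain ⟨n, hn⟩ := hb
    rw [map_add]
    exact ⟨max m n, add_mem (HN_mono (le_max_left _ _) hm) (HN_mono (le_max_right _ _) hn)⟩

theorem comm_T {n j : ℕ} (hj : n ≤ j) {x : H K q} (h : x ∈ HN n) : x * T j = T j * x := by
  induction h using Algebra.adjoin_induction with
  | mem x hx => obtain ⟨i, hi, rfl⟩ := hx; exact T_far (by omega)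
  | algebraMap r => exact Algebra.commutes _ _
  | add x y _ _ hx hy => rw [add_mul, mul_add, hx, hy]
  | mul x y _ _ hx hy => rw [mul_assoc, hy, ← mul_assoc, hx, mul_assoc]

theorem comm_sh {n m : ℕ} {x y : H K q} (h : x ∈ HN n) (hnm : n ≤ m) : x * sh m y = sh m y * x := by
  obtain ⟨N, hN⟩ := exists_HN y
  induction hN using Algebra.adjoin_induction with
  | mem y hy => obtain ⟨i, hi, rfl⟩ := hy; rw [sh_T]; exact comm_T (by omega) h
  | algebraMap r => rw [AlgHom.commutes]; exact (Algebra.commutes _ _).symm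
  | add y z _ _ hy hz => rw [map_add, add_mul, mul_add, hy, hz]
  | mul y z _ _ hy hz => rw [map_mul, ← mul_assoc, hy, mul_assoc, hz, mul_assoc]

theorem HN_le_one {n : ℕ} (hn : n ≤ 1) {x : H K q} (h : x ∈ HN n) : ∃ c : K, x = algebraMap K _ c := by
  induction h using Algebra.adjoin_induction with
  | mem x hx => obtain ⟨i, hi, rfl⟩ := hx; omega
  | algebraMap r => exact ⟨r, rfl⟩
  | add x y _ _ hx hy => obtain ⟨a, rfl⟩ := hx; obtain ⟨b, rfl⟩ := hy; exact ⟨a + b, by simp⟩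
  | mul x y _ _ hx hy => obtain ⟨a, rfl⟩ := hx; obtain ⟨b, rfl⟩ := hy; exact ⟨a * b, by simp⟩

theorem T_inv (hq : q ≠ 0) (i : ℕ) :
    (T i : H K q) * (q⁻¹ • T i - (q⁻¹ * (q - 1)) • 1) = 1 ∧
    (q⁻¹ • T i - (q⁻¹ * (q - 1)) • 1) * (T i : H K q) = 1 := by
  constructor
  · rw [mul_sub, mul_smul_comm, T_quad, smul_add, smul_smul, mul_smul_comm, mul_one,
      Algebra.algebraMap_eq_smul_one, smul_smul, inv_mul_cancel₀ hq, one_smul]; abel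
  · rw [sub_mul, smul_mul_assoc, T_quad, smul_add, smul_smul, smul_mul_assoc, one_mul,
      Algebra.algebraMap_eq_smul_one, smul_smul, inv_mul_cancel₀ hq, one_smul]; abel

/-- `T_0 ⋯ T_{n-1}` -/
def c1 : ℕ → H K q
  | 0 => 1
  | n + 1 => c1 n * T n

theorem c1_s (n : ℕ) : (c1 (n+1) : H K q) = c1 n * T n := rfl

theorem c1_succ' (n : ℕ) : (c1 (n+1) : H K q) = T 0 * sh 1 (c1 n) := by
  induction n with
  | zero => simp [c1]
  | succ n ih =>
    rw [c1_s, ih, mul_assoc]; congr 1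
    rw [← ih, c1_s, map_mul, sh_T]

theorem c1_mem (n : ℕ) : (c1 n : H K q) ∈ HN (n + 1) := by
  induction n with
  | zero => exact one_mem _
  | succ n ih => exact mul_mem (HN_mono (by omega) ih) (T_mem (by omega))

theorem c1_inv (hq : q ≠ 0) (n : ℕ) : ∃ y ∈ HN (K := K) (q := q) (n + 1), c1 n * y = 1 ∧ y * c1 n = 1 := by
  induction n with
  | zero => exact ⟨1, one_mem _, by simp [c1], by simp [c1]⟩
  | succ n ih =>
    obtain ⟨y, hy, h1, h2⟩ := ih
    refine ⟨(q⁻¹ • T n - (q⁻¹ * (q - 1)) • 1) * y, ?_, ?_, ?_⟩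
    · refine mul_mem (sub_mem (Subalgebra.smul_mem _ (T_mem (by omega)) _)
        (Subalgebra.smul_mem _ (one_mem _) _)) (HN_mono (by omega) hy)
    · rw [c1_s, mul_assoc, ← mul_assoc (T n), (T_inv hq n).1, one_mul, h1]
    · rw [c1_s, mul_assoc, ← mul_assoc y, h2, one_mul, (T_inv hq n).2]

theorem c1_T {n i : ℕ} (h : i + 1 < n) : (c1 n : H K q) * T i = T (i + 1) * c1 n := by
  induction n with
  | zero => omega
  | succ n ih =>
    rcases Nat.lt_or_ge (i + 1) n with h' | h'
    · rw [c1_s, mul_assoc, ← T_far (by omega), ← mul_assoc, ih h', mul_assoc]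
    · obtain rfl : n = i + 1 := by omega
      rw [c1_s, c1_s]
      have hc : (c1 i : H K q) * T (i+1) = T (i+1) * c1 i := comm_T le_rfl (c1_mem i)
      calc c1 i * T i * T (i+1) * T i = c1 i * (T i * T (i+1) * T i) := by noncomm_ring
        _ = c1 i * T (i+1) * T i * T (i+1) := by rw [T_braid]; noncomm_ring
        _ = _ := by rw [hc]; noncomm_ring

theorem c1_conj {n : ℕ} {x : H K q} (h : x ∈ HN n) : c1 n * x = sh 1 x * c1 n := by
  induction h using Algebra.adjoin_induction with
  | mem x hx => obtain ⟨i, hi, rfl⟩ := hx; rw [sh_T]; exact c1_T hi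
  | algebraMap r => rw [AlgHom.commutes]; exact (Algebra.commutes _ _).symm
  | add x y _ _ hx hy => rw [map_add, add_mul, mul_add, hx, hy]
  | mul x y _ _ hx hy => rw [map_mul, ← mul_assoc, hx, mul_assoc, hy, mul_assoc]

/-- `T_{n-1} ⋯ T_a` -/
def Dw : ℕ → ℕ → H K q
  | 0, _ => 1
  | n + 1, a => if a ≤ n then T n * Dw n a else 1

theorem Dw_of_le {n a : ℕ} (h : n ≤ a) : (Dw n a : H K q) = 1 := by
  cases n with
  | zero => rfl
  | succ n => rw [Dw, if_neg (by omega)]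

theorem Dw_succ {n a : ℕ} (h : a ≤ n) : (Dw (n+1) a : H K q) = T n * Dw n a := by
  rw [Dw, if_pos h]

theorem Dw_mem (n a : ℕ) : (Dw n a : H K q) ∈ HN (n + 1) := by
  induction n with
  | zero => exact one_mem _
  | succ n ih =>
    rw [Dw]; split_ifs
    · exact mul_mem (T_mem (by omega)) (HN_mono (by omega) ih)
    · exact one_mem _

theorem Dw_right {n a : ℕ} (h : a < n) : (Dw n a : H K q) = Dw n (a+1) * T a := by
  induction n with
  | zero => omega
  | succ n ih =>
    rcases Nat.lt_or_ge a n with h' | h'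
    · rw [Dw_succ (by omega), ih h', Dw_succ (by omega), mul_assoc]
    · obtain rfl : a = n := by omega
      rw [Dw_succ le_rfl, Dw_of_le le_rfl, Dw_of_le le_rfl, one_mul, mul_one]

/-- far right: `i + 1 < a` -/
theorem Dw_T_far {n a i : ℕ} (h : i + 1 < a) : (Dw n a : H K q) * T i = T i * Dw n a := by
  induction n with
  | zero => simp [Dw]
  | succ n ih =>
    rw [Dw]; split_ifs with h'
    · rw [mul_assoc, ih, ← mul_assoc, ← T_far (by omega), mul_assoc]
    · simp

/-- inner: `a < i < n` -/
theorem Dw_T_in {n a i : ℕ} (h : a < i) (h2 : i < n) : (Dw n a : H K q) * T i = T (i - 1) * Dw n a := by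
  induction n with
  | zero => omega
  | succ n ih =>
    rcases Nat.lt_or_ge i n with h' | h'
    · rw [Dw_succ (by omega), mul_assoc, ih h', ← mul_assoc, ← T_far (by omega), mul_assoc]
    · obtain rfl : i = n := by omega
      obtain ⟨i, rfl⟩ : ∃ j, i = j + 1 := ⟨i - 1, by omega⟩
      rw [Dw_succ (by omega), Dw_succ (by omega)]
      have hc : (Dw i a : H K q) * T (i+1) = T (i+1) * Dw i a := comm_T le_rfl (Dw_mem i a)
      simp only [Nat.add_sub_cancel]
      calc T (i+1) * (T i * Dw i a) * T (i+1) = T (i+1) * T i * (Dw i a * T (i+1)) := by noncomm_ring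
        _ = (T (i+1) * T i * T (i+1)) * Dw i a := by rw [hc]; noncomm_ring
        _ = _ := by rw [← T_braid]; noncomm_ring

theorem Dw_T_eq {n a : ℕ} (h : a < n) : (Dw n a : H K q) * T a = (q - 1) • Dw n a + q • Dw n (a+1) := by
  rw [Dw_right h, mul_assoc, T_quad, mul_add, mul_smul_comm, ← Algebra.commutes, ← Algebra.smul_def]

end HS

namespace HS
variable {K : Type} [Field K] {q : K}

theorem span_of_right {S : Submodule K (H K q)} {n : ℕ} (h1 : (1 : H K q) ∈ S)
    (hT : ∀ i, i + 1 < n → ∀ s ∈ S, s * T i ∈ S) {x : H K q} (hx : x ∈ HN n) : x ∈ S := by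
  suffices h : ∀ s ∈ S, s * x ∈ S by simpa using h 1 h1
  induction hx using Algebra.adjoin_induction with
  | mem x hx => obtain ⟨i, hi, rfl⟩ := hx; exact hT i hi
  | algebraMap r => intro s hs; rw [← Algebra.commutes, ← Algebra.smul_def]; exact S.smul_mem _ hs
  | add x y _ _ hx hy => intro s hs; rw [mul_add]; exact add_mem (hx s hs) (hy s hs)
  | mul x y _ _ hx hy => intro s hs; rw [← mul_assoc]; exact hy _ (hx s hs)

theorem span_right_closed {S : Set (H K q)} {z : H K q}
    (h : ∀ s ∈ S, s * z ∈ Submodule.span K S) : ∀ s ∈ Submodule.span K S, s * z ∈ Submodule.span K S := by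
  intro s hs
  induction hs using Submodule.span_induction with
  | mem x hx => exact h x hx
  | zero => simp
  | add x y _ _ hx hy => rw [add_mul]; exact add_mem hx hy
  | smul c x _ hx => rw [smul_mul_assoc]; exact Submodule.smul_mem _ _ hx

theorem S1 {n : ℕ} {x : H K q} (hx : x ∈ HN (n + 1)) :
    x ∈ Submodule.span K {x : H K q | ∃ h ∈ HN (K := K) (q := q) n, ∃ a ≤ n, x = h * Dw n a} := by
  apply span_of_right (n := n + 1) _ _ hx
  · exact Submodule.subset_span ⟨1, one_mem _, n, le_rfl, by rw [Dw_of_le le_rfl, one_mul]⟩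
  · intro i hi
    apply span_right_closed
    rintro s ⟨h, hh, a, ha, rfl⟩
    rcases Nat.lt_trichotomy (i + 1) a with h1 | h1 | h1
    · rw [mul_assoc, Dw_T_far h1, ← mul_assoc]
      exact Submodule.subset_span ⟨_, mul_mem hh (T_mem (by omega)), a, ha, rfl⟩
    · subst h1
      rw [mul_assoc, ← Dw_right (by omega)]
      exact Submodule.subset_span ⟨_, hh, i, by omega, rfl⟩
    · rcases Nat.lt_or_ge a i with h2 | h2
      · rw [mul_assoc, Dw_T_in h2 (by omega), ← mul_assoc]
        exact Submodule.subset_span ⟨_, mul_mem hh (T_mem (by omega)), a, ha, rfl⟩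
      · obtain rfl : a = i := by omega
        rw [mul_assoc, Dw_T_eq (by omega), mul_add, mul_smul_comm, mul_smul_comm]
        exact add_mem (Submodule.smul_mem _ _ (Submodule.subset_span ⟨_, hh, a, ha, rfl⟩))
          (Submodule.smul_mem _ _ (Submodule.subset_span ⟨_, hh, a + 1, by omega, rfl⟩))

/-- `HN (n+2) = HN (n+1) + HN (n+1) T_n HN (n+1)`. -/
theorem S2 {n : ℕ} {x : H K q} (hx : x ∈ HN (n + 2)) :
    x ∈ Submodule.span K {x : H K q | x ∈ HN (K := K) (q := q) (n + 1) ∨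
      ∃ a ∈ HN (K := K) (q := q) (n+1), ∃ b ∈ HN (K := K) (q := q) (n+1), x = a * T n * b} := by
  refine Submodule.span_mono ?_ (S1 hx)
  rintro x ⟨h, hh, a, ha, rfl⟩
  rcases Nat.lt_or_ge n a with h1 | h1
  · left; rw [Dw_of_le (by omega), mul_one]; exact hh
  · right; exact ⟨h, hh, _, Dw_mem n a, by rw [Dw_succ h1, mul_assoc]⟩

theorem S3 {n : ℕ} {x : H K q} (hx : x ∈ HN (n + 1)) :
    x ∈ Submodule.span K {x : H K q | ∃ h ∈ HN (K := K) (q := q) n, ∃ a ≤ n, x = sh 1 h * c1 a} := by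
  apply span_of_right (n := n + 1) _ _ hx
  · exact Submodule.subset_span ⟨1, one_mem _, 0, by omega, by simp [c1]⟩
  · intro i hi
    apply span_right_closed
    rintro s ⟨h, hh, a, ha, rfl⟩
    rcases Nat.lt_trichotomy i a with h1 | h1 | h1
    · rcases Nat.lt_or_ge (i + 1) a with h2 | h2
      · rw [mul_assoc, c1_T h2, ← mul_assoc]
        exact Submodule.subset_span ⟨h * T i, mul_mem hh (T_mem (by omega)), a, ha, by
          rw [map_mul, sh_T]⟩
      · obtain rfl : a = i + 1 := by omega
        rw [mul_assoc, c1_s, mul_assoc, T_quad, mul_add, mul_smul_comm, ← c1_s, ← Algebra.commutes,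
          ← Algebra.smul_def, mul_add, mul_smul_comm, mul_smul_comm]
        exact add_mem (Submodule.smul_mem _ _ (Submodule.subset_span ⟨_, hh, i+1, ha, rfl⟩))
          (Submodule.smul_mem _ _ (Submodule.subset_span ⟨_, hh, i, by omega, rfl⟩))
    · subst h1
      rw [mul_assoc, ← c1_s]
      exact Submodule.subset_span ⟨_, hh, i+1, by omega, rfl⟩
    · obtain ⟨i, rfl⟩ : ∃ j, i = j + 1 := ⟨i - 1, by omega⟩
      rw [mul_assoc, comm_T (n := a + 1) (by omega) (c1_mem a), ← mul_assoc]
      exact Submodule.subset_span ⟨h * T i, mul_mem hh (T_mem (by omega)), a, ha, by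
          rw [map_mul, sh_T]⟩

theorem S3' {n : ℕ} {x : H K q} (hx : x ∈ HN (n + 1)) :
    x ∈ Submodule.span K {x : H K q | (∃ h ∈ HN (K := K) (q := q) n, x = sh 1 h) ∨
      ∃ a ∈ HN (K := K) (q := q) n, ∃ b ∈ HN (K := K) (q := q) n, x = sh 1 a * T 0 * sh 1 b} := by
  refine Submodule.span_mono ?_ (S3 hx)
  rintro x ⟨h, hh, a, ha, rfl⟩
  rcases a with _ | a
  · left; exact ⟨h, hh, by simp [c1]⟩
  · right; exact ⟨h, hh, c1 a, HN_mono (by omega) (c1_mem a), by rw [c1_succ', mul_assoc]⟩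

theorem ant_sh (n : ℕ) (x : H K q) : ant (sh n x) = sh n (ant x) := by
  obtain ⟨N, hN⟩ := exists_HN x
  induction hN using Algebra.adjoin_induction with
  | mem y hy => obtain ⟨i, hi, rfl⟩ := hy; simp
  | algebraMap r => simp
  | add y z _ _ hy hz => simp [hy, hz]
  | mul y z _ _ hy hz => simp [hy, hz]

def antL : H K q →ₗ[K] H K q where
  toFun := ant
  map_add' := ant_add
  map_smul' := ant_smul

theorem span_ant {S S' : Set (H K q)} (h : ∀ s ∈ S, ant s ∈ S') {x : H K q}
    (hx : x ∈ Submodule.span K S) : ant x ∈ Submodule.span K S' := by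
  have : Submodule.span K S ≤ (Submodule.span K S').comap antL :=
    Submodule.span_le.2 (fun s hs => Submodule.subset_span (h s hs))
  exact this hx

/-- `T_a ⋯ T_{n-1}` -/
def Uw (n a : ℕ) : H K q := ant (Dw n a)

theorem Uw_zero (n : ℕ) : (Uw n 0 : H K q) = c1 n := by
  induction n with
  | zero => simp [Uw, Dw, c1]
  | succ n ih => rw [Uw, Dw_succ (by omega), ant_mul, ant_T, c1_s, ← ih, Uw]

theorem Dw_sh (n a : ℕ) : (Dw (n+1) (a+1) : H K q) = sh 1 (Dw n a) := by
  induction n with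
  | zero => rw [Dw_of_le (by omega), Dw_of_le (by omega), map_one]
  | succ n ih =>
    rcases Nat.lt_or_ge n a with h | h
    · rw [Dw_of_le (by omega), Dw_of_le (by omega), map_one]
    · rw [Dw_succ (by omega), ih, Dw_succ h, map_mul, sh_T]

theorem S4 {n : ℕ} {x : H K q} (hx : x ∈ HN (n + 1)) :
    x ∈ Submodule.span K {x : H K q | (∃ a ∈ HN (K := K) (q := q) n, ∃ b ∈ HN (K := K) (q := q) n,
      x = sh 1 a * b) ∨ ∃ b ∈ HN (K := K) (q := q) n, x = c1 n * b} := by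
  have := span_ant (S' := {x : H K q | (∃ a ∈ HN (K := K) (q := q) n, ∃ b ∈ HN (K := K) (q := q) n,
      x = sh 1 a * b) ∨ ∃ b ∈ HN (K := K) (q := q) n, x = c1 n * b}) ?_ (S1 (ant_mem hx))
  · rwa [ant_ant] at this
  · rintro s ⟨h, hh, a, ha, rfl⟩
    rcases a with _ | a
    · right; exact ⟨ant h, ant_mem hh, by rw [ant_mul, ← Uw_zero, Uw]⟩
    · left
      obtain ⟨n, rfl⟩ : ∃ j, n = j + 1 := ⟨n - 1, by omega⟩
      exact ⟨ant (Dw n a), ant_mem (Dw_mem n a), ant h, ant_mem hh, by rw [ant_mul, Dw_sh, ant_sh]⟩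

/-- conjugation by `Dw n 0` -/
theorem Dw_conj {n : ℕ} {x : H K q} (h : x ∈ HN n) : Dw n 0 * sh 1 x = x * Dw n 0 := by
  have := congrArg ant (c1_conj (ant_mem h))
  rw [ant_mul, ant_mul, ← ant_sh, ant_ant, ant_ant, ← Uw_zero, Uw, ant_ant] at this
  exact this.symm

theorem Dw_inv (hq : q ≠ 0) (n : ℕ) : ∃ y ∈ HN (K := K) (q := q) (n + 1), Dw n 0 * y = 1 ∧ y * Dw n 0 = 1 := by
  obtain ⟨y, hy, h1, h2⟩ := c1_inv (K := K) hq n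
  refine ⟨ant y, ant_mem hy, ?_, ?_⟩
  · have := congrArg ant h2
    rwa [ant_mul, ← Uw_zero, Uw, ant_ant, ant_one] at this
  · have := congrArg ant h1
    rwa [ant_mul, ← Uw_zero, Uw, ant_ant, ant_one] at this

/-- sign character -/
def sgn : H K q →ₐ[K] K := lft (fun _ => -1) (fun _ _ _ => rfl) (fun _ => rfl)
  (fun i => by simp)

@[simp] theorem sgn_T (i : ℕ) : sgn (T i : H K q) = -1 := lft_T _ _ _ _ _

theorem sgn_ant (x : H K q) : sgn (ant x) = sgn x := by
  obtain ⟨N, hN⟩ := exists_HN x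
  induction hN using Algebra.adjoin_induction with
  | mem y hy => obtain ⟨i, hi, rfl⟩ := hy; simp
  | algebraMap r => simp
  | add y z _ _ hy hz => simp [hy, hz]
  | mul y z _ _ hy hz => simp [hy, hz, mul_comm]

theorem sgn_Dw {n a : ℕ} (h : a ≤ n) : sgn (Dw n a : H K q) = (-1) ^ (n - a) := by
  induction n with
  | zero => simp [Dw]
  | succ n ih =>
    rcases Nat.lt_or_ge n a with h' | h'
    · rw [Dw_of_le (by omega), map_one, show n + 1 - a = 0 by omega, pow_zero]
    · rw [Dw_succ h', map_mul, ih h', sgn_T, show n + 1 - a = (n - a) + 1 by omega, pow_succ]; ring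

def qn (q : K) (n : ℕ) : K := ∑ i ∈ Finset.range n, q ^ i

def zc (q : K) (n j : ℕ) : K := (-1) ^ (n - j) * q ^ j

/-- sum used for antisymmetrizers -/
def XS (n : ℕ) : H K q := ∑ j ∈ Finset.range (n + 1), zc q n j • Dw n j

def AS : ℕ → H K q
  | 0 => 1
  | n + 1 => AS n * ((qn q (n+1))⁻¹ • XS n)

theorem AS_s (n : ℕ) : (AS (n+1) : H K q) = AS n * ((qn q (n+1))⁻¹ • XS n) := rfl

theorem XS_mem (n : ℕ) : (XS n : H K q) ∈ HN (n+1) :=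
  Subalgebra.sum_mem _ (fun j _ => Subalgebra.smul_mem _ (Dw_mem n j) _)

theorem AS_mem (n : ℕ) : (AS n : H K q) ∈ HN n := by
  induction n with
  | zero => exact one_mem _
  | succ n ih => exact mul_mem (HN_mono (by omega) ih) (Subalgebra.smul_mem _ (XS_mem n) _)

theorem sgn_XS (n : ℕ) : sgn (XS n : H K q) = qn q (n+1) := by
  rw [XS, map_sum, qn]
  refine Finset.sum_congr rfl (fun j hj => ?_)
  rw [Finset.mem_range] at hj
  rw [map_smul, sgn_Dw (by omega), zc, smul_eq_mul, mul_right_comm, ← mul_pow]; simp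

theorem sgn_AS (hq : ∀ n, qn q (n+1) ≠ 0) (n : ℕ) : sgn (AS n : H K q) = 1 := by
  induction n with
  | zero => simp [AS]
  | succ n ih => rw [AS_s, map_mul, ih, map_smul, sgn_XS, smul_eq_mul, inv_mul_cancel₀ (hq n), one_mul]

theorem AS_right0 (n : ℕ) {x : H K q} (hx : x ∈ HN n) (h : ∀ i, i + 1 < n → (AS n : H K q) * T i = - AS n) :
    AS n * x = sgn x • AS n := by
  induction hx using Algebra.adjoin_induction with
  | mem y hy => obtain ⟨i, hi, rfl⟩ := hy; simp [h i hi]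
  | algebraMap r => rw [← Algebra.commutes, AlgHom.commutes, Algebra.smul_def]; rfl
  | add y z _ _ hy hz => rw [mul_add, hy, hz, map_add, add_smul]
  | mul y z _ _ hy hz => rw [← mul_assoc, hy, smul_mul_assoc, hz, map_mul, smul_smul]

theorem AS_XS_T (n i : ℕ) (hi : i < n) (h : ∀ i, i + 1 < n → (AS n : H K q) * T i = - AS n) :
    (AS n * XS n : H K q) * T i = - (AS n * XS n) := by
  have key : (AS n : H K q) * XS n = ∑ j ∈ Finset.range (n+1), zc q n j • (AS n * Dw n j) := by
    rw [XS, Finset.mul_sum]; exact Finset.sum_congr rfl (fun j _ => by rw [mul_smul_comm])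
  have key2 : (AS n * XS n : H K q) * T i + AS n * XS n =
    ∑ j ∈ Finset.range (n+1), zc q n j • (AS n * Dw n j * T i + AS n * Dw n j) := by
    rw [key, Finset.sum_mul, ← Finset.sum_add_distrib]
    exact Finset.sum_congr rfl (fun j _ => by rw [smul_mul_assoc, smul_add])
  rw [eq_neg_iff_add_eq_zero, key2]
  have hz : zc q n (i+1) = - q * zc q n i := by
    rw [zc, zc, show n - i = (n - (i+1)) + 1 by omega]; ring
  rw [← Finset.sum_subset (s₁ := {i, i+1}) (by
    intro j; simp only [Finset.mem_insert, Finset.mem_singleton, Finset.mem_range]; omega)]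
  · rw [Finset.sum_pair (by omega), hz, mul_assoc, Dw_T_eq hi, mul_assoc, ← Dw_right hi, mul_add,
      mul_smul_comm, mul_smul_comm]
    module
  · intro j hj hj'
    simp only [Finset.mem_insert, Finset.mem_singleton, Finset.mem_range] at hj hj'
    rcases Nat.lt_or_ge (i+1) j with h1 | h1
    · rw [mul_assoc, Dw_T_far h1, ← mul_assoc, h i (by omega), neg_mul, neg_add_cancel, smul_zero]
    · rw [mul_assoc, Dw_T_in (by omega) hi, ← mul_assoc, h (i-1) (by omega), neg_mul, neg_add_cancel, smul_zero]

theorem AS_T (n : ℕ) : ∀ i, i + 1 < n → (AS n : H K q) * T i = - AS n := by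
  induction n with
  | zero => intro i hi; omega
  | succ n ih =>
    intro i hi
    rw [AS_s, mul_smul_comm, smul_mul_assoc, AS_XS_T n i (by omega) ih, smul_neg]

theorem AS_right (n : ℕ) {x : H K q} (hx : x ∈ HN n) : AS n * x = sgn x • AS n := AS_right0 n hx (AS_T n)

theorem ant_AS (hq : ∀ n, qn q (n+1) ≠ 0) (n : ℕ) : ant (AS n : H K q) = AS n := by
  have h1 : (AS n : H K q) * ant (AS n) = AS n := by
    rw [AS_right n (ant_mem (AS_mem n)), sgn_ant, sgn_AS hq, one_smul]
  have h2 := congrArg ant h1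
  rw [ant_mul, ant_ant] at h2
  exact h2.symm.trans h1

theorem AS_left (hq : ∀ n, qn q (n+1) ≠ 0) (n : ℕ) {x : H K q} (hx : x ∈ HN n) :
    x * AS n = sgn x • AS n := by
  have := congrArg ant (AS_right n (ant_mem hx))
  rwa [ant_mul, ant_ant, ant_smul, ant_AS hq, sgn_ant] at this

end HS

namespace HS
variable {K : Type} [Field K] {q : K}

theorem span_zero {M M' : Type} [AddCommGroup M] [Module K M] [AddCommGroup M'] [Module K M'] {S : Set M}
    (F : M →ₗ[K] M') (h : ∀ s ∈ S, F s = 0) {x : M}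
    (hx : x ∈ Submodule.span K S) : F x = 0 := by
  have : Submodule.span K S ≤ LinearMap.ker F := Submodule.span_le.2 (fun s hs => h s hs)
  exact this hx

theorem sh1_mem {n : ℕ} {x : H K q} (h : x ∈ HN n) : sh 1 x ∈ HN (K := K) (q := q) (n + 1) := sh_mem h

structure IsTr (N : ℕ) (t : ℕ → H K q →ₗ[K] K) (p : ℕ → K) : Prop where
  one : t 0 1 = 1
  tr : ∀ n ≤ N, ∀ x ∈ HN (K := K) (q := q) n, ∀ y ∈ HN (K := K) (q := q) n, t n (x * y) = t n (y * x)
  mkv : ∀ j k, j + k + 1 ≤ N → ∀ a ∈ HN (K := K) (q := q) j, t (j + k + 1) (a * sh j (c1 k)) = t j a * p (k + 1)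

theorem IsTr.step {N : ℕ} {t : ℕ → H K q →ₗ[K] K} {p : ℕ → K} (h : IsTr N t p) {n : ℕ} (hn : n + 1 ≤ N)
    {a : H K q} (ha : a ∈ HN n) : t (n+1) a = t n a * p 1 := by
  have := h.mkv n 0 hn a ha
  simpa [c1] using this

theorem abs_lem {n : ℕ} (F : H K q →ₗ[K] K)
    (htr : ∀ x ∈ HN (K := K) (q := q) (n + 2), ∀ y ∈ HN (K := K) (q := q) (n + 2), F (x * y) = F (y * x))
    (hF : ∀ j k, j + k = n → ∀ a ∈ HN (K := K) (q := q) j, F (a * sh j (c1 (k+1))) = 0)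
    {a : H K q} (ha : a ∈ HN (n + 1)) : F (a * T n) = 0 := by
  have hF1 : ∀ k, k ≤ n → ∀ a ∈ HN (K := K) (q := q) (k+1), F (a * sh (k+1) (c1 (n-k))) = 0 ∨ k = n := by
    intro k hk a ha
    rcases Nat.lt_or_ge k n with h | h
    · left
      have := hF (k+1) (n-k-1) (by omega) a ha
      rwa [show n - k - 1 + 1 = n - k by omega] at this
    · right; omega
  have claim : ∀ m ≤ n, ∀ a ∈ HN (K := K) (q := q) (m+1), F (a * sh m (c1 (n - m + 1))) = 0 := by
    intro m
    induction m with
    | zero =>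
      intro _ a ha
      obtain ⟨c, rfl⟩ := HN_le_one (by omega) ha
      rw [← Algebra.smul_def, map_smul]
      have := hF 0 n (by omega) 1 (one_mem _)
      rw [one_mul] at this
      rw [Nat.sub_zero, this, smul_zero]
    | succ m ih =>
      intro hm a ha
      have := span_zero (F ∘ₗ LinearMap.mulRight K (sh (m+1) (c1 (n - (m+1) + 1)))) ?_ (S2 ha)
      · simpa using this
      · rintro s (hs | ⟨a, ha, b, hb, rfl⟩)
        · have := hF (m+1) (n-(m+1)) (by omega) s hs
          simpa using this
        · simp only [LinearMap.comp_apply, LinearMap.mulRight_apply]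
          have hy : sh (m+1) (c1 (n - (m+1) + 1)) ∈ HN (K := K) (q := q) (n+2) :=
            HN_mono (by omega) (sh_mem (c1_mem _))
          rw [mul_assoc, comm_sh hb le_rfl, ← mul_assoc, htr _ _ _ (HN_mono (by omega) hb)]
          · have h2 := ih (by omega) (b * a) (mul_mem hb ha)
            rw [show n - m + 1 = (n - (m+1) + 1) + 1 by omega, c1_succ', map_mul (sh m), sh_T, sh_sh] at h2
            rw [← h2]; congr 1
            simp only [mul_assoc, zero_add]
          · exact mul_mem (mul_mem (HN_mono (by omega) ha) (T_mem (by omega))) hy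
  have := claim n le_rfl a ha
  rw [Nat.sub_self, c1_s] at this
  simpa [c1] using this

theorem IsTr.uniq {N : ℕ} {t t' : ℕ → H K q →ₗ[K] K} {p p' : ℕ → K} (h : IsTr N t p) (h' : IsTr N t' p')
    (hp : ∀ k, 1 ≤ k → k ≤ N → p k = p' k) : ∀ n ≤ N, ∀ x ∈ HN (K := K) (q := q) n, t n x = t' n x := by
  intro n
  induction n using Nat.strong_induction_on with
  | _ n ih =>
    intro hn x hx
    rcases n with _ | n
    · obtain ⟨c, rfl⟩ := HN_le_one (by omega) hx
      rw [Algebra.algebraMap_eq_smul_one, map_smul, map_smul, h.one, h'.one]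
    · have hmk : ∀ j k, j + k = n → ∀ a ∈ HN (K := K) (q := q) j,
          (t (n+1) - t' (n+1)) (a * sh j (c1 k)) = 0 := by
        rintro j k rfl a ha
        rw [LinearMap.sub_apply, h.mkv j k hn a ha, h'.mkv j k hn a ha, ih j (by omega) (by omega) a ha,
          hp (k+1) (by omega) (by omega), sub_self]
      have h0 : ∀ a ∈ HN (K := K) (q := q) n, (t (n+1) - t' (n+1)) a = 0 := by
        intro a ha
        simpa [c1] using hmk n 0 rfl a ha
      rcases n with _ | n
      · obtain ⟨c, rfl⟩ := HN_le_one (by omega) hx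
        have := h0 (algebraMap K _ c) (Subalgebra.algebraMap_mem _ _)
        exact sub_eq_zero.1 this
      · have htr : ∀ x ∈ HN (K := K) (q := q) (n + 2), ∀ y ∈ HN (K := K) (q := q) (n + 2),
            (t (n+2) - t' (n+2)) (x * y) = (t (n+2) - t' (n+2)) (y * x) := by
          intro x hx y hy
          rw [LinearMap.sub_apply, LinearMap.sub_apply, h.tr _ hn x hx y hy, h'.tr _ hn x hx y hy]
        have hT : ∀ a ∈ HN (K := K) (q := q) (n + 1), (t (n+2) - t' (n+2)) (a * T n) = 0 := fun a ha =>
          abs_lem _ htr (fun j k hjk => hmk j (k+1) (by omega)) ha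
        refine sub_eq_zero.1 (span_zero (t (n+2) - t' (n+2)) ?_ (S2 hx))
        rintro s (hs | ⟨a, ha, b, hb, rfl⟩)
        · exact h0 s hs
        · rw [htr _ (mul_mem (HN_mono (by omega) ha) (T_mem (by omega))) _ (HN_mono (by omega) hb),
            ← mul_assoc]
          exact hT _ (mul_mem hb ha)

/-! Newton identities -/
theorem newton0 (hq : ∀ n, qn q (n+1) ≠ 0) {N : ℕ} {t : ℕ → H K q →ₗ[K] K} {p : ℕ → K} (h : IsTr N t p)
    (n m : ℕ) (hN : n + m + 2 ≤ N) :
    qn q (n+2) * t (n+m+2) (AS (n+2) * sh (n+1) (c1 m)) =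
      q ^ (n+1) * t (n+1) (AS (n+1)) * p (m+1)
        - qn q (n+1) * t (n+m+2) (AS (n+1) * sh n (c1 (m+1))) := by
  have e1 : (AS (n+2) : H K q) = (qn q (n+2))⁻¹ • (AS (n+1) * XS (n+1)) := by
    rw [AS_s, mul_smul_comm]
  rw [e1, smul_mul_assoc, map_smul, smul_eq_mul, ← mul_assoc, mul_inv_cancel₀ (hq _), one_mul]
  rw [XS, Finset.sum_range_succ, mul_add, add_mul, map_add, add_comm, sub_eq_add_neg]
  congr 1
  · rw [Dw_of_le le_rfl, mul_smul_comm, smul_mul_assoc, map_smul, mul_one]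
    have := h.mkv (n+1) m (by omega) _ (AS_mem (n+1))
    rw [show n + 1 + m + 1 = n + m + 2 by ring] at this
    rw [this, zc, Nat.sub_self, smul_eq_mul]; ring
  · rw [Finset.mul_sum, Finset.sum_mul, map_sum, qn, Finset.sum_mul, ← Finset.sum_neg_distrib]
    refine Finset.sum_congr rfl (fun j hj => ?_)
    rw [Finset.mem_range] at hj
    rw [mul_smul_comm, smul_mul_assoc, map_smul, Dw_succ (by omega), smul_eq_mul]
    have hD : (Dw n j : H K q) ∈ HN (n+1) := Dw_mem n j
    have e2 : (AS (n+1) * (T n * Dw n j) * sh (n+1) (c1 m) : H K q) =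
        (AS (n+1) * T n * sh (n+1) (c1 m)) * Dw n j := by
      rw [← mul_assoc, mul_assoc, comm_sh hD le_rfl, ← mul_assoc]
    rw [e2, h.tr (n+m+2) hN _ _ _ (HN_mono (by omega) hD)]
    · rw [mul_assoc, ← mul_assoc (Dw n j), AS_left hq _ hD, sgn_Dw (by omega), smul_mul_assoc, map_smul,
        smul_eq_mul, c1_succ', map_mul (sh n), sh_T, sh_sh, zero_add, ← mul_assoc, ← mul_assoc, zc,
        show n + 1 - j = (n - j) + 1 by omega]
      have : ((-1 : K) ^ (n - j)) * (-1) ^ (n - j) = 1 := by rw [← mul_pow]; simp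
      linear_combination (-(q ^ j) * (t (n + m + 2)) (AS (n + 1) * T n * (sh (n + 1)) (c1 m))) * this
    · exact mul_mem (mul_mem (HN_mono (by omega) (AS_mem _)) (T_mem (by omega)))
        (HN_mono (by omega) (sh_mem (c1_mem _)))

theorem newton1 (hq : ∀ n, qn q (n+1) ≠ 0) {N : ℕ} {t : ℕ → H K q →ₗ[K] K} {p : ℕ → K} (h : IsTr N t p)
    (n : ℕ) : ∀ m, n + m + 1 ≤ N →
    qn q (n+1) * t (n+m+1) (AS (n+1) * sh n (c1 m)) =
      ∑ i ∈ Finset.range (n+1), (-1) ^ (n - i) * q ^ i * t i (AS i) * p (m + 1 + (n - i)) := by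
  induction n with
  | zero =>
    intro m hm
    have := h.mkv 0 m hm 1 (one_mem _)
    rw [show 0 + m + 1 = m + 1 by ring] at *
    simp only [AS, XS, qn] at *
    simp [zc, Dw] at *
    rw [this]
    rfl
  | succ n ih =>
    intro m hm
    have h0 := newton0 hq h n m (by omega)
    rw [show n + 1 + m + 1 = n + m + 2 by ring, h0]
    have h1 := ih (m+1) (by omega)
    rw [show n + (m + 1) + 1 = n + m + 2 by ring] at h1
    rw [h1, Finset.sum_range_succ (n := n+1), sub_eq_add_neg, add_comm, ← Finset.sum_neg_distrib]
    congr 1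
    · refine Finset.sum_congr rfl (fun i hi => ?_)
      rw [Finset.mem_range] at hi
      rw [show n + 1 - i = (n - i) + 1 by omega, show m + 1 + 1 + (n - i) = m + 1 + (n - i + 1) by ring]
      ring
    · simp

theorem newton (hq : ∀ n, qn q (n+1) ≠ 0) {N : ℕ} {t : ℕ → H K q →ₗ[K] K} {p : ℕ → K} (h : IsTr N t p)
    (n : ℕ) (hn : n + 1 ≤ N) :
    qn q (n+1) * t (n+1) (AS (n+1)) =
      ∑ i ∈ Finset.range (n+1), (-1) ^ (n - i) * q ^ i * t i (AS i) * p (1 + (n - i)) := by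
  have := newton1 hq h n 0 hn
  simpa [c1] using this

/-! The Markov-type trace `τ` -/
section tau
variable {N : ℕ} {t : ℕ → H K q →ₗ[K] K} {p : ℕ → K}

theorem tau_T (h : IsTr N t p) (hp : ∀ k, 2 ≤ k → k ≤ N → p k = 0) {n : ℕ} (hn : n + 2 ≤ N)
    {a : H K q} (ha : a ∈ HN (n + 1)) : t (n+2) (a * T n) = 0 := by
  apply abs_lem _ (h.tr _ hn) _ ha
  rintro j k rfl a ha
  have := h.mkv j (k+1) (by omega) a ha
  rw [show j + (k + 1) + 1 = j + k + 2 by ring] at this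
  rw [this, hp _ (by omega) (by omega), mul_zero]

theorem tau_T2 (h : IsTr N t p) (hp : ∀ k, 2 ≤ k → k ≤ N → p k = 0) {n : ℕ} (hn : n + 2 ≤ N)
    {a b : H K q} (ha : a ∈ HN (n + 1)) (hb : b ∈ HN (n + 1)) : t (n+2) (a * T n * b) = 0 := by
  rw [h.tr (n+2) hn _ (mul_mem (HN_mono (by omega) ha) (T_mem (by omega))) _ (HN_mono (by omega) hb),
    ← mul_assoc]
  exact tau_T h hp hn (mul_mem hb ha)

theorem tau_T0 (h : IsTr N t p) (hp : ∀ k, 2 ≤ k → k ≤ N → p k = 0) (n : ℕ) : n + 2 ≤ N →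
    ∀ z ∈ HN (K := K) (q := q) (n+1), t (n+2) (T 0 * sh 1 z) = 0 := by
  induction n with
  | zero =>
    intro hn z hz
    obtain ⟨c, rfl⟩ := HN_le_one (by omega) hz
    have := tau_T h hp hn (one_mem _)
    rw [one_mul] at this
    rw [AlgHom.commutes, ← Algebra.commutes, ← Algebra.smul_def, map_smul, this, smul_zero]
  | succ n ih =>
    intro hn z hz
    have := span_zero (t (n+3) ∘ₗ LinearMap.mulLeft K (T 0) ∘ₗ (sh 1).toLinearMap) ?_ (S2 hz)
    · simpa using this
    · rintro s (hs | ⟨a, ha, b, hb, rfl⟩)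
      · have h1 := ih (by omega) s hs
        simp only [LinearMap.comp_apply, LinearMap.mulLeft_apply, AlgHom.toLinearMap_apply]
        rw [h.step (n := n+2) hn (mul_mem (T_mem (by omega)) (sh1_mem hs)), h1, zero_mul]
      · simp only [LinearMap.comp_apply, LinearMap.mulLeft_apply, AlgHom.toLinearMap_apply, map_mul, sh_T]
        have := tau_T2 h hp (n := n+1) hn (mul_mem (T_mem (by omega)) (sh1_mem ha) : T 0 * sh 1 a ∈ HN (K := K) (q := q) (n+2))
          (sh1_mem hb)
        simpa [mul_assoc] using this

theorem tau_T0' (h : IsTr N t p) (hp : ∀ k, 2 ≤ k → k ≤ N → p k = 0) (n : ℕ) (hn : n + 2 ≤ N)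
    {a b : H K q} (ha : a ∈ HN (n + 1)) (hb : b ∈ HN (n + 1)) : t (n+2) (sh 1 a * T 0 * sh 1 b) = 0 := by
  rw [mul_assoc, h.tr (n+2) hn _ (sh1_mem ha) _ (mul_mem (T_mem (by omega)) (sh1_mem hb)), mul_assoc, ← map_mul]
  exact tau_T0 h hp n hn _ (mul_mem hb ha)

/-- `HN n T_{n-1} HN n` -/
def MM : ℕ → Submodule K (H K q)
  | 0 => ⊥
  | n + 1 => Submodule.span K {x | ∃ a ∈ HN (K := K) (q := q) (n+1), ∃ b ∈ HN (K := K) (q := q) (n+1), x = a * T n * b}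

theorem MM_mem {n : ℕ} {a b : H K q} (ha : a ∈ HN (n+1)) (hb : b ∈ HN (n+1)) : a * T n * b ∈ MM (K := K) (q := q) (n+1) :=
  Submodule.subset_span ⟨a, ha, b, hb, rfl⟩

theorem MM_step {n : ℕ} {x : H K q} (hx : x ∈ MM (K := K) (q := q) n) : T n * x * T n ∈ MM (K := K) (q := q) (n+1) := by
  rcases n with _ | n
  · have : x = 0 := hx
    rw [this]; simp
  · have h : MM (K := K) (q := q) (n+1) ≤ (MM (n+2)).comap (LinearMap.mulRight K (T (n+1)) ∘ₗ LinearMap.mulLeft K (T (n+1))) := by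
      refine Submodule.span_le.2 ?_
      rintro s ⟨a, ha, b, hb, rfl⟩
      change T (n+1) * (a * T n * b) * T (n+1) ∈ MM (K := K) (q := q) (n+2)
      have e : (T (n+1) * (a * T n * b) * T (n+1) : H K q) = (a * T n) * T (n+1) * (T n * b) := by
        calc _ = (T (n+1) * a) * T n * (b * T (n+1)) := by noncomm_ring
          _ = a * (T (n+1) * T n * T (n+1)) * b := by
            rw [← comm_T le_rfl ha, comm_T le_rfl hb]; noncomm_ring
          _ = _ := by rw [← T_braid]; noncomm_ring
      rw [e]
      exact MM_mem (mul_mem (HN_mono (by omega) ha) (T_mem (by omega))) (mul_mem (T_mem (by omega)) (HN_mono (by omega) hb))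
    exact h hx

theorem DU (n : ℕ) : ∀ a ≤ n, ∀ a' ≤ n, ∃ z ∈ MM (K := K) (q := q) n,
    Dw n a' * Uw n a = (if a' = a then q ^ (n - a) else 0) • (1 : H K q) + z := by
  induction n with
  | zero =>
    intro a ha a' ha'
    obtain rfl : a = 0 := by omega
    obtain rfl : a' = 0 := by omega
    exact ⟨0, Submodule.zero_mem _, by simp [Dw, Uw]⟩
  | succ n ih =>
    intro a ha a' ha'
    have hU : ∀ a ≤ n, (Uw (n+1) a : H K q) = Uw n a * T n := fun a ha => by
      rw [Uw, Dw_succ ha, ant_mul, ant_T, Uw]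
    have hU1 : (Uw (n+1) (n+1) : H K q) = 1 := by rw [Uw, Dw_of_le le_rfl, ant_one]
    rcases Nat.lt_or_ge n a' with h1 | h1
    · obtain rfl : a' = n + 1 := by omega
      rw [Dw_of_le le_rfl, one_mul]
      rcases Nat.lt_or_ge n a with h2 | h2
      · obtain rfl : a = n + 1 := by omega
        exact ⟨0, Submodule.zero_mem _, by simp [hU1]⟩
      · refine ⟨Uw (n+1) a, ?_, by rw [if_neg (by omega)]; simp⟩
        have := MM_mem (n := n) (ant_mem (Dw_mem n a)) (one_mem (HN (K := K) (q := q) (n+1)))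
        rw [hU a h2]
        simpa [Uw] using this
    · rw [Dw_succ h1]
      rcases Nat.lt_or_ge n a with h2 | h2
      · obtain rfl : a = n + 1 := by omega
        rw [hU1]
        refine ⟨T n * Dw n a', ?_, by rw [if_neg (by omega)]; simp⟩
        have := MM_mem (n := n) (one_mem (HN (K := K) (q := q) (n+1))) (Dw_mem n a')
        simpa using this
      · obtain ⟨z, hz, e⟩ := ih a h2 a' h1
        rw [hU a h2, show T n * Dw n a' * (Uw n a * T n) = T n * (Dw n a' * Uw n a) * T n by noncomm_ring, e]
        refine ⟨((if a' = a then q ^ (n - a) else 0) * (q - 1)) • T n + T n * z * T n, ?_, ?_⟩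
        · refine add_mem (Submodule.smul_mem _ _ ?_) (MM_step hz)
          have := MM_mem (n := n) (one_mem (HN (K := K) (q := q) (n+1))) (one_mem (HN (K := K) (q := q) (n+1)))
          simpa using this
        · rw [mul_add, add_mul, mul_smul_comm, mul_one, smul_mul_assoc, T_quad, smul_add, smul_smul,
            Algebra.algebraMap_eq_smul_one, smul_smul]
          rw [show (if a' = a then q ^ (n - a) else 0) * q = (if a' = a then q ^ (n + 1 - a) else 0) by
            split_ifs
            · rw [show n + 1 - a = n - a + 1 by omega, pow_succ]
            · simp]
          abel

theorem tau_MM (h : IsTr N t p) (hp : ∀ k, 2 ≤ k → k ≤ N → p k = 0) {n : ℕ} (hn : n + 1 ≤ N)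
    {a z : H K q} (ha : a ∈ HN n) (hz : z ∈ MM (K := K) (q := q) n) : t (n+1) (a * z) = 0 := by
  rcases n with _ | n
  · have : z = 0 := hz
    rw [this]; simp
  · refine span_zero (t (n+2) ∘ₗ LinearMap.mulLeft K a) ?_ hz
    rintro s ⟨b, hb, c, hc, rfl⟩
    simp only [LinearMap.comp_apply, LinearMap.mulLeft_apply]
    rw [← mul_assoc, ← mul_assoc]
    exact tau_T2 h hp hn (mul_mem ha hb) hc

theorem gram (hq : q ≠ 0) (h : IsTr N t p) (hp1 : p 1 = 1) (hp : ∀ k, 2 ≤ k → k ≤ N → p k = 0) (n : ℕ) (hn : n ≤ N) :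
    ∃ (C : Type) (_ : Fintype C) (_ : DecidableEq C) (hb yb : C → H K q) (κ : C → K),
      Fintype.card C = n.factorial ∧ (∀ c, hb c ∈ HN (K := K) (q := q) n) ∧ (∀ c, yb c ∈ HN (K := K) (q := q) n) ∧
      (∀ c, κ c ≠ 0) ∧ (∀ c c', t n (yb c * hb c') = if c' = c then κ c else 0) ∧
      ∀ x ∈ HN (K := K) (q := q) n, x ∈ Submodule.span K (Set.range hb) := by
  induction n with
  | zero =>
    refine ⟨Unit, inferInstance, inferInstance, fun _ => 1, fun _ => 1, fun _ => 1, by simp,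
      fun _ => one_mem _, fun _ => one_mem _, by simp, by simp [h.one], ?_⟩
    intro x hx
    obtain ⟨c, rfl⟩ := HN_le_one (by omega) hx
    rw [Algebra.algebraMap_eq_smul_one]
    exact Submodule.smul_mem _ _ (Submodule.subset_span ⟨(), rfl⟩)
  | succ n ih =>
    obtain ⟨C, i1, i2, hb, yb, κ, hcard, hhb, hyb, hκ, hg, hsp⟩ := ih (by omega)
    refine ⟨C × Fin (n+1), inferInstance, inferInstance, fun c => hb c.1 * Dw n c.2,
      fun c => Uw n c.2 * yb c.1, fun c => κ c.1 * q ^ (n - (c.2 : ℕ)), ?_, ?_, ?_, ?_, ?_, ?_⟩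
    · rw [Fintype.card_prod, hcard, Fintype.card_fin, Nat.factorial_succ, mul_comm]
    · intro c; exact mul_mem (HN_mono (by omega) (hhb _)) (Dw_mem _ _)
    · intro c; exact mul_mem (ant_mem (Dw_mem _ _)) (HN_mono (by omega) (hyb _))
    · intro c; exact mul_ne_zero (hκ _) (pow_ne_zero _ hq)
    · rintro ⟨c, a⟩ ⟨c', a'⟩
      simp only
      have m1 : (Uw n a : H K q) ∈ HN (n+1) := ant_mem (Dw_mem _ _)
      have m2 : yb c * hb c' ∈ HN (K := K) (q := q) n := mul_mem (hyb _) (hhb _)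
      rw [show Uw n a * yb c * (hb c' * Dw n a') = Uw n a * (yb c * hb c' * Dw n a') by noncomm_ring,
        h.tr (n+1) hn _ m1 _ (mul_mem (HN_mono (by omega) m2) (Dw_mem _ _)), mul_assoc]
      obtain ⟨z, hz, e⟩ := DU (K := K) (q := q) n a (by omega) a' (by omega)
      rw [e, mul_add, map_add, tau_MM h hp hn m2 hz, add_zero, mul_smul_comm, mul_one, map_smul,
        h.step hn m2, hg, hp1, mul_one, smul_eq_mul]
      by_cases h1 : c' = c <;> by_cases h2 : a' = a
      · simp [h1, h2, mul_comm]
      · rw [if_neg (fun hh => h2 (Fin.ext hh)), if_neg (fun hh => h2 (Prod.ext_iff.1 hh).2), zero_mul]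
      · simp [h1]
      · simp [h1]
    · intro x hx
      refine Submodule.span_le.2 ?_ (S1 hx)
      rintro s ⟨g, hg, a, ha, rfl⟩
      have : Submodule.span K (Set.range hb) ≤ (Submodule.span K (Set.range fun c : C × Fin (n+1) => hb c.1 * Dw n c.2)).comap
          (LinearMap.mulRight K (Dw n a)) := by
        refine Submodule.span_le.2 ?_
        rintro _ ⟨c, rfl⟩
        exact Submodule.subset_span ⟨(c, ⟨a, by omega⟩), rfl⟩
      exact this (hsp g hg)

theorem gram_nondeg (hq : q ≠ 0) (h : IsTr N t p) (hp1 : p 1 = 1) (hp : ∀ k, 2 ≤ k → k ≤ N → p k = 0) {n : ℕ} (hn : n ≤ N)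
    {x : H K q} (hx : x ∈ HN n) (hx0 : ∀ y ∈ HN (K := K) (q := q) n, t n (y * x) = 0) : x = 0 := by
  obtain ⟨C, i1, i2, hb, yb, κ, hcard, hhb, hyb, hκ, hg, hsp⟩ := gram hq h hp1 hp n hn
  obtain ⟨f, rfl⟩ := (Submodule.mem_span_range_iff_exists_fun K).1 (hsp x hx)
  apply Finset.sum_eq_zero
  intro c _
  have := hx0 (yb c) (hyb c)
  rw [Finset.mul_sum, map_sum] at this
  simp only [mul_smul_comm, map_smul, hg, smul_eq_mul, mul_ite, mul_zero, Finset.sum_ite_eq', Finset.mem_univ, if_true] at this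
  rw [(mul_eq_zero.1 this).resolve_right (hκ c), zero_smul]

end tau

end HS

namespace HS

theorem exists_eps (F B : Type) [Field F] [Ring B] [Algebra F B] [Nontrivial B] :
    ∃ f : B →ₗ[F] F, f 1 = 1 := by
  obtain ⟨g, hg⟩ := LinearMap.exists_leftInverse_of_injective (Algebra.linearMap F B)
    (LinearMap.ker_eq_bot.2 (FaithfulSMul.algebraMap_injective F B))
  refine ⟨g, ?_⟩
  have := DFunLike.congr_fun hg 1
  simpa using this

def eps (F B : Type) [Field F] [Ring B] [Algebra F B] [Nontrivial B] : B →ₗ[F] F := (exists_eps F B).choose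
@[simp] theorem eps_one (F B : Type) [Field F] [Ring B] [Algebra F B] [Nontrivial B] : eps F B 1 = 1 :=
  (exists_eps F B).choose_spec

def Wd (ι : Type) : ℕ → Type
  | 0 => Unit
  | n + 1 => ι × Wd ι n

instance Wd.instF (ι : Type) [Fintype ι] : ∀ n, Fintype (Wd ι n)
  | 0 => inferInstanceAs (Fintype Unit)
  | n + 1 => by
    haveI := Wd.instF ι n
    exact inferInstanceAs (Fintype (ι × Wd ι n))

instance Wd.instD (ι : Type) [DecidableEq ι] : ∀ n, DecidableEq (Wd ι n)
  | 0 => inferInstanceAs (DecidableEq Unit)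
  | n + 1 => by
    haveI := Wd.instD ι n
    exact inferInstanceAs (DecidableEq (ι × Wd ι n))

theorem Wd.sum_succ {ι M : Type} [Fintype ι] [AddCommMonoid M] (n : ℕ) (f : Wd ι (n+1) → M) :
    ∑ w, f w = ∑ a : ι, ∑ w : Wd ι n, f (a, w) :=
  Fintype.sum_prod_type (f : ι × Wd ι n → M)

def Wd.nil {ι : Type} : Wd ι 0 := ()

theorem Wd.eq_nil {ι : Type} (w : Wd ι 0) : w = Wd.nil := Subsingleton.elim (α := Unit) w ()

theorem Wd.sum_zero {ι M : Type} [Fintype ι] [AddCommMonoid M] (f : Wd ι 0 → M) :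
    ∑ w, f w = f Wd.nil := by
  rw [show (Finset.univ : Finset (Wd ι 0)) = {Wd.nil} from rfl, Finset.sum_singleton]

theorem Wd.card {ι : Type} [Fintype ι] (n : ℕ) : Fintype.card (Wd ι n) = Fintype.card ι ^ n := by
  induction n with
  | zero => rfl
  | succ n ih =>
    have : Fintype.card (Wd ι (n+1)) = Fintype.card ι * Fintype.card (Wd ι n) := Fintype.card_prod ι (Wd ι n)
    rw [this, ih, pow_succ, mul_comm]

/-- Leavitt-type data -/
structure Lv (ι B : Type) [Fintype ι] [DecidableEq ι] [Ring B] where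
  e : ι → B
  d : ι → B
  de : ∀ a b, d a * e b = if a = b then 1 else 0
  ed : ∑ a, e a * d a = 1

namespace Lv
variable {F : Type} [Field F] {ι B : Type} [Fintype ι] [DecidableEq ι] [Ring B] [Algebra F B]

section
variable (l : Lv ι B)

def s (A : B) : B := ∑ a, l.e a * A * l.d a

theorem s_e (A : B) (a : ι) : l.s A * l.e a = l.e a * A := by
  rw [s, Finset.sum_mul]
  simp only [mul_assoc, l.de, mul_ite, mul_one, mul_zero, Finset.sum_ite_eq', Finset.mem_univ, if_true]

theorem d_s (A : B) (a : ι) : l.d a * l.s A = A * l.d a := by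
  rw [s, Finset.mul_sum]
  simp only [← mul_assoc, l.de, ite_mul, one_mul, zero_mul, Finset.sum_ite_eq, Finset.mem_univ, if_true]

theorem eq_of_e {x y : B} (h : ∀ a, x * l.e a = y * l.e a) : x = y := by
  rw [← mul_one x, ← mul_one y, ← l.ed, Finset.mul_sum, Finset.mul_sum]
  exact Finset.sum_congr rfl (fun a _ => by rw [← mul_assoc, h, mul_assoc])

theorem eq_of_d {x y : B} (h : ∀ a, l.d a * x = l.d a * y) : x = y := by
  rw [← one_mul x, ← one_mul y, ← l.ed, Finset.sum_mul, Finset.sum_mul]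
  exact Finset.sum_congr rfl (fun a _ => by rw [mul_assoc, h, mul_assoc])

theorem s_mul (x y : B) : l.s (x * y) = l.s x * l.s y :=
  l.eq_of_e (fun a => by rw [s_e, mul_assoc, s_e, ← mul_assoc, ← mul_assoc, s_e])

theorem s_one : l.s 1 = 1 := l.eq_of_e (fun a => by rw [s_e]; simp)

variable (F) in
/-- shift as algebra hom -/
def sa : B →ₐ[F] B where
  toFun := l.s
  map_one' := l.s_one
  map_mul' := l.s_mul
  map_zero' := by simp [s]
  map_add' x y := by simp [s, mul_add, add_mul, Finset.sum_add_distrib]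
  commutes' r := l.eq_of_e (fun a => by
    rw [s_e, Algebra.commutes])

@[simp] theorem sa_apply (x : B) : l.sa F x = l.s x := rfl

def pw : ∀ n, Lv (Wd ι n) B
  | 0 => { e := fun _ => 1, d := fun _ => 1, de := fun a b => by
             rw [Wd.eq_nil a, Wd.eq_nil b, if_pos rfl, mul_one], ed := by
             rw [Wd.sum_zero, mul_one] }
  | n + 1 =>
    { e := fun w => l.e w.1 * (pw n).e w.2
      d := fun w => (pw n).d w.2 * l.d w.1
      de := fun w w' => by
        rw [mul_assoc, ← mul_assoc (l.d _), l.de]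
        have : (w = w') ↔ w.1 = w'.1 ∧ w.2 = w'.2 := Prod.ext_iff
        by_cases h : w.1 = w'.1
        · rw [if_pos h, one_mul, (pw n).de]
          simp [this, h]
        · rw [if_neg h, if_neg (fun hh => h (this.1 hh).1)]; simp
      ed := by
        rw [Wd.sum_succ, ← l.ed]
        refine Finset.sum_congr rfl (fun a _ => ?_)
        have : ∀ w : Wd ι n, l.e a * (pw n).e w * ((pw n).d w * l.d a) = l.e a * ((pw n).e w * (pw n).d w) * l.d a := by
          intro w; noncomm_ring
        simp only [this]
        rw [← Finset.sum_mul, ← Finset.mul_sum, (pw n).ed, mul_one] }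

theorem pw_e0 (w) : (l.pw 0).e w = 1 := rfl
theorem pw_d0 (w) : (l.pw 0).d w = 1 := rfl
theorem pw_e (n : ℕ) (a : ι) (w : Wd ι n) : (l.pw (n+1)).e (a, w) = l.e a * (l.pw n).e w := rfl
theorem pw_d (n : ℕ) (a : ι) (w : Wd ι n) : (l.pw (n+1)).d (a, w) = (l.pw n).d w * l.d a := rfl

theorem pw_last (n : ℕ) : ∀ w : Wd ι (n+1), ∃ (w' : Wd ι n) (a : ι),
    (l.pw (n+1)).e w = (l.pw n).e w' * l.e a ∧ (l.pw (n+1)).d w = l.d a * (l.pw n).d w' := by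
  induction n with
  | zero => rintro ⟨a, w⟩; exact ⟨w, a, by simp [pw_e, pw_d, pw_e0, pw_d0]⟩
  | succ n ih =>
    rintro ⟨a, w⟩
    obtain ⟨w', b, h1, h2⟩ := ih w
    exact ⟨(a, w'), b, by rw [pw_e, h1, pw_e, mul_assoc], by rw [pw_d, h2, pw_d, mul_assoc]⟩

end

variable (l : Lv ι B)

variable (F) in
/-- bidegree -/
def S (M N : ℕ) (y : B) : Prop := ∀ (m : Wd ι M) (w : Wd ι N), ∃ c : F, (l.pw M).d m * y * (l.pw N).e w = algebraMap F B c

variable {l}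
theorem S.add {M N : ℕ} {x y : B} (hx : l.S F M N x) (hy : l.S F M N y) : l.S F M N (x + y) := by
  intro m w
  obtain ⟨a, ha⟩ := hx m w
  obtain ⟨b, hb⟩ := hy m w
  exact ⟨a + b, by rw [mul_add, add_mul, ha, hb, map_add]⟩

theorem S.smul {M N : ℕ} {x : B} (c : F) (hx : l.S F M N x) : l.S F M N (c • x) := by
  intro m w
  obtain ⟨a, ha⟩ := hx m w
  exact ⟨c * a, by rw [mul_smul_comm, smul_mul_assoc, ha, map_mul, Algebra.smul_def]⟩

theorem S.zero {M N : ℕ} : l.S F M N 0 := fun m w => ⟨0, by simp⟩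

theorem S.sub {M N : ℕ} {x y : B} (hx : l.S F M N x) (hy : l.S F M N y) : l.S F M N (x - y) := by
  have := hx.add (hy.smul (-1))
  simpa [sub_eq_add_neg] using this

theorem S.sum {M N : ℕ} {J : Type} (s : Finset J) {f : J → B} (h : ∀ j ∈ s, l.S F M N (f j)) :
    l.S F M N (∑ j ∈ s, f j) :=
  Finset.sum_induction f (l.S F M N) (fun _ _ => S.add) S.zero h

theorem S.mul {M N P : ℕ} {x y : B} (hx : l.S F M N x) (hy : l.S F N P y) : l.S F M P (x * y) := by
  intro m w
  choose a ha using fun u => hx m u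
  choose b hb using fun u => hy u w
  refine ⟨∑ u, a u * b u, ?_⟩
  rw [map_sum, ← mul_one x, ← (l.pw N).ed, Finset.mul_sum, Finset.sum_mul, Finset.mul_sum, Finset.sum_mul]
  refine Finset.sum_congr rfl (fun u _ => ?_)
  rw [map_mul, ← ha, ← hb]; noncomm_ring

theorem S.one (N : ℕ) : l.S F N N 1 := by
  intro m w
  rw [mul_one, (l.pw N).de]
  split_ifs
  · exact ⟨1, by simp⟩
  · exact ⟨0, by simp⟩

theorem S.e (a : ι) : l.S F 1 0 (l.e a) := by
  rintro ⟨b, u⟩ w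
  rw [pw_d, pw_d0, pw_e0, one_mul, mul_one, l.de]
  split_ifs
  · exact ⟨1, by simp⟩
  · exact ⟨0, by simp⟩

theorem S.d (a : ι) : l.S F 0 1 (l.d a) := by
  rintro w ⟨b, u⟩
  rw [pw_e, pw_d0, pw_e0, one_mul, mul_one, l.de]
  split_ifs
  · exact ⟨1, by simp⟩
  · exact ⟨0, by simp⟩

theorem S.up {M N : ℕ} {x : B} (hx : l.S F M N x) : l.S F (M+1) (N+1) x := by
  intro m w
  obtain ⟨m', a, -, h2⟩ := l.pw_last _ m
  obtain ⟨w', b, h3, -⟩ := l.pw_last _ w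
  obtain ⟨c, hc⟩ := hx m' w'
  have : (l.pw (M+1)).d m * x * (l.pw (N+1)).e w = l.d a * ((l.pw M).d m' * x * (l.pw N).e w') * l.e b := by
    rw [h2, h3]; noncomm_ring
  rw [this, hc, ← Algebra.commutes, mul_assoc, l.de]
  split_ifs
  · exact ⟨c, by simp⟩
  · exact ⟨0, by simp⟩

theorem S.ups {M N : ℕ} {x : B} (hx : l.S F M N x) (k : ℕ) : l.S F (M+k) (N+k) x := by
  induction k with
  | zero => exact hx
  | succ k ih => exact ih.up

theorem S.upto {M N : ℕ} {x : B} (hx : l.S F M M x) (h : M ≤ N) : l.S F N N x := by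
  obtain ⟨k, rfl⟩ := Nat.exists_eq_add_of_le h
  exact hx.ups k

theorem S.s {M N : ℕ} {x : B} (hx : l.S F M N x) : l.S F (M+1) (N+1) (l.s x) := by
  rintro ⟨a, m⟩ ⟨b, w⟩
  obtain ⟨c, hc⟩ := hx m w
  rw [pw_d, pw_e, mul_assoc, mul_assoc, ← mul_assoc (l.s x), s_e, ← mul_assoc (l.d a), ← mul_assoc (l.d a), l.de]
  split_ifs
  · exact ⟨c, by rw [← hc]; noncomm_ring⟩
  · exact ⟨0, by simp⟩

theorem S.scalar {x : B} (hx : l.S F 0 0 x) : ∃ c : F, x = algebraMap F B c := by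
  obtain ⟨c, hc⟩ := hx Wd.nil Wd.nil
  exact ⟨c, by rw [← hc, pw_d0, pw_e0]; simp⟩

end Lv
end HS

namespace HS

namespace Lv
section mt
variable {F : Type} [Field F] {κ B : Type} [Fintype κ] [DecidableEq κ] [Ring B] [Algebra F B] [Nontrivial B]
variable (l : Lv κ B)

variable (F) in
def mt : B →ₗ[F] Matrix κ κ F where
  toFun y := Matrix.of fun m w => eps F B (l.d m * y * l.e w)
  map_add' x y := by ext; simp [mul_add, add_mul]
  map_smul' c x := by ext; simp

variable (F) in
theorem mt_apply (y : B) (m w : κ) : l.mt F y m w = eps F B (l.d m * y * l.e w) := rfl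

variable (F) in
def Sc (y : B) : Prop := ∀ m w, ∃ c : F, l.d m * y * l.e w = algebraMap F B c

variable {l}
theorem Sc.eq {y : B} (h : l.Sc F y) (m w : κ) : l.d m * y * l.e w = algebraMap F B (l.mt F y m w) := by
  obtain ⟨c, hc⟩ := h m w
  have h1 : eps F B (algebraMap F B c) = c := by
    rw [Algebra.algebraMap_eq_smul_one, map_smul, eps_one, smul_eq_mul, mul_one]
  rw [mt_apply, hc, h1]

theorem mt_mul {x : B} (h : l.Sc F x) (y : B) : l.mt F (x * y) = l.mt F x * l.mt F y := by
  ext m w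
  have hxy : l.d m * (x * y) * l.e w = ∑ u, (l.d m * x * l.e u) * (l.d u * y * l.e w) := by
    calc l.d m * (x * y) * l.e w = l.d m * x * 1 * (y * l.e w) := by noncomm_ring
      _ = _ := by
        rw [← l.ed, Finset.mul_sum, Finset.sum_mul]
        exact Finset.sum_congr rfl (fun u _ => by noncomm_ring)
  rw [Matrix.mul_apply, mt_apply, hxy, map_sum]
  refine Finset.sum_congr rfl (fun u _ => ?_)
  rw [h.eq, ← Algebra.smul_def, map_smul, smul_eq_mul, mt_apply F l y]

theorem mt_one : l.mt F 1 = 1 := by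
  ext m w
  rw [mt_apply, mul_one, l.de, Matrix.one_apply]
  split_ifs <;> simp

theorem mt_inj {x : B} (h : l.Sc F x) (h0 : l.mt F x = 0) : x = 0 := by
  apply l.eq_of_d; intro m
  apply l.eq_of_e; intro w
  rw [h.eq, h0]; simp

theorem mt_G (g : κ → F) : l.mt F (∑ w, g w • (l.e w * l.d w)) = Matrix.diagonal g := by
  ext m w
  rw [mt_apply, Finset.mul_sum, Finset.sum_mul, map_sum, Finset.sum_eq_single m]
  · rw [mul_smul_comm, smul_mul_assoc, map_smul, ← mul_assoc, l.de, if_pos rfl, one_mul, l.de, Matrix.diagonal_apply]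
    split_ifs <;> simp
  · intro b _ hb
    rw [mul_smul_comm, smul_mul_assoc, map_smul, ← mul_assoc, l.de, if_neg (Ne.symm hb)]; simp
  · simp

theorem Sc_G (g : κ → F) : l.Sc F (∑ w, g w • (l.e w * l.d w)) := by
  intro m w
  refine ⟨if m = w then g m else 0, ?_⟩
  rw [Finset.mul_sum, Finset.sum_mul, Finset.sum_eq_single m]
  · rw [mul_smul_comm, smul_mul_assoc, ← mul_assoc, l.de, if_pos rfl, one_mul, l.de]
    split_ifs <;> simp [Algebra.algebraMap_eq_smul_one]
  · intro b _ hb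
    rw [mul_smul_comm, smul_mul_assoc, ← mul_assoc, l.de, if_neg (Ne.symm hb)]; simp
  · simp

theorem tr_mt (g : κ → F) (y : B) : (Matrix.diagonal g * l.mt F y).trace = eps F B (∑ w, g w • (l.d w * y * l.e w)) := by
  rw [Matrix.trace, map_sum]
  refine Finset.sum_congr rfl (fun w _ => ?_)
  rw [Matrix.diag_apply, Matrix.diagonal_mul, mt_apply, map_smul, smul_eq_mul]

theorem mt_comm (g : κ → F) {x : B} (hx : l.Sc F x)
    (hc : (∑ w, g w • (l.e w * l.d w)) * x = x * (∑ w, g w • (l.e w * l.d w))) :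
    Matrix.diagonal g * l.mt F x = l.mt F x * Matrix.diagonal g := by
  have := congrArg (l.mt F) hc
  rwa [mt_mul (Sc_G g), mt_mul hx, mt_G] at this

theorem tr_cyc (g : κ → F) {x y : B} (hx : l.Sc F x) (hy : l.Sc F y)
    (hc : (∑ w, g w • (l.e w * l.d w)) * x = x * (∑ w, g w • (l.e w * l.d w))) :
    eps F B (∑ w, g w • (l.d w * (x * y) * l.e w)) = eps F B (∑ w, g w • (l.d w * (y * x) * l.e w)) := by
  rw [← tr_mt, ← tr_mt, mt_mul hx, mt_mul hy, ← mul_assoc, mt_comm g hx hc, mul_assoc, Matrix.trace_mul_comm,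
    mul_assoc]

end mt

variable {F : Type} [Field F] {ι B : Type} [Fintype ι] [DecidableEq ι] [Ring B] [Algebra F B]
variable (l : Lv ι B) 

/-- weights -/
def gw (g : ι → F) : ∀ n, Wd ι n → F
  | 0, _ => 1
  | n + 1, w => g w.1 * gw g n w.2

theorem gw_s (g : ι → F) (n : ℕ) (a : ι) (w : Wd ι n) : gw g (n+1) (a, w) = g a * gw g n w := rfl
theorem gw_0 (g : ι → F) (w : Wd ι 0) : gw g 0 w = 1 := rfl

def Pt (g : ι → F) : B →ₗ[F] B where
  toFun y := ∑ a, g a • (l.d a * y * l.e a)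
  map_add' x y := by simp [mul_add, add_mul, Finset.sum_add_distrib]
  map_smul' c x := by simp [Finset.smul_sum, smul_comm c]

theorem Pt_apply (g : ι → F) (y : B) : l.Pt g y = ∑ a, g a • (l.d a * y * l.e a) := rfl

def ptN (g : ι → F) : ℕ → B →ₗ[F] B
  | 0 => LinearMap.id
  | n + 1 => ptN g n ∘ₗ l.Pt g

theorem ptN_0 (g : ι → F) (y : B) : l.ptN g 0 y = y := rfl
theorem ptN_s (g : ι → F) (n : ℕ) (y : B) : l.ptN g (n+1) y = l.ptN g n (l.Pt g y) := rfl

theorem ptN_eq (g : ι → F) (n : ℕ) (y : B) :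
    l.ptN g n y = ∑ w, gw g n w • ((l.pw n).d w * y * (l.pw n).e w) := by
  induction n generalizing y with
  | zero => rw [Wd.sum_zero, gw_0, pw_d0, pw_e0, ptN_0]; simp
  | succ n ih =>
    rw [ptN_s, ih, Wd.sum_succ, Finset.sum_comm]
    refine Finset.sum_congr rfl (fun w _ => ?_)
    rw [Pt_apply, Finset.mul_sum, Finset.sum_mul, Finset.smul_sum]
    refine Finset.sum_congr rfl (fun a _ => ?_)
    rw [gw_s, pw_d, pw_e, mul_smul_comm, smul_mul_assoc, smul_smul, mul_comm (g a)]
    congr 1; noncomm_ring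

theorem Pt_s (g : ι → F) (x y z : B) : l.Pt g (l.s x * y * l.s z) = x * l.Pt g y * z := by
  rw [Pt_apply, Pt_apply, Finset.mul_sum, Finset.sum_mul]
  refine Finset.sum_congr rfl (fun a _ => ?_)
  rw [mul_smul_comm, smul_mul_assoc]; congr 1
  rw [mul_assoc, mul_assoc, mul_assoc, s_e, ← mul_assoc, d_s]; noncomm_ring

theorem Pt_s_right (g : ι → F) (y z : B) : l.Pt g (y * l.s z) = l.Pt g y * z := by
  have := l.Pt_s g 1 y z
  simpa [s_one] using this

variable {l} in
theorem S.Pt {M N : ℕ} (g : ι → F) {x : B} (hx : l.S F (M+1) (N+1) x) : l.S F M N (l.Pt g x) := by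
  rw [Pt_apply]
  refine S.sum _ (fun a _ => S.smul _ ?_)
  intro m w
  obtain ⟨c, hc⟩ := hx (a, m) (a, w)
  exact ⟨c, by rw [← hc, pw_d, pw_e]; noncomm_ring⟩

variable {l} in
theorem S.ptN {N : ℕ} (n : ℕ) (g : ι → F) {x : B} (hx : l.S F (N+n) (N+n) x) : l.S F N N (l.ptN g n x) := by
  induction n generalizing x with
  | zero => exact hx
  | succ n ih => rw [ptN_s]; exact ih (S.Pt g hx)

/-- iterated shift -/
def si (n : ℕ) : B → B := l.s^[n]

theorem si_0 (x : B) : l.si 0 x = x := rfl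
theorem si_s (n : ℕ) (x : B) : l.si (n+1) x = l.s (l.si n x) := Function.iterate_succ_apply' _ _ _

theorem ptN_mul [Nontrivial B] (g : ι → F) (j k : ℕ) {a y : B} (ha : l.S F j j a) :
    eps F B (l.ptN g (j + k) (a * l.si j y)) = eps F B (l.ptN g j a) * eps F B (l.ptN g k y) := by
  induction j generalizing a with
  | zero =>
    obtain ⟨c, rfl⟩ := ha.scalar
    rw [si_0, zero_add, ← Algebra.smul_def, map_smul, map_smul, ptN_0, Algebra.algebraMap_eq_smul_one, map_smul,
      eps_one, smul_eq_mul, smul_eq_mul, mul_one]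
  | succ j ih =>
    rw [show j + 1 + k = (j + k) + 1 by ring, ptN_s, si_s, Pt_s_right, ih (Lv.S.Pt g ha), ptN_s]

/-- group-like element -/
def Gel (g : ι → F) (n : ℕ) : B := ∑ w, gw g n w • ((l.pw n).e w * (l.pw n).d w)
def G1 (g : ι → F) : B := ∑ a, g a • (l.e a * l.d a)

theorem G1_s (g : ι → F) (x : B) : l.G1 g * l.s x = l.s x * l.G1 g := by
  rw [G1, Finset.sum_mul, Finset.mul_sum]
  refine Finset.sum_congr rfl (fun a _ => ?_)
  rw [smul_mul_assoc, mul_assoc, d_s, mul_smul_comm, ← mul_assoc, ← mul_assoc, s_e]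

theorem G1_mul_s (g : ι → F) (x : B) : l.G1 g * l.s x = ∑ a, g a • (l.e a * x * l.d a) := by
  rw [G1, Finset.sum_mul]
  refine Finset.sum_congr rfl (fun a _ => ?_)
  rw [smul_mul_assoc, mul_assoc, d_s, ← mul_assoc]

theorem Gel_0 (g : ι → F) : l.Gel g 0 = 1 := by
  rw [Gel, Wd.sum_zero, gw_0, pw_e0, pw_d0, one_smul, one_mul]

theorem Gel_s (g : ι → F) (n : ℕ) : l.Gel g (n+1) = l.G1 g * l.s (l.Gel g n) := by
  rw [G1_mul_s, Gel, Wd.sum_succ]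
  refine Finset.sum_congr rfl (fun a _ => ?_)
  rw [Gel, Finset.mul_sum, Finset.sum_mul, Finset.smul_sum]
  refine Finset.sum_congr rfl (fun w _ => ?_)
  rw [gw_s, pw_e, pw_d, mul_smul_comm, smul_mul_assoc, smul_smul]
  congr 1; noncomm_ring

def T0 (R : ι → ι → ι → ι → F) : B := ∑ a, ∑ b, ∑ c, ∑ d, R a b c d • (l.e a * l.e b * (l.d d * l.d c))

theorem d_T0 (R : ι → ι → ι → ι → F) (v : ι) : l.d v * l.T0 R = ∑ b, ∑ c, ∑ d, R v b c d • (l.e b * (l.d d * l.d c)) := by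
  rw [T0, Finset.mul_sum, Finset.sum_eq_single v]
  · simp only [Finset.mul_sum, mul_smul_comm, ← mul_assoc, l.de, if_true, one_mul]
  · intro u _ hu
    simp only [Finset.mul_sum, mul_smul_comm, ← mul_assoc, l.de, if_neg hu.symm, zero_mul, smul_zero, Finset.sum_const_zero]
  · simp

theorem T0_e (R : ι → ι → ι → ι → F) (u v : ι) : l.T0 R * (l.e u * l.e v) = ∑ a, ∑ b, R a b u v • (l.e a * l.e b) := by
  rw [T0, Finset.sum_mul]
  refine Finset.sum_congr rfl (fun a _ => ?_)
  rw [Finset.sum_mul]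
  refine Finset.sum_congr rfl (fun b _ => ?_)
  rw [Finset.sum_mul, Finset.sum_eq_single u]
  · rw [Finset.sum_mul, Finset.sum_eq_single v]
    · rw [smul_mul_assoc, mul_assoc, mul_assoc (l.d v), ← mul_assoc (l.d u), l.de, if_pos rfl, one_mul, l.de, if_pos rfl, mul_one]
    · intro c _ hc
      rw [smul_mul_assoc, mul_assoc, mul_assoc (l.d c), ← mul_assoc (l.d u), l.de, if_pos rfl, one_mul, l.de, if_neg hc, mul_zero, smul_zero]
    · simp
  · intro c _ hc
    rw [Finset.sum_mul]
    refine Finset.sum_eq_zero (fun x _ => ?_)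
    rw [smul_mul_assoc, mul_assoc, mul_assoc (l.d x), ← mul_assoc (l.d c), l.de, if_neg hc]; simp
  · simp

theorem T0_ss (R : ι → ι → ι → ι → F) (x : B) : l.T0 R * l.s (l.s x) = l.s (l.s x) * l.T0 R := by
  simp only [T0, Finset.sum_mul, Finset.mul_sum]
  refine Finset.sum_congr rfl (fun a _ => Finset.sum_congr rfl (fun b _ => Finset.sum_congr rfl (fun c _ =>
    Finset.sum_congr rfl (fun d _ => ?_))))
  rw [smul_mul_assoc, mul_smul_comm]; congr 1
  rw [mul_assoc, mul_assoc (l.d d), d_s, ← mul_assoc (l.d d), d_s]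
  have h1 : l.s (l.s x) * (l.e a * l.e b) = l.e a * l.e b * x := by
    rw [← mul_assoc, s_e, mul_assoc, s_e, mul_assoc]
  rw [← mul_assoc (l.s (l.s x)), h1]; noncomm_ring

theorem S_T0 (R : ι → ι → ι → ι → F) : l.S F 2 2 (l.T0 R) := by
  refine S.sum _ (fun a _ => S.sum _ (fun b _ => S.sum _ (fun c _ => S.sum _ (fun d _ => S.smul _ ?_))))
  exact (((S.e a).up (N := 0)).mul (S.e b)).mul ((S.d d).mul ((S.d c).up (M := 0)))

end Lv

/-- an `R`-matrix in a Leavitt algebra -/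
structure Dat (F : Type) [Field F] (q : F) (ι B : Type) [Fintype ι] [DecidableEq ι] [Ring B] [Algebra F B]
    extends Lv ι B where
  R : ι → ι → ι → ι → F
  hecke : toLv.T0 R * toLv.T0 R = (q - 1) • toLv.T0 R + algebraMap F B q
  braid : toLv.T0 R * toLv.s (toLv.T0 R) * toLv.T0 R = toLv.s (toLv.T0 R) * toLv.T0 R * toLv.s (toLv.T0 R)

namespace Dat
variable {F : Type} [Field F] {q : F} {ι B : Type} [Fintype ι] [DecidableEq ι] [Ring B] [Algebra F B]
variable (D : Dat F q ι B)

def l : Lv ι B := D.toLv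

def GC (g : ι → F) : Prop := ∀ a b c d, D.R a b c d * (g a * g b) = D.R a b c d * (g c * g d)

theorem si_far (i j : ℕ) (h : i + 2 ≤ j) : D.l.si i (D.l.T0 D.R) * D.l.si j (D.l.T0 D.R) = D.l.si j (D.l.T0 D.R) * D.l.si i (D.l.T0 D.R) := by
  induction i generalizing j with
  | zero =>
    obtain ⟨k, rfl⟩ : ∃ k, j = k + 2 := ⟨j - 2, by omega⟩
    rw [Lv.si_s, Lv.si_s, Lv.si_0]; exact Lv.T0_ss _ _ _
  | succ i ih =>
    obtain ⟨k, rfl⟩ : ∃ k, j = k + 1 := ⟨j - 1, by omega⟩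
    rw [Lv.si_s, Lv.si_s, ← Lv.s_mul, ih k (by omega), Lv.s_mul]

def ρ : H F q →ₐ[F] B := lft (fun i => D.l.si i (D.l.T0 D.R)) D.si_far
  (fun i => by
    induction i with
    | zero => exact D.braid
    | succ i ih =>
      have := congrArg D.l.s ih
      simp only [Lv.s_mul, ← Lv.si_s] at this
      exact this)
  (fun i => by
    induction i with
    | zero => exact D.hecke
    | succ i ih =>
      have := congrArg (D.l.sa F) ih
      rw [map_mul, map_add, map_smul, AlgHom.commutes] at this
      simp only [Lv.sa_apply, ← Lv.si_s] at this
      exact this)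

theorem ρ_T (i : ℕ) : D.ρ (T i) = D.l.si i (D.l.T0 D.R) := lft_T _ _ _ _ _

theorem ρ_T0 : D.ρ (T 0) = D.l.T0 D.R := D.ρ_T 0

theorem ρ_sh (x : H F q) : D.ρ (sh 1 x) = D.l.s (D.ρ x) := by
  have : D.ρ.comp (sh 1) = (D.l.sa F).comp D.ρ := hom_ext (fun i => by
    simp only [AlgHom.comp_apply, sh_T, ρ_T, Lv.sa_apply, Lv.si_s])
  exact DFunLike.congr_fun this x

theorem ρ_shi (n : ℕ) (x : H F q) : D.ρ (sh n x) = D.l.si n (D.ρ x) := by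
  induction n with
  | zero => rw [sh_zero, Lv.si_0]
  | succ n ih => rw [add_comm, ← sh_sh, ρ_sh, ih, add_comm, Lv.si_s]

theorem S_T (i : ℕ) : D.l.S F (i+2) (i+2) (D.ρ (T i)) := by
  rw [ρ_T]
  induction i with
  | zero => exact D.l.S_T0 _
  | succ i ih => rw [Lv.si_s]; exact ih.s

theorem S_ρ {n : ℕ} {x : H F q} (hx : x ∈ HN n) : D.l.S F n n (D.ρ x) := by
  induction hx using Algebra.adjoin_induction with
  | mem x hx => obtain ⟨i, hi, rfl⟩ := hx; exact (D.S_T i).upto (by omega)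
  | algebraMap r =>
    rw [AlgHom.commutes, Algebra.algebraMap_eq_smul_one]; exact (Lv.S.one n).smul r
  | add x y _ _ hx hy => rw [map_add]; exact hx.add hy
  | mul x y _ _ hx hy => rw [map_mul]; exact hx.mul hy

variable {D}
theorem G1_T0 {g : ι → F} (hg : D.GC g) :
    D.l.G1 g * D.l.s (D.l.G1 g) * D.l.T0 D.R = D.l.T0 D.R * (D.l.G1 g * D.l.s (D.l.G1 g)) := by
  have hG : ∀ a, D.l.G1 g * D.l.e a = g a • D.l.e a := by
    intro a
    rw [Lv.G1, Finset.sum_mul]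
    simp only [smul_mul_assoc, mul_assoc, D.l.de, mul_ite, mul_one, mul_zero, smul_ite, smul_zero, Finset.sum_ite_eq', Finset.mem_univ, if_true]
  have hGG : ∀ a b, D.l.G1 g * D.l.s (D.l.G1 g) * (D.l.e a * D.l.e b) = (g a * g b) • (D.l.e a * D.l.e b) := by
    intro a b
    rw [mul_assoc, ← mul_assoc (D.l.s _), Lv.s_e, mul_assoc, hG, ← mul_assoc, hG, smul_mul_assoc, mul_smul_comm, smul_smul]
  apply D.l.eq_of_e; intro u
  apply D.l.eq_of_e; intro v
  rw [mul_assoc, mul_assoc, mul_assoc (D.l.T0 D.R * _), mul_assoc (D.l.T0 D.R), hGG, Lv.T0_e, mul_smul_comm, Lv.T0_e]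
  simp only [Finset.mul_sum, Finset.smul_sum, mul_smul_comm, hGG, smul_smul]
  refine Finset.sum_congr rfl (fun a _ => Finset.sum_congr rfl (fun b _ => ?_))
  rw [hg, mul_comm]

theorem Gel_comm {g : ι → F} (hg : D.GC g) {n : ℕ} {x : H F q} (hx : x ∈ HN n) :
    D.l.Gel g n * D.ρ x = D.ρ x * D.l.Gel g n := by
  induction hx using Algebra.adjoin_induction with
  | mem x hx =>
    obtain ⟨i, hi, rfl⟩ := hx
    rw [ρ_T]
    induction i generalizing n with
    | zero =>
      obtain ⟨n, rfl⟩ : ∃ k, n = k + 2 := ⟨n - 2, by omega⟩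
      rw [Lv.si_0, Lv.Gel_s, Lv.Gel_s, Lv.s_mul, ← mul_assoc, mul_assoc, ← Lv.T0_ss, ← mul_assoc, G1_T0 hg, mul_assoc]
    | succ i ih =>
      obtain ⟨n, rfl⟩ : ∃ k, n = k + 1 := ⟨n - 1, by omega⟩
      rw [Lv.Gel_s, Lv.si_s, mul_assoc, ← Lv.s_mul, ih (by omega), Lv.s_mul, ← mul_assoc, Lv.G1_s, mul_assoc]
  | algebraMap r => rw [AlgHom.commutes, Algebra.commutes]
  | add x y _ _ hx hy => rw [map_add, mul_add, add_mul, hx, hy]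
  | mul x y _ _ hx hy => rw [map_mul, ← mul_assoc, hx, mul_assoc, hy, mul_assoc]

variable (D)
variable [Nontrivial B]

def tb (g : ι → F) (n : ℕ) : B →ₗ[F] F := eps F B ∘ₗ D.l.ptN g n
def tt (g : ι → F) (n : ℕ) : H F q →ₗ[F] F := D.tb g n ∘ₗ D.ρ.toLinearMap
def pk (g : ι → F) (k : ℕ) : F := D.tt g k (c1 (k-1))

theorem tb_apply (g : ι → F) (n : ℕ) (x : B) : D.tb g n x = eps F B (D.l.ptN g n x) := rfl
theorem tt_apply (g : ι → F) (n : ℕ) (x : H F q) : D.tt g n x = D.tb g n (D.ρ x) := rfl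

variable {D} in
theorem tb_cyc {g : ι → F} (hg : D.GC g) {n : ℕ} {x : H F q} {y : B} (hx : x ∈ HN n) (hy : D.l.S F n n y) :
    D.tb g n (D.ρ x * y) = D.tb g n (y * D.ρ x) := by
  rw [tb_apply, tb_apply, Lv.ptN_eq, Lv.ptN_eq]
  exact Lv.tr_cyc _ (D.S_ρ hx) hy (Gel_comm hg hx)

variable {D} in
theorem tt_mul (g : ι → F) (j k : ℕ) {a : H F q} (ha : a ∈ HN j) (y : H F q) :
    D.tt g (j + k) (a * sh j y) = D.tt g j a * D.tt g k y := by
  rw [tt_apply, map_mul, ρ_shi, tb_apply, Lv.ptN_mul _ _ _ _ (D.S_ρ ha)]; rfl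

variable {D} in
theorem isTr {g : ι → F} (hg : D.GC g) (N : ℕ) : IsTr N (D.tt g) (D.pk g) where
  one := by rw [tt_apply, map_one, tb_apply, Lv.ptN_0, eps_one]
  tr n _ x hx y hy := by rw [tt_apply, tt_apply, map_mul D.ρ, map_mul D.ρ]; exact tb_cyc hg hx (D.S_ρ hy)
  mkv j k _ a ha := by rw [add_assoc, tt_mul g j (k+1) ha]; rfl

theorem pk_one (g : ι → F) : D.pk g 1 = ∑ a, g a := by
  rw [pk, tt_apply, tb_apply, c1, map_one, Lv.ptN_s, Lv.ptN_0, Lv.Pt_apply, map_sum]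
  refine Finset.sum_congr rfl (fun a _ => ?_)
  rw [mul_one, D.l.de, if_pos rfl, map_smul, eps_one, smul_eq_mul, mul_one]

end Dat
end HS

namespace HS

namespace Dat
variable {F : Type} [Field F] {q : F} {ι B : Type} [Fintype ι] [DecidableEq ι] [Ring B] [Algebra F B]

structure Cl (D : Dat F q ι B) where
  Dm : ι → ι → F
  hD : ∀ b x, ∑ v, ∑ a, D.R v b a x * Dm a v = if b = x then 1 else 0
  Ψ : ι → ι → ι → ι → F
  hΨ : ∀ v' a' v a, ∑ b, ∑ x, Ψ v' a' b x * D.R v b a x = if v = v' ∧ a = a' then 1 else 0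

variable {D : Dat F q ι B}

namespace Cl
variable (C : D.Cl)

theorem inj (C : D.Cl) (z : ι → ι → B) (h : ∀ b x, ∑ v, ∑ a, D.R v b a x • z v a = 0) (v' a' : ι) : z v' a' = 0 := by
  have h1 : ∑ b, ∑ x, C.Ψ v' a' b x • ∑ v, ∑ a, D.R v b a x • z v a = 0 :=
    Finset.sum_eq_zero (fun b _ => Finset.sum_eq_zero (fun x _ => by rw [h, smul_zero]))
  have h2 : ∑ b, ∑ x, C.Ψ v' a' b x • ∑ v, ∑ a, D.R v b a x • z v a =
      ∑ v, ∑ a, (∑ b, ∑ x, C.Ψ v' a' b x * D.R v b a x) • z v a := by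
    simp only [Finset.smul_sum, Finset.sum_smul, smul_smul]
    rw [show (∑ b, ∑ x, ∑ v, ∑ a, (C.Ψ v' a' b x * D.R v b a x) • z v a) =
      ∑ b, ∑ v, ∑ a, ∑ x, (C.Ψ v' a' b x * D.R v b a x) • z v a from
        Finset.sum_congr rfl (fun b _ => by
          rw [Finset.sum_comm]
          exact Finset.sum_congr rfl (fun v _ => Finset.sum_comm))]
    rw [Finset.sum_comm]
    exact Finset.sum_congr rfl (fun v _ => Finset.sum_comm)
  rw [h2] at h1
  simp only [C.hΨ] at h1
  rw [Finset.sum_eq_single v', Finset.sum_eq_single a'] at h1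
  · simpa using h1
  · intro a _ ha; rw [if_neg (fun hh => ha hh.2), zero_smul]
  · simp
  · intro v _ hv
    exact Finset.sum_eq_zero (fun a _ => by rw [if_neg (fun hh => hv hh.1), zero_smul])
  · simp

def De (v : ι) : B := ∑ a, C.Dm a v • D.l.e a

theorem s_De (x : B) (v : ι) : D.l.s x * C.De v = C.De v * x := by
  rw [De, Finset.mul_sum, Finset.sum_mul]
  exact Finset.sum_congr rfl (fun a _ => by rw [mul_smul_comm, Lv.s_e, smul_mul_assoc])

theorem d_De (a v : ι) : D.l.d a * C.De v = algebraMap F B (C.Dm a v) := by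
  rw [De, Finset.mul_sum, Finset.sum_eq_single a]
  · rw [mul_smul_comm, D.l.de, if_pos rfl, Algebra.algebraMap_eq_smul_one]
  · intro b _ hb; rw [mul_smul_comm, D.l.de, if_neg hb.symm, smul_zero]
  · simp

theorem S_De (v : ι) : D.l.S F 1 0 (C.De v) := Lv.S.sum _ (fun a _ => (Lv.S.e a).smul _)

def ctr : B →ₗ[F] B where
  toFun X := ∑ b, D.l.d b * X * C.De b
  map_add' x y := by simp [mul_add, add_mul, Finset.sum_add_distrib]
  map_smul' c x := by simp [Finset.smul_sum]

theorem ctr_apply (X : B) : C.ctr X = ∑ b, D.l.d b * X * C.De b := rfl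

def δ : F := ∑ b, C.Dm b b

theorem ctr_s (x A y : B) : C.ctr (D.l.s x * A * D.l.s y) = x * C.ctr A * y := by
  rw [ctr_apply, ctr_apply, Finset.mul_sum, Finset.sum_mul]
  refine Finset.sum_congr rfl (fun b _ => ?_)
  rw [mul_assoc, mul_assoc, mul_assoc, s_De, ← mul_assoc, Lv.d_s]; noncomm_ring

theorem ctr_one : C.ctr 1 = algebraMap F B C.δ := by
  rw [ctr_apply, δ, map_sum]
  exact Finset.sum_congr rfl (fun b _ => by rw [mul_one, d_De])

theorem ctr_T0 : C.ctr (D.l.T0 D.R) = 1 := by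
  rw [ctr_apply]
  have h1 : ∀ v, D.l.d v * D.l.T0 D.R * C.De v = ∑ b, ∑ a, ∑ x, (D.R v b a x * C.Dm a v) • (D.l.e b * D.l.d x) := by
    intro v
    rw [Lv.d_T0, Finset.sum_mul]
    refine Finset.sum_congr rfl (fun b _ => ?_)
    rw [Finset.sum_mul]
    refine Finset.sum_congr rfl (fun a _ => ?_)
    rw [Finset.sum_mul]
    refine Finset.sum_congr rfl (fun x _ => ?_)
    rw [smul_mul_assoc, mul_assoc, mul_assoc, d_De, ← Algebra.commutes, ← Algebra.smul_def, mul_smul_comm, smul_smul]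
  simp only [h1]
  rw [Finset.sum_comm]
  have h2 : ∀ b, ∑ v, ∑ a, ∑ x, (D.R v b a x * C.Dm a v) • (D.l.e b * D.l.d x) =
      ∑ x, (∑ v, ∑ a, D.R v b a x * C.Dm a v) • (D.l.e b * D.l.d x) := by
    intro b
    simp only [Finset.sum_smul]
    rw [show (∑ v, ∑ a, ∑ x, (D.R v b a x * C.Dm a v) • (D.l.e b * D.l.d x)) =
      ∑ v, ∑ x, ∑ a, (D.R v b a x * C.Dm a v) • (D.l.e b * D.l.d x) from
        Finset.sum_congr rfl (fun v _ => Finset.sum_comm)]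
    rw [Finset.sum_comm]
  simp only [h2, C.hD, ite_smul, one_smul, zero_smul, Finset.sum_ite_eq, Finset.mem_univ, if_true]
  exact D.l.ed

theorem ctr_sh (x : H F q) : C.ctr (D.ρ (sh 1 x)) = C.δ • D.ρ x := by
  have := C.ctr_s (D.ρ x) 1 1
  rw [Lv.s_one, mul_one, mul_one, mul_one, ctr_one] at this
  rw [ρ_sh, this, ← Algebra.commutes, ← Algebra.smul_def]

theorem ctr_shT (x y : H F q) : C.ctr (D.ρ (sh 1 x * T 0 * sh 1 y)) = D.ρ (x * y) := by
  rw [map_mul D.ρ, map_mul D.ρ, ρ_sh, ρ_sh, ρ_T0, ctr_s, ctr_T0, mul_one, map_mul D.ρ]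

/-- injectivity of the twisted contraction -/
theorem kinj (C : D.Cl) (M : ℕ) : ∀ (p : ℕ) (y : ι → B), (∀ v, D.l.S F M p (y v)) → ∑ v, D.l.d v * D.ρ (c1 M) * y v = 0 →
    ∀ v, y v = 0 := by
  induction M with
  | zero =>
    intro p y hy h u
    apply (D.l.pw p).eq_of_e; intro w
    rw [zero_mul]
    have h1 : ∀ v, ∃ c : F, y v * (D.l.pw p).e w = algebraMap F B c := fun v => by
      obtain ⟨c, hc⟩ := hy v Wd.nil w
      exact ⟨c, by rw [← hc, Lv.pw_d0, one_mul]⟩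
    choose c hc using h1
    have h2 := congrArg (fun z => z * (D.l.pw p).e w * D.l.e u) h
    simp only [Finset.sum_mul, zero_mul] at h2
    rw [Finset.sum_eq_single u] at h2
    · rw [c1, map_one, mul_one, mul_assoc (D.l.d u), hc, ← Algebra.commutes, mul_assoc, D.l.de, if_pos rfl, mul_one] at h2
      rw [hc, h2]
    · intro v _ hv
      rw [c1, map_one, mul_one, mul_assoc (D.l.d v), hc, ← Algebra.commutes, mul_assoc, D.l.de, if_neg hv, mul_zero]
    · simp
  | succ M ih =>
    intro p y hy h
    have hz : ∀ b x, ∑ v, ∑ a, D.R v b a x • (D.l.d a * y v) = 0 := by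
      intro b
      apply ih p
      · intro x
        refine Lv.S.sum _ (fun v _ => Lv.S.sum _ (fun a _ => Lv.S.smul _ ?_))
        have := (Lv.S.d (F := F) (l := D.l) a).ups M
        rw [zero_add, add_comm 1] at this
        exact this.mul (hy v)
      · have h1 : ∀ v, D.l.d v * D.ρ (c1 (M+1)) * y v =
            ∑ b, ∑ a, ∑ x, R D v b a x • (D.l.e b * (D.l.d x * D.ρ (c1 M) * (D.l.d a * y v))) := by
          intro v
          rw [c1_succ', map_mul, ρ_T0, ρ_sh, ← mul_assoc, Lv.d_T0, Finset.sum_mul, Finset.sum_mul]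
          refine Finset.sum_congr rfl (fun b _ => ?_)
          rw [Finset.sum_mul, Finset.sum_mul]
          refine Finset.sum_congr rfl (fun a _ => ?_)
          rw [Finset.sum_mul, Finset.sum_mul]
          refine Finset.sum_congr rfl (fun x _ => ?_)
          rw [smul_mul_assoc, smul_mul_assoc]; congr 1
          rw [mul_assoc (D.l.e b), mul_assoc (D.l.d x), Lv.d_s]; noncomm_ring
        simp only [h1] at h
        rw [Finset.sum_comm] at h
        have h2 := congrArg (fun z => D.l.d b * z) h
        simp only [mul_zero] at h2
        rw [Finset.mul_sum, Finset.sum_eq_single b] at h2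
        · simp only [Finset.mul_sum, mul_smul_comm, ← mul_assoc, D.l.de, if_true, one_mul] at h2
          simp only [Finset.mul_sum, mul_smul_comm, ← mul_assoc]
          rw [← h2, Finset.sum_comm]
          exact Finset.sum_congr rfl (fun v _ => Finset.sum_comm)
        · intro c _ hc
          simp only [Finset.mul_sum, mul_smul_comm, ← mul_assoc, D.l.de, if_neg hc.symm, zero_mul, smul_zero, Finset.sum_const_zero]
        · simp
    intro v
    apply D.l.eq_of_d; intro a
    rw [mul_zero]
    exact C.inj (fun v a => D.l.d a * y v) hz v a

/-- words -/
def DeW : ∀ k, Wd ι k → B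
  | 0, _ => 1
  | k + 1, w => C.De w.1 * DeW k w.2

theorem DeW_0 (w) : C.DeW 0 w = 1 := rfl
theorem DeW_s (k : ℕ) (a : ι) (w : Wd ι k) : C.DeW (k+1) (a, w) = C.De a * C.DeW k w := rfl

theorem S_DeW (k : ℕ) (w : Wd ι k) : D.l.S F k 0 (C.DeW k w) := by
  induction k with
  | zero => exact Lv.S.one 0
  | succ k ih =>
    obtain ⟨a, w⟩ := w
    rw [DeW_s]
    have := (C.S_De a).ups k
    rw [zero_add, add_comm 1] at this
    exact this.mul (ih w)

def PP (k : ℕ) (E : H F q) {J : Type} [Fintype J] (h2 h1 : J → H F q) : Prop :=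
  ∀ v v' : Wd ι k, ∑ j, D.ρ (h2 j) * C.DeW k v * (D.l.pw k).d v' * D.ρ (h1 j) = if v = v' then D.ρ E else 0

theorem PP0 : C.PP 0 1 (J := Unit) (fun _ => 1) (fun _ => 1) := by
  intro v v'
  rw [Wd.eq_nil v, Wd.eq_nil v', if_pos rfl]
  simp [DeW_0, Lv.pw_d0]

theorem PP1 {N : ℕ} {e : H F q} {J : Type} [Fintype J] (a b : J → H F q) (he : e ∈ HN (N+1)) (ha : ∀ j, a j ∈ HN (K := F) (q := q) (N+1))
    (hb : ∀ j, b j ∈ HN (K := F) (q := q) (N+1)) {χ : H F q} (hχ : χ ∈ HN (K := F) (q := q) (N+1)) (hχ1 : χ * c1 N = 1)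
    (h : D.ρ (c1 (N+1) * e) = ∑ j, D.ρ (sh 1 (b j) * a j)) :
    C.PP 1 e (fun j => b j * χ) a := by
  have key : ∀ v' v, (∑ j, D.ρ (b j * χ) * C.De v * D.l.d v' * D.ρ (a j)) - (if v = v' then D.ρ e else 0) = 0 := by
    intro v'
    apply C.kinj (N+1) (N+1)
    · intro v
      refine Lv.S.sub (Lv.S.sum _ (fun j _ => ?_)) ?_
      · have h1 := (C.S_De v).ups N
        rw [zero_add, add_comm 1] at h1
        have h2 := (Lv.S.d (F := F) (l := D.l) v').ups N
        rw [zero_add, add_comm 1] at h2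
        exact (((D.S_ρ (mul_mem (hb j) hχ)).mul h1).mul h2).mul (D.S_ρ (ha j))
      · split_ifs
        · exact D.S_ρ he
        · exact Lv.S.zero
    · simp only [mul_sub, Finset.sum_sub_distrib, mul_ite, mul_zero, Finset.sum_ite_eq', Finset.mem_univ, if_true, Finset.mul_sum]
      rw [Finset.sum_comm, sub_eq_zero]
      have h3 : ∀ j, ∑ v, D.l.d v * D.ρ (c1 (N+1)) * (D.ρ (b j * χ) * C.De v * D.l.d v' * D.ρ (a j)) =
          D.l.d v' * D.ρ (sh 1 (b j) * a j) := by
        intro j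
        have h4 : ∀ v, D.l.d v * D.ρ (c1 (N+1)) * (D.ρ (b j * χ) * C.De v * D.l.d v' * D.ρ (a j)) =
           D.ρ (b j * χ) * (D.l.d v * D.ρ (c1 (N+1)) * C.De v) * (D.l.d v' * D.ρ (a j)) := by
          intro v
          rw [show D.l.d v * D.ρ (c1 (N+1)) * (D.ρ (b j * χ) * C.De v * D.l.d v' * D.ρ (a j)) =
            D.l.d v * (D.ρ (c1 (N+1)) * D.ρ (b j * χ)) * (C.De v * D.l.d v' * D.ρ (a j)) by noncomm_ring,
            ← map_mul D.ρ, c1_conj (mul_mem (hb j) hχ), map_mul D.ρ, ρ_sh, ← mul_assoc (D.l.d v), Lv.d_s]; noncomm_ring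
        simp only [h4]
        rw [← Finset.sum_mul, ← Finset.mul_sum, ← ctr_apply]
        have h5 : C.ctr (D.ρ (c1 (N+1))) = D.ρ (c1 N) := by
          have := C.ctr_shT 1 (c1 N)
          rwa [map_one, one_mul, one_mul, ← c1_succ'] at this
        rw [h5, ← map_mul D.ρ, mul_assoc (b j), hχ1, mul_one, map_mul D.ρ, ρ_sh, ← mul_assoc (D.l.d v'), Lv.d_s, ← mul_assoc]
      simp only [h3]
      rw [← Finset.mul_sum, ← h, map_mul D.ρ, mul_assoc]
  rintro ⟨v, u⟩ ⟨v', u'⟩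
  rw [Wd.eq_nil u, Wd.eq_nil u']
  have := sub_eq_zero.1 (key v' v)
  simp only [DeW_s, Lv.pw_d, DeW_0, Lv.pw_d0, mul_one, one_mul]
  rw [this]
  have hiff : ((v, Wd.nil) : Wd ι 1) = (v', Wd.nil) ↔ v = v' := ⟨fun h => congrArg Prod.fst h, fun h => by rw [h]⟩
  by_cases hv : v = v'
  · rw [if_pos hv]; exact (if_pos (hiff.2 hv)).symm
  · rw [if_neg hv]; exact (if_neg (fun hh => hv (hiff.1 hh))).symm

theorem PPconj {k : ℕ} {E : H F q} {J : Type} [Fintype J] {h2 h1 : J → H F q} (h : C.PP k E h2 h1) (u u' : H F q) :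
    C.PP k (u * E * u') (fun j => u * h2 j) (fun j => h1 j * u') := by
  intro v v'
  have := congrArg (fun z => D.ρ u * z * D.ρ u') (h v v')
  simp only [Finset.mul_sum, Finset.sum_mul, mul_ite, ite_mul, mul_zero, zero_mul] at this
  rw [map_mul D.ρ, map_mul D.ρ, ← this]
  refine Finset.sum_congr rfl (fun j _ => ?_)
  rw [map_mul D.ρ, map_mul D.ρ]; noncomm_ring

theorem PPstep {k N : ℕ} {E e : H F q} {J J' : Type} [Fintype J] [Fintype J'] {h2 h1 : J → H F q}
    {g2 g1 : J' → H F q} (hh : ∀ j, h2 j ∈ HN (K := F) (q := q) (N+1))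
    (h : C.PP 1 e h2 h1) (g : C.PP k (sh N E) g2 g1) :
    C.PP (k+1) (sh (N+1) E * e) (fun j : J × J' => h2 j.1 * sh 1 (g2 j.2)) (fun j => sh 1 (g1 j.2) * h1 j.1) := by
  rintro ⟨v, w⟩ ⟨v', w'⟩
  rw [Fintype.sum_prod_type, DeW_s, Lv.pw_d]
  have h3 : ∀ j j', D.ρ (h2 j * sh 1 (g2 j')) * (C.De v * C.DeW k w) * ((D.l.pw k).d w' * D.l.d v') * D.ρ (sh 1 (g1 j') * h1 j) =
      D.ρ (h2 j) * C.De v * (D.ρ (g2 j') * C.DeW k w * (D.l.pw k).d w' * D.ρ (g1 j')) * (D.l.d v' * D.ρ (h1 j)) := by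
    intro j j'
    rw [map_mul D.ρ, map_mul D.ρ, ρ_sh, ρ_sh]
    calc _ = D.ρ (h2 j) * (D.l.s (D.ρ (g2 j')) * C.De v) * C.DeW k w * (D.l.pw k).d w' * (D.l.d v' * D.l.s (D.ρ (g1 j'))) * D.ρ (h1 j) := by noncomm_ring
      _ = _ := by rw [s_De, Lv.d_s]; noncomm_ring
  simp only [h3, ← Finset.mul_sum, ← Finset.sum_mul, g w w']
  have hiff : ((v, w) : Wd ι (k+1)) = (v', w') ↔ v = v' ∧ w = w' := Prod.ext_iff
  by_cases hw : w = w'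
  · simp only [if_pos hw]
    have h4 : ∀ j, D.ρ (h2 j) * C.De v * D.ρ (sh N E) * (D.l.d v' * D.ρ (h1 j)) =
        D.ρ (sh (N+1) E) * (D.ρ (h2 j) * C.De v * D.l.d v' * D.ρ (h1 j)) := by
      intro j
      rw [mul_assoc (D.ρ (h2 j)), ← s_De, ← ρ_sh, sh_sh, add_comm 1 N, ← mul_assoc (D.ρ (h2 j)), ← map_mul D.ρ, comm_sh (hh j) le_rfl, map_mul D.ρ]
      noncomm_ring
    simp only [h4]
    rw [← Finset.mul_sum]
    have h5 := h (v, Wd.nil) (v', Wd.nil)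
    simp only [DeW_s, Lv.pw_d, DeW_0, Lv.pw_d0, mul_one, one_mul] at h5
    have hiff2 : ((v, Wd.nil) : Wd ι 1) = (v', Wd.nil) ↔ v = v' := ⟨fun h => congrArg Prod.fst h, fun h => by rw [h]⟩
    rw [h5]
    by_cases hv : v = v'
    · refine Eq.trans ?_ (if_pos (hiff.2 ⟨hv, hw⟩)).symm
      rw [map_mul D.ρ]
      exact congrArg _ (if_pos (hiff2.2 hv))
    · refine Eq.trans ?_ (if_neg (fun hh => hv (hiff.1 hh).1)).symm
      refine Eq.trans (congrArg _ (if_neg (fun hh => hv (hiff2.1 hh)))) (mul_zero _)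
  · refine Eq.trans ?_ (if_neg (fun hh => hw (hiff.1 hh).2)).symm
    simp [if_neg hw]

/-- twisted group-like -/
def GG1 (g : ι → F) : B := ∑ a, g a • (C.De a * D.l.d a)
def GG (g : ι → F) (k : ℕ) : B := ∑ w, Lv.gw g k w • (C.DeW k w * (D.l.pw k).d w)

theorem GG_0 (g : ι → F) : C.GG g 0 = 1 := by
  rw [GG, Wd.sum_zero, Lv.gw_0, DeW_0, Lv.pw_d0, one_smul, one_mul]

theorem GG_s (g : ι → F) (k : ℕ) : C.GG g (k+1) = C.GG1 g * D.l.s (C.GG g k) := by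
  rw [GG, Wd.sum_succ, GG1, Finset.sum_mul]
  refine Finset.sum_congr rfl (fun a _ => ?_)
  rw [smul_mul_assoc, mul_assoc, Lv.d_s, GG, Finset.sum_mul, Finset.mul_sum, Finset.smul_sum]
  refine Finset.sum_congr rfl (fun w _ => ?_)
  rw [Lv.gw_s, DeW_s, Lv.pw_d, smul_mul_assoc, mul_smul_comm, smul_smul]
  congr 1; noncomm_ring

theorem S_GG (g : ι → F) (k : ℕ) : D.l.S F k k (C.GG g k) := by
  refine Lv.S.sum _ (fun w _ => Lv.S.smul _ ((C.S_DeW k w).mul ?_))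
  clear * -
  induction k with
  | zero => exact Lv.S.one 0
  | succ k ih =>
    obtain ⟨a, w⟩ := w
    have := (Lv.S.d (F := F) (l := D.l) a).ups k
    rw [zero_add, add_comm 1] at this
    exact (ih w).mul this

variable [Nontrivial B]

theorem tb_GG1 {g gi : ι → F} (hg : ∀ a, g a * gi a = 1) (n : ℕ) (X y : B) :
    D.tb g (n+1) (X * (C.GG1 gi * D.l.s y)) = D.tb g n (C.ctr X * y) := by
  rw [tb_apply, tb_apply, Lv.ptN_s, ← mul_assoc, Lv.Pt_s_right]
  suffices h : D.l.Pt g (X * C.GG1 gi) = C.ctr X by rw [h]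
  rw [Lv.Pt_apply, ctr_apply]
  refine Finset.sum_congr rfl (fun b _ => ?_)
  have : C.GG1 gi * D.l.e b = gi b • C.De b := by
    rw [GG1, Finset.sum_mul]
    simp only [smul_mul_assoc, mul_assoc, D.l.de, mul_ite, mul_one, mul_zero, smul_ite, smul_zero, Finset.sum_ite_eq', Finset.mem_univ, if_true]
  rw [mul_assoc, mul_assoc, this, mul_smul_comm, mul_smul_comm, smul_smul, hg, one_smul, mul_assoc]

theorem tb_GG {g gi : ι → F} (hg : ∀ a, g a * gi a = 1) (n k : ℕ) (X : B) :
    D.tb g (n+k) (X * C.GG gi k) = D.tb g n (C.ctr^[k] X) := by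
  induction k generalizing X with
  | zero => rw [GG_0, mul_one]; rfl
  | succ k ih => rw [GG_s, ← add_assoc, tb_GG1 C hg, ih, Function.iterate_succ_apply]

theorem trPP {g gi : ι → F} (hgc : D.GC g) {k M : ℕ} (hk : k ≤ M) {E x : H F q} (hx : x ∈ HN k) {J : Type} [Fintype J]
    {h2 h1 : J → H F q} (h : C.PP k E h2 h1) (hh1 : ∀ j, h1 j ∈ HN (K := F) (q := q) M)
    (hh2 : ∀ j, h2 j ∈ HN (K := F) (q := q) M) :
    D.tt gi k x * D.tt g M E = ∑ j, D.tb g M (D.ρ (x * h1 j * h2 j) * C.GG gi k) := by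
  have hsc : ∀ w w', ∃ c : F, (D.l.pw k).d w * D.ρ x * (D.l.pw k).e w' = algebraMap F B c := D.S_ρ hx
  choose c hc using hsc
  have h3 : D.tt gi k x = ∑ w, Lv.gw gi k w * c w w := by
    rw [tt_apply, tb_apply, Lv.ptN_eq, map_sum]
    refine Finset.sum_congr rfl (fun w _ => ?_)
    rw [hc, map_smul, Algebra.algebraMap_eq_smul_one, map_smul, eps_one, smul_eq_mul, smul_eq_mul, mul_one]
  have h4 : ∀ w, (D.l.pw k).d w * D.ρ x = ∑ w', c w w' • (D.l.pw k).d w' := by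
    intro w
    apply (D.l.pw k).eq_of_e; intro w'
    rw [hc, Finset.sum_mul]
    simp only [smul_mul_assoc, (D.l.pw k).de, smul_ite, smul_zero, Finset.sum_ite_eq', Finset.mem_univ, if_true]
    rw [Algebra.algebraMap_eq_smul_one]
  have h5 : (D.tt gi k x) • D.ρ E = ∑ j, D.ρ (h2 j) * (C.GG gi k * D.ρ (x * h1 j)) := by
    have h6 : ∀ j, D.ρ (h2 j) * (C.GG gi k * D.ρ (x * h1 j)) =
        ∑ w, ∑ w', (Lv.gw gi k w * c w w') • (D.ρ (h2 j) * C.DeW k w * (D.l.pw k).d w' * D.ρ (h1 j)) := by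
      intro j
      rw [GG, Finset.sum_mul, Finset.mul_sum]
      refine Finset.sum_congr rfl (fun w _ => ?_)
      rw [map_mul D.ρ, smul_mul_assoc, mul_assoc, ← mul_assoc _ (D.ρ x), h4, Finset.sum_mul, Finset.mul_sum, Finset.smul_sum, Finset.mul_sum]
      refine Finset.sum_congr rfl (fun w' _ => ?_)
      simp only [mul_smul_comm, smul_mul_assoc, smul_smul]
      congr 1; noncomm_ring
    simp only [h6]
    rw [Finset.sum_comm, h3, Finset.sum_smul]
    refine Finset.sum_congr rfl (fun w _ => ?_)
    rw [Finset.sum_comm]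
    simp only [← Finset.smul_sum, h w, smul_ite, smul_zero, Finset.sum_ite_eq, Finset.mem_univ, if_true]
  rw [tt_apply D g M E, ← smul_eq_mul, ← map_smul, h5, map_sum]
  refine Finset.sum_congr rfl (fun j _ => ?_)
  have hG : D.l.S F M M (C.GG gi k) := (C.S_GG gi k).upto hk
  have hxM : x * h1 j ∈ HN (K := F) (q := q) M := mul_mem (HN_mono hk hx) (hh1 j)
  rw [tb_cyc hgc (hh2 j) (hG.mul (D.S_ρ hxM)), mul_assoc, ← map_mul D.ρ, ← tb_cyc hgc (mul_mem hxM (hh2 j)) hG]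

end Cl

section two
variable {ι' B' : Type} [Fintype ι'] [DecidableEq ι'] [Ring B'] [Algebra F B'] {D' : Dat F q ι' B'}
variable (C : D.Cl) (C' : D'.Cl)

theorem ctr2 (hδ : C.δ = C'.δ) {n : ℕ} {x : H F q} (hx : x ∈ HN (n+1)) :
    ∃ x' ∈ HN (K := F) (q := q) n, C.ctr (D.ρ x) = D.ρ x' ∧ C'.ctr (D'.ρ x) = D'.ρ x' := by
  have := S3' hx
  clear hx
  induction this using Submodule.span_induction with
  | mem x h =>
    rcases h with ⟨h, hh, rfl⟩ | ⟨a, ha, b, hb, rfl⟩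
    · exact ⟨C.δ • h, Subalgebra.smul_mem _ hh _, by rw [Cl.ctr_sh, map_smul], by rw [Cl.ctr_sh, map_smul, hδ]⟩
    · exact ⟨a * b, mul_mem ha hb, by rw [Cl.ctr_shT], by rw [Cl.ctr_shT]⟩
  | zero => exact ⟨0, zero_mem _, by simp, by simp⟩
  | add x y _ _ hx hy =>
    obtain ⟨x', h1, h2, h3⟩ := hx
    obtain ⟨y', h4, h5, h6⟩ := hy
    exact ⟨x' + y', add_mem h1 h4, by simp only [map_add, h2, h5], by simp only [map_add, h3, h6]⟩
  | smul c x _ hx =>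
    obtain ⟨x', h1, h2, h3⟩ := hx
    exact ⟨c • x', Subalgebra.smul_mem _ h1 _, by simp only [map_smul, h2], by simp only [map_smul, h3]⟩

theorem ctr2k (hδ : C.δ = C'.δ) (k n : ℕ) {x : H F q} (hx : x ∈ HN (n+k)) :
    ∃ x' ∈ HN (K := F) (q := q) n, C.ctr^[k] (D.ρ x) = D.ρ x' ∧ C'.ctr^[k] (D'.ρ x) = D'.ρ x' := by
  induction k generalizing x with
  | zero => exact ⟨x, hx, rfl, rfl⟩
  | succ k ih =>
    obtain ⟨y, hy, h1, h2⟩ := ctr2 C C' hδ (n := n + k) hx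
    obtain ⟨x', hx', h3, h4⟩ := ih hy
    exact ⟨x', hx', by rw [Function.iterate_succ_apply, h1, h3], by rw [Function.iterate_succ_apply, h2, h4]⟩

variable [Nontrivial B] [Nontrivial B']

theorem dual_eq (hδ : C.δ = C'.δ) {g gi : ι → F} {g' gi' : ι' → F} (hg : ∀ a, g a * gi a = 1) (hg' : ∀ a, g' a * gi' a = 1)
    (hc : D.GC g) (hc' : D'.GC g') (hp : ∀ k, 1 ≤ k → D.pk g k = D'.pk g' k)
    {k M : ℕ} (hk : k ≤ M) {E x : H F q} (hE : E ∈ HN M) (hx : x ∈ HN k) {J : Type} [Fintype J]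
    {h2 h1 : J → H F q} (h : C.PP k E h2 h1) (h' : C'.PP k E h2 h1) (hh1 : ∀ j, h1 j ∈ HN (K := F) (q := q) M)
    (hh2 : ∀ j, h2 j ∈ HN (K := F) (q := q) M) (hne : D.tt g M E ≠ 0) :
    D.tt gi k x = D'.tt gi' k x := by
  have hu : ∀ n, ∀ x ∈ HN (K := F) (q := q) n, D.tt g n x = D'.tt g' n x := fun n =>
    (isTr hc n).uniq (isTr hc' n) (fun k hk _ => hp k hk) n le_rfl
  have e1 := C.trPP (gi := gi) hc hk hx h hh1 hh2
  have e2 := C'.trPP (gi := gi') hc' hk hx h' hh1 hh2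
  obtain ⟨n, rfl⟩ := Nat.exists_eq_add_of_le' hk
  have e3 : ∑ j, D.tb g (n+k) (D.ρ (x * h1 j * h2 j) * C.GG gi k) = ∑ j, D'.tb g' (n+k) (D'.ρ (x * h1 j * h2 j) * C'.GG gi' k) := by
    refine Finset.sum_congr rfl (fun j _ => ?_)
    rw [C.tb_GG hg, C'.tb_GG hg']
    obtain ⟨x', hx', h3, h4⟩ := ctr2k C C' hδ k n (mul_mem (mul_mem (HN_mono hk hx) (hh1 j)) (hh2 j))
    rw [h3, h4, ← tt_apply, ← tt_apply, hu n x' hx']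
  rw [e3, ← e2, ← hu _ E hE] at e1
  exact mul_right_cancel₀ hne e1

end two
end Dat
end HS

namespace HS

/-- concrete Leavitt data -/
abbrev BB (F ι : Type) [Field F] : Type := Module.End F ((ℕ → ι) → F)

def consW {ι : Type} (a : ι) (w : ℕ → ι) : ℕ → ι
  | 0 => a
  | n + 1 => w n

def lvF (F ι : Type) [Field F] [Fintype ι] [DecidableEq ι] : Lv ι (BB F ι) where
  e a := { toFun := fun φ w => if w 0 = a then φ (fun n => w (n+1)) else 0
           map_add' := fun x y => by ext w; by_cases h : w 0 = a <;> simp [h]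
           map_smul' := fun c x => by ext w; by_cases h : w 0 = a <;> simp [h] }
  d a := { toFun := fun φ w => φ (consW a w)
           map_add' := fun x y => rfl
           map_smul' := fun c x => rfl }
  de a b := by
    apply LinearMap.ext; intro φ
    funext w
    by_cases h : a = b
    · rw [if_pos h]; exact if_pos h
    · rw [if_neg h]; exact if_neg h
  ed := by
    apply LinearMap.ext; intro φ
    funext w
    rw [LinearMap.sum_apply, Finset.sum_apply, Finset.sum_eq_single (w 0)]
    · refine (if_pos rfl).trans ?_
      refine congrArg φ (funext fun n => ?_)
      cases n <;> rfl
    · intro b _ hb; exact if_neg hb.symm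
    · simp

instance (F ι : Type) [Field F] [Nonempty ι] : Nontrivial (BB F ι) := inferInstance

section clinj
variable {F : Type} [Field F] {q : F} {ι B : Type} [Fintype ι] [DecidableEq ι] [Ring B] [Algebra F B]

theorem Cl_of_inj (D : Dat F q ι B)
    (h : ∀ z : ι → ι → F, (∀ b x, ∑ v, ∑ a, D.R v b a x * z v a = 0) → ∀ v a, z v a = 0) : Nonempty D.Cl := by
  let A : Matrix (ι × ι) (ι × ι) F := fun i j => D.R j.1 i.1 j.2 i.2
  have hA : Function.Injective A.mulVec := by
    rw [← Matrix.coe_mulVecLin]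
    refine (injective_iff_map_eq_zero A.mulVecLin).2 (fun z hz => ?_)
    have := h (fun v a => z (v, a)) (fun b x => by
      have h1 := congrFun hz (b, x)
      rw [Matrix.mulVecLin_apply, Matrix.mulVec, dotProduct, Fintype.sum_prod_type] at h1
      exact h1)
    funext ⟨v, a⟩; exact this v a
  have hu := Matrix.mulVec_injective_iff_isUnit.1 hA
  have hd := (Matrix.isUnit_iff_isUnit_det A).1 hu
  have h1 := Matrix.mul_nonsing_inv A hd
  have h2 := Matrix.nonsing_inv_mul A hd
  refine ⟨⟨fun a v => (A⁻¹.mulVec (fun i => if i.1 = i.2 then 1 else 0)) (v, a), ?_, fun v' a' b x => A⁻¹ (v', a') (b, x), ?_⟩⟩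
  · intro b x
    have h3 : A.mulVec (A⁻¹.mulVec (fun i => if i.1 = i.2 then 1 else 0)) = fun i => if i.1 = i.2 then 1 else 0 := by
      rw [Matrix.mulVec_mulVec, h1, Matrix.one_mulVec]
    have h4 := congrFun h3 (b, x)
    rw [Matrix.mulVec, dotProduct, Fintype.sum_prod_type] at h4
    exact h4
  · intro v' a' v a
    have h4 := congrFun (congrFun h2 (v', a')) (v, a)
    rw [Matrix.mul_apply, Fintype.sum_prod_type, Matrix.one_apply] at h4
    refine h4.trans ?_
    simp only [Prod.mk.injEq]
    congr 1
    exact propext ⟨fun h => ⟨h.1.symm, h.2.symm⟩, fun h => ⟨h.1.symm, h.2.symm⟩⟩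
end clinj

section model
variable {F : Type} [Field F] (q : F) {n : ℕ} (s : Fin n → F)

def mR (a b c d : Fin n) : F :=
  if a = b then (if c = a ∧ d = a then s a else 0)
  else if a < b then (if c = b ∧ d = a then q else 0)
  else (if c = a ∧ d = b then q - 1 else 0) + (if c = b ∧ d = a then 1 else 0)

variable {B : Type} [Ring B] [Algebra F B] (l : Lv (Fin n) B)

theorem mR_sum {M : Type} [AddCommGroup M] [Module F M] (a b : Fin n) (z : Fin n → Fin n → M) :
    ∑ c, ∑ d, mR q s a b c d • z c d =
      if a = b then s a • z a a else if a < b then q • z b a else (q - 1) • z a b + z b a := by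
  have key : ∀ (x y : Fin n) (r : F), ∑ c, ∑ d, (if c = x ∧ d = y then r else 0) • z c d = r • z x y := by
    intro x y r
    rw [Finset.sum_eq_single x, Finset.sum_eq_single y]
    · rw [if_pos ⟨rfl, rfl⟩]
    · intro d _ hd; rw [if_neg (fun h => hd h.2), zero_smul]
    · simp
    · intro c _ hc
      exact Finset.sum_eq_zero (fun d _ => by rw [if_neg (fun h => hc h.1), zero_smul])
    · simp
  unfold mR
  split_ifs with h1 h2
  · rw [key]
  · rw [key]
  · simp only [add_smul, Finset.sum_add_distrib, key, one_smul]

theorem d_d_T0 (a b : Fin n) : l.d b * l.d a * l.T0 (mR q s) =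
    if a = b then s a • (l.d a * l.d a) else if a < b then q • (l.d a * l.d b) else (q - 1) • (l.d b * l.d a) + l.d a * l.d b := by
  rw [← mR_sum q s a b (fun c d => l.d d * l.d c), mul_assoc, Lv.d_T0, Finset.mul_sum, Finset.sum_eq_single b]
  · rw [Finset.mul_sum]
    refine Finset.sum_congr rfl (fun c _ => ?_)
    rw [Finset.mul_sum]
    refine Finset.sum_congr rfl (fun d _ => ?_)
    rw [mul_smul_comm, ← mul_assoc, l.de, if_pos rfl, one_mul]
  · intro x _ hx
    rw [Finset.mul_sum]
    refine Finset.sum_eq_zero (fun c _ => ?_)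
    rw [Finset.mul_sum]
    refine Finset.sum_eq_zero (fun d _ => ?_)
    rw [mul_smul_comm, ← mul_assoc, l.de, if_neg hx.symm, zero_mul, smul_zero]
  · simp

theorem dT_eq (a : Fin n) : l.d a * l.d a * l.T0 (mR q s) = s a • (l.d a * l.d a) := by
  rw [d_d_T0, if_pos rfl]
theorem dT_lt {a b : Fin n} (h : a < b) : l.d b * l.d a * l.T0 (mR q s) = q • (l.d a * l.d b) := by
  rw [d_d_T0, if_neg h.ne, if_pos h]
theorem dT_gt {a b : Fin n} (h : b < a) : l.d b * l.d a * l.T0 (mR q s) = (q - 1) • (l.d b * l.d a) + l.d a * l.d b := by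
  rw [d_d_T0, if_neg h.ne', if_neg (by exact h.not_gt)]

theorem m_hecke (hs : ∀ a, s a = q ∨ s a = -1) :
    l.T0 (mR q s) * l.T0 (mR q s) = (q - 1) • l.T0 (mR q s) + algebraMap F B q := by
  apply l.eq_of_d; intro a
  apply l.eq_of_d; intro b
  rw [← mul_assoc, ← mul_assoc, ← mul_assoc, mul_add, mul_smul_comm, ← Algebra.commutes, ← Algebra.smul_def]
  rcases lt_trichotomy a b with h | rfl | h
  · simp only [dT_lt q s l h, dT_gt q s l h, smul_mul_assoc]
    match_scalars <;> ring
  · simp only [dT_eq q s l, smul_mul_assoc]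
    rcases hs a with h | h <;> simp only [h] <;> match_scalars <;> ring
  · simp only [dT_lt q s l h, dT_gt q s l h, smul_mul_assoc, add_mul]
    try match_scalars <;> ring

theorem m_braid (hs : ∀ a, s a = q ∨ s a = -1) :
    l.T0 (mR q s) * l.s (l.T0 (mR q s)) * l.T0 (mR q s) = l.s (l.T0 (mR q s)) * l.T0 (mR q s) * l.s (l.T0 (mR q s)) := by
  have E0 := dT_eq q s l
  have E1 := @dT_lt _ _ q _ s _ _ _ l
  have E2 := @dT_gt _ _ q _ s _ _ _ l
  generalize l.T0 (mR q s) = t at *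
  have e0 : ∀ a c, l.d c * l.d a * l.d a * t = s a • (l.d c * l.d a * l.d a) := by
    intro a c; rw [mul_assoc (l.d c), mul_assoc, E0, mul_smul_comm]
  have e1 : ∀ a b c, a < b → l.d c * l.d b * l.d a * t = q • (l.d c * l.d a * l.d b) := by
    intro a b c h; rw [mul_assoc (l.d c), mul_assoc, E1 h, mul_smul_comm, mul_assoc]
  have e2 : ∀ a b c, b < a → l.d c * l.d b * l.d a * t = (q - 1) • (l.d c * l.d b * l.d a) + l.d c * l.d a * l.d b := by
    intro a b c h; rw [mul_assoc (l.d c), mul_assoc, E2 h, mul_add, mul_smul_comm, mul_assoc (l.d c) (l.d a)]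
  have f0 : ∀ a c, l.d a * l.d a * l.d c * l.s t = s a • (l.d a * l.d a * l.d c) := by
    intro a c; rw [mul_assoc, Lv.d_s, ← mul_assoc, E0, smul_mul_assoc]
  have f1 : ∀ a b c, a < b → l.d b * l.d a * l.d c * l.s t = q • (l.d a * l.d b * l.d c) := by
    intro a b c h; rw [mul_assoc, Lv.d_s, ← mul_assoc, E1 h, smul_mul_assoc]
  have f2 : ∀ a b c, b < a → l.d b * l.d a * l.d c * l.s t = (q - 1) • (l.d b * l.d a * l.d c) + l.d a * l.d b * l.d c := by
    intro a b c h; rw [mul_assoc, Lv.d_s, ← mul_assoc, E2 h, add_mul, smul_mul_assoc]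
  apply l.eq_of_d; intro a
  apply l.eq_of_d; intro b
  apply l.eq_of_d; intro c
  have h2 : ∀ a, s a * s a = (q - 1) * s a + q := by
    intro a; rcases hs a with h | h <;> rw [h] <;> ring
  simp only [← mul_assoc]
  rcases lt_trichotomy a b with hab | hab | hab <;> rcases lt_trichotomy b c with hbc | hbc | hbc <;>
    rcases lt_trichotomy a c with hac | hac | hac <;>
    first
    | (exfalso; omega)
    | (subst_vars
       simp (disch := assumption) only [e0, e1, e2, f0, f1, f2, smul_mul_assoc, add_mul, smul_add, smul_smul]
       try (match_scalars <;> first | ring1 | linear_combination (q - 1) * h2 _ | linear_combination (1 - q) * h2 _ | linear_combination q * h2 _ | linear_combination - q * h2 _ | linear_combination h2 _ | linear_combination - h2 _ | skip))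


/-- model data -/
def mD (hs : ∀ a, s a = q ∨ s a = -1) : Dat F q (Fin n) B :=
  { l with R := mR q s, hecke := m_hecke q s l hs, braid := m_braid q s l hs }

variable {q s} (hs : ∀ a, s a = q ∨ s a = -1)

theorem mR_row (v b x : Fin n) (z : Fin n → F) : ∑ a, mR q s v b a x * z a =
    if v = b then (if x = b then s b * z b else 0) else if v < b then (if x = v then q * z b else 0)
      else (if x = b then (q - 1) * z v else 0) + (if x = v then z b else 0) := by
  have key : ∀ (c d : Fin n) (r : F), ∑ a, (if a = c ∧ x = d then r else 0) * z a = if x = d then r * z c else 0 := by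
    intro c d r
    rw [Finset.sum_eq_single c]
    · by_cases h : x = d <;> simp [h]
    · intro a _ ha; rw [if_neg (fun h => ha h.1), zero_mul]
    · simp
  unfold mR
  split_ifs with h1 h2 h3 h4 h5 h6 h7 h8
  all_goals first | (subst h1; rw [key]; simp [*]; done) | (rw [key]; simp [*]; done) | (simp only [add_mul, Finset.sum_add_distrib, key]; (try subst x); simp [*]; try tauto)

theorem mD_Cl (hq0 : q ≠ 0) : Nonempty (mD q s l hs).Cl := by
  apply Cl_of_inj
  intro z h
  have h' : ∀ b x, ∑ v, ∑ a, mR q s v b a x * z v a = 0 := h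
  simp only [mR_row] at h'
  have hoff : ∀ b x, b ≠ x → z x b = 0 := by
    intro b x hbx
    have h1 := h' b x
    rw [Finset.sum_eq_single x] at h1
    · rw [if_neg hbx.symm] at h1
      by_cases h2 : x < b
      · simpa [h2, hq0] using h1
      · simpa [h2, hbx.symm] using h1
    · intro v _ hv
      simp [hv.symm, hbx.symm]
    · simp
  have hdiag : ∀ k : ℕ, ∀ b : Fin n, n - b.1 = k → z b b = 0 := by
    intro k
    induction k using Nat.strong_induction_on with
    | _ k ih =>
      intro b hb
      have h1 := h' b b
      rw [Finset.sum_eq_single b] at h1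
      · have hsb : s b ≠ 0 := by rcases hs b with h | h <;> rw [h] <;> simp [hq0]
        simpa [hsb] using h1
      · intro v _ hv
        by_cases h2 : v < b
        · simp [hv, h2, Ne.symm hv]
        · have h3 : b < v := lt_of_le_of_ne (not_lt.1 h2) (Ne.symm hv)
          have h4 := ih (n - v.1) (by have := v.2; have : b.1 < v.1 := h3; omega) v rfl
          simp [hv, h2, Ne.symm hv, h4]
      · simp
  intro v a
  by_cases h1 : v = a
  · subst h1; exact hdiag _ v rfl
  · exact hoff a v (Ne.symm h1)

theorem mD_GC (g : Fin n → F) : (mD q s l hs).GC g := by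
  intro a b c d
  change mR q s a b c d * _ = mR q s a b c d * _
  unfold mR
  split_ifs with h1 h2 h3 h4 h5 h6 <;> simp_all [mul_comm]

/-- the recursion vector -/
def uk (q : F) (s g : Fin n → F) : ℕ → Fin n → F
  | 0 => g
  | k + 1 => fun b => g b * (s b * uk q s g k b + (q - 1) * ∑ a, if b < a then uk q s g k a else 0)

theorem Pt_G1T (g h : Fin n → F) : l.Pt g (l.G1 h * l.T0 (mR q s)) =
    l.G1 (fun b => s b * (g b * h b) + (q - 1) * ∑ a, if b < a then g a * h a else 0) := by
  have h1 : ∀ a, l.d a * l.G1 h = h a • l.d a := by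
    intro a
    rw [Lv.G1, Finset.mul_sum]
    simp only [mul_smul_comm, ← mul_assoc, l.de, ite_mul, one_mul, zero_mul, smul_ite, smul_zero, Finset.sum_ite_eq, Finset.mem_univ, if_true]
  have h2 : ∀ a, l.d a * l.T0 (mR q s) * l.e a = ∑ b, (if b = a then s a else if b < a then q - 1 else 0) • (l.e b * l.d b) := by
    intro a
    rw [Lv.d_T0, Finset.sum_mul]
    refine Finset.sum_congr rfl (fun b _ => ?_)
    rw [mR_sum q s a b (fun c d => l.e b * (l.d d * l.d c))]
    rcases lt_trichotomy a b with hab | hab | hab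
    · rw [if_neg hab.ne, if_pos hab, if_neg hab.ne', if_neg hab.not_gt, smul_mul_assoc, mul_assoc, mul_assoc, l.de, if_neg hab.ne']; simp
    · subst hab; rw [if_pos rfl, if_pos rfl, smul_mul_assoc, mul_assoc, mul_assoc, l.de, if_pos rfl, mul_one]
    · rw [if_neg hab.ne', if_neg hab.not_gt, if_neg hab.ne, if_pos hab, add_mul, smul_mul_assoc, mul_assoc, mul_assoc, l.de, if_pos rfl, mul_one,
        mul_assoc, mul_assoc, l.de, if_neg hab.ne]; simp
  rw [Lv.Pt_apply]
  conv_rhs => rw [Lv.G1]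
  have h3 : ∀ a, l.d a * (l.G1 h * l.T0 (mR q s)) * l.e a = h a • (l.d a * l.T0 (mR q s) * l.e a) := by
    intro a; rw [← mul_assoc, h1, smul_mul_assoc, smul_mul_assoc]
  simp only [h3, h2, Finset.smul_sum, smul_smul]
  rw [Finset.sum_comm]
  refine Finset.sum_congr rfl (fun b _ => ?_)
  rw [← Finset.sum_smul]
  congr 1
  rw [Finset.mul_sum, ← Finset.add_sum_erase (M := F) Finset.univ _ (Finset.mem_univ b)]
  conv_rhs => rw [← Finset.add_sum_erase (M := F) Finset.univ _ (Finset.mem_univ b)]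
  rw [if_pos rfl, if_neg (lt_irrefl b), mul_zero, zero_add, mul_comm (s b)]
  rw [mul_assoc]
  congr 1
  refine Finset.sum_congr rfl (fun a ha => ?_)
  have hab := Finset.ne_of_mem_erase ha
  rw [if_neg (Ne.symm hab)]
  split_ifs <;> ring

theorem mD_pk [Nontrivial B] (g : Fin n → F) (k : ℕ) : (mD q s l hs).pk g (k+1) = ∑ b, uk q s g k b := by
  have key : ∀ k j (h : Fin n → F), (fun b => g b * h b) = uk q s g j →
      (mD q s l hs).tb g (k+1) (l.G1 h * (mD q s l hs).ρ (c1 k)) = ∑ b, uk q s g (j + k) b := by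
    intro k
    induction k with
    | zero =>
      intro j h hj
      rw [Dat.tb_apply, c1, map_one, mul_one, Lv.ptN_s, Lv.ptN_0, Lv.Pt_apply, map_sum]
      refine Finset.sum_congr rfl (fun a _ => ?_)
      change eps F B (g a • (l.d a * l.G1 h * l.e a)) = _
      rw [add_zero, ← hj, Lv.G1, Finset.mul_sum]
      simp only [mul_smul_comm, ← mul_assoc, l.de, ite_mul, one_mul, zero_mul, smul_ite, smul_zero, Finset.sum_ite_eq, Finset.mem_univ, if_true]
      rw [smul_mul_assoc, l.de, if_pos rfl, map_smul, map_smul, eps_one]; simp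
    | succ k ih =>
      intro j h hj
      rw [Dat.tb_apply, c1_succ', map_mul (mD q s l hs).ρ, Dat.ρ_sh, ← mul_assoc, Lv.ptN_s, Lv.Pt_s_right, Dat.ρ_T0]
      have := Pt_G1T (q := q) (s := s) l g h
      change eps F B ((mD q s l hs).l.ptN g (k+1) (l.Pt g (l.G1 h * l.T0 (mR q s)) * _)) = _
      rw [this, ← Dat.tb_apply]
      rw [ih (j+1), show j + 1 + k = j + (k + 1) by ring]
      funext b
      rw [uk, ← hj]
  have h1 := key k 0 (fun _ => 1) (by funext b; simp [uk])
  rw [zero_add] at h1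
  rw [← h1, Dat.pk, Dat.tt_apply]
  congr 1
  have : l.G1 (fun _ => (1:F)) = 1 := by rw [Lv.G1]; simp only [one_smul]; exact l.ed
  rw [this, one_mul]; rfl

open PowerSeries in
theorem ps_prod (n : ℕ) (q : F) (s g : Fin n → F) (U : Fin n → PowerSeries F)
    (hU : ∀ b, U b = PowerSeries.C (g b) * PowerSeries.X * (1 + PowerSeries.C (q - 1) * ∑ a, if b < a then U a else 0) + PowerSeries.C (s b * g b) * PowerSeries.X * U b) :
    (1 + PowerSeries.C (q - 1) * ∑ b, U b) * ∏ b, (1 - PowerSeries.C (s b * g b) * PowerSeries.X) =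
      ∏ b, (1 + PowerSeries.C ((q - 1 - s b) * g b) * PowerSeries.X) := by
  induction n with
  | zero => simp
  | succ n ih =>
    have h1 := ih (fun i => s i.succ) (fun i => g i.succ) (fun i => U i.succ) (fun i => by
      have := hU i.succ
      rw [Fin.sum_univ_succ, if_neg (Fin.not_lt_zero _), zero_add] at this
      simp only [Fin.succ_lt_succ_iff] at this
      exact this)
    have h2 := hU 0
    rw [Fin.sum_univ_succ, if_neg (lt_irrefl _), zero_add] at h2
    simp only [Fin.succ_pos, if_true] at h2
    rw [Fin.sum_univ_succ, Fin.prod_univ_succ, Fin.prod_univ_succ, ← h1]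
    set S := ∑ i : Fin n, U i.succ
    set P := ∏ i : Fin n, (1 - PowerSeries.C (s i.succ * g i.succ) * PowerSeries.X)
    simp only [map_mul, map_sub, map_one] at h2 ⊢
    linear_combination (PowerSeries.C q - 1) * P * h2

/-- generating series of the `p_k` -/
def Phi (q : F) (p : ℕ → F) : PowerSeries F := PowerSeries.mk (fun k => if k = 0 then 1 else (q - 1) * p k)

theorem mD_Phi [Nontrivial B] (g : Fin n → F) :
    Phi q ((mD q s l hs).pk g) * ∏ b, (1 - PowerSeries.C (s b * g b) * PowerSeries.X) =
      ∏ b, (1 + PowerSeries.C ((q - 1 - s b) * g b) * PowerSeries.X) := by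
  rw [← ps_prod n q s g (fun b => PowerSeries.mk (fun k => if k = 0 then 0 else uk q s g (k-1) b))]
  · congr 1
    ext k
    rcases k with _ | k
    · simp [Phi]
    · rw [map_add, PowerSeries.coeff_C_mul, map_sum]
      simp [Phi, mD_pk, PowerSeries.coeff_one]
  · intro b
    ext k
    rcases k with _ | k
    · simp [mul_assoc]
    · rw [map_add, mul_right_comm, mul_right_comm _ PowerSeries.X, PowerSeries.coeff_succ_mul_X, PowerSeries.coeff_succ_mul_X, PowerSeries.coeff_C_mul,
        PowerSeries.coeff_C_mul, map_add, PowerSeries.coeff_C_mul, map_sum]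
      simp only [PowerSeries.coeff_mk, PowerSeries.coeff_one, apply_ite (PowerSeries.coeff k), map_zero]
      rcases k with _ | k
      · simp [uk]
      · simp [uk]; ring

theorem Phi_inj {q : F} (hq1 : q ≠ 1) {p p' : ℕ → F} (h : Phi q p = Phi q p') (k : ℕ) (hk : 1 ≤ k) : p k = p' k := by
  have h1 := congrArg (PowerSeries.coeff k) h
  rw [Phi, Phi, PowerSeries.coeff_mk, PowerSeries.coeff_mk, if_neg (by omega), if_neg (by omega)] at h1
  exact mul_left_cancel₀ (sub_ne_zero.2 hq1) h1

theorem rescale_lin (c a : F) : PowerSeries.rescale c (1 + PowerSeries.C a * PowerSeries.X) = 1 + PowerSeries.C (c * a) * PowerSeries.X := by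
  ext k
  rw [PowerSeries.coeff_rescale, map_add, map_add, PowerSeries.coeff_C_mul, PowerSeries.coeff_C_mul, PowerSeries.coeff_one, PowerSeries.coeff_X]
  rcases k with _ | k
  · simp
  · rcases k with _ | k <;> simp

theorem poly_split [IsAlgClosed F] (P : F[X]) (h0 : P.eval 0 = 1) : ∃ (n : ℕ) (g : Fin n → F),
    P = ∏ i, (1 + Polynomial.C (g i) * Polynomial.X) := by
  have hP : P ≠ 0 := by rintro rfl; simp at h0
  have h1 := (IsAlgClosed.splits P).eq_prod_roots
  have h2 : ∀ M : Multiset F, (∀ r ∈ M, r ≠ 0) → ∃ c : F, (M.map (fun r => Polynomial.X - Polynomial.C r)).prod = Polynomial.C c * (M.map (fun r => 1 + Polynomial.C (-r⁻¹) * Polynomial.X)).prod := by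
    intro M
    induction M using Multiset.induction_on with
    | empty => intro _; exact ⟨1, by simp⟩
    | cons r M ih =>
      intro hM
      obtain ⟨c, hc⟩ := ih (fun r hr => hM r (Multiset.mem_cons_of_mem hr))
      have hr := hM r (Multiset.mem_cons_self _ _)
      refine ⟨-r * c, ?_⟩
      rw [Multiset.map_cons, Multiset.prod_cons, hc, Multiset.map_cons, Multiset.prod_cons]
      have : Polynomial.X - Polynomial.C r = Polynomial.C (-r) * (1 + Polynomial.C (-r⁻¹) * Polynomial.X) := by
        rw [mul_add, mul_one, ← mul_assoc, ← Polynomial.C_mul, neg_mul_neg, mul_inv_cancel₀ hr]; simp; ring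
      rw [this, Polynomial.C_mul]; ring
  obtain ⟨c, hc⟩ := h2 P.roots (fun r hr hr0 => by
    have := Polynomial.isRoot_of_mem_roots hr
    rw [hr0, Polynomial.IsRoot, h0] at this
    exact one_ne_zero this)
  rw [hc, ← mul_assoc, ← Polynomial.C_mul] at h1
  set L := P.roots.toList with hL
  have h3 : (P.roots.map (fun r => 1 + Polynomial.C (-r⁻¹) * Polynomial.X)).prod = ∏ i : Fin L.length, (1 + Polynomial.C (-(L.get i)⁻¹) * Polynomial.X) := by
    rw [← Multiset.coe_toList P.roots, ← hL, Multiset.map_coe, Multiset.prod_coe, ← Fin.prod_univ_fun_getElem]; rfl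
  refine ⟨L.length, fun i => -(L.get i)⁻¹, ?_⟩
  rw [h3] at h1
  have h4 := h0
  rw [h1, Polynomial.eval_mul, Polynomial.eval_prod] at h4
  simp at h4
  rw [h1, h4]; simp

theorem tau_exists [IsAlgClosed F] {q : F} (hq1 : q ≠ 1) (hq : ∀ n, qn q (n+1) ≠ 0) (N : ℕ) :
    ∃ (n : ℕ) (_ : NeZero n) (g : Fin n → F),
      (mD q (fun _ => q) (lvF F (Fin n)) (fun _ => Or.inl rfl)).pk g 1 = 1 ∧
      ∀ k, 2 ≤ k → k ≤ N → (mD q (fun _ => q) (lvF F (Fin n)) (fun _ => Or.inl rfl)).pk g k = 0 := by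
  have hf : ∃ f : ℕ → F, f 0 = 1 ∧ ∀ k, qn q (k+1) * f (k+1) = q ^ k * f k := by
    refine ⟨fun k => Nat.rec 1 (fun k x => q ^ k * x / qn q (k+1)) k, rfl, fun k => ?_⟩
    rw [mul_div_cancel₀ _ (hq k)]
  obtain ⟨f, f0, fs⟩ := hf
  have hqn : ∀ k, (q - 1) * qn q k = q ^ k - 1 := by
    intro k; rw [qn]; exact mul_geom_sum q k
  obtain ⟨n, g, hg⟩ := poly_split (∑ k ∈ Finset.range (N+2), Polynomial.C (f k) * Polynomial.X ^ k) (by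
    rw [Finset.sum_range_succ']; simp [f0, Polynomial.eval_finset_sum])
  have hcf : ∀ k, k ≤ N + 1 → (∏ i, (1 + Polynomial.C (g i) * Polynomial.X)).coeff k = f k := by
    intro k hk
    rw [← hg, Polynomial.finset_sum_coeff]
    simp only [Polynomial.coeff_C_mul_X_pow]
    rw [Finset.sum_ite_eq, if_pos (Finset.mem_range.2 (by omega))]
  have f1 : f 1 = 1 := by have := fs 0; simpa [qn, f0] using this
  have hn : NeZero n := ⟨by
    rintro rfl
    have := hcf 1 (by omega)
    rw [f1] at this
    simp [Polynomial.coeff_one] at this⟩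
  refine ⟨n, hn, g, ?_⟩
  have hP := mD_Phi (q := q) (s := fun _ => q) (lvF F (Fin n)) (fun _ => Or.inl rfl) g
  set p := (mD q (fun _ => q) (lvF F (Fin n)) (fun _ => Or.inl rfl)).pk g
  have hc : ∀ (c : F) k, k ≤ N + 1 → PowerSeries.coeff k (∏ i, (1 + PowerSeries.C (c * g i) * PowerSeries.X) : PowerSeries F) = c ^ k * f k := by
    intro c k hk
    have : (∏ i, (1 + PowerSeries.C (c * g i) * PowerSeries.X) : PowerSeries F) = PowerSeries.rescale c ((∏ i, (1 + Polynomial.C (g i) * Polynomial.X) : F[X]) : PowerSeries F) := by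
      rw [← Polynomial.coeToPowerSeries.ringHom_apply, map_prod, map_prod]
      refine Finset.prod_congr rfl (fun i _ => ?_)
      rw [Polynomial.coeToPowerSeries.ringHom_apply, Polynomial.coe_add, Polynomial.coe_mul, Polynomial.coe_one, Polynomial.coe_C, Polynomial.coe_X, rescale_lin]
    rw [this, PowerSeries.coeff_rescale, Polynomial.coeff_coe, hcf k hk]
  have e1 : (∏ b : Fin n, (1 - PowerSeries.C (q * g b) * PowerSeries.X) : PowerSeries F) = ∏ i, (1 + PowerSeries.C ((-q) * g i) * PowerSeries.X) := by
    refine Finset.prod_congr rfl (fun i _ => ?_)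
    rw [neg_mul, map_neg]; ring
  have e2 : (∏ b : Fin n, (1 + PowerSeries.C ((q - 1 - q) * g b) * PowerSeries.X) : PowerSeries F) = ∏ i, (1 + PowerSeries.C ((-1) * g i) * PowerSeries.X) := by
    refine Finset.prod_congr rfl (fun i _ => ?_)
    rw [show q - 1 - q = -1 by ring]
  rw [e1, e2] at hP
  set A := (∏ i, (1 + PowerSeries.C ((-q) * g i) * PowerSeries.X) : PowerSeries F) with hA
  have hAu : IsUnit A := by
    rw [PowerSeries.isUnit_iff_constantCoeff, ← PowerSeries.coeff_zero_eq_constantCoeff_apply, hc _ 0 (by omega), f0]; simp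
  have hd : PowerSeries.X ^ (N+1) ∣ (Phi q p - (1 + PowerSeries.C (q - 1) * PowerSeries.X)) * A := by
    rw [PowerSeries.X_pow_dvd_iff]
    intro k hk
    rw [sub_mul, hP, add_mul, one_mul, map_sub, map_add, hc _ k (by omega), hc _ k (by omega), mul_assoc, PowerSeries.coeff_C_mul]
    rcases k with _ | k
    · simp
    · rw [PowerSeries.coeff_succ_X_mul, hc _ k (by omega)]
      have h1 := fs k
      have h2 := hqn (k+1)
      rw [neg_pow q, neg_pow q, pow_succ (-1 : F)]
      linear_combination -(-1 : F)^k * f (k+1) * h2 + (-1 : F)^k * (q - 1) * h1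
  rw [hAu.dvd_mul_right, PowerSeries.X_pow_dvd_iff] at hd
  have hco : ∀ k, 1 ≤ k → k ≤ N → (q - 1) * p k = if k = 1 then q - 1 else 0 := by
    intro k h1 hk
    have := hd k (by omega)
    rw [map_sub, map_add, PowerSeries.coeff_C_mul, PowerSeries.coeff_one, if_neg (by omega), PowerSeries.coeff_X, Phi, PowerSeries.coeff_mk, if_neg (by omega)] at this
    rw [sub_eq_zero.1 this]; simp
  have hq1' := sub_ne_zero.2 hq1
  refine ⟨?_, fun k h1 hk => ?_⟩
  · have h1 := Dat.pk_one (mD q (fun _ => q) (lvF F (Fin n)) (fun _ => Or.inl rfl)) g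
    refine h1.trans ?_
    have h2 := hcf 1 (by omega)
    rw [f1] at h2
    rw [← h2]
    clear * -
    have : ∀ s : Finset (Fin n), (∏ i ∈ s, (1 + Polynomial.C (g i) * Polynomial.X)).coeff 0 = 1 ∧ ∑ i ∈ s, g i = (∏ i ∈ s, (1 + Polynomial.C (g i) * Polynomial.X)).coeff 1 := by
      intro s
      induction s using Finset.induction_on with
      | empty => simp [Polynomial.coeff_one]
      | insert a s ha ih =>
        rw [Finset.prod_insert ha, Finset.sum_insert ha, add_mul, one_mul, mul_assoc]
        refine ⟨by simp [ih.1], ?_⟩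
        rw [Polynomial.coeff_add, Polynomial.coeff_C_mul, Polynomial.coeff_X_mul, ih.1, ih.2]; ring
    exact (this Finset.univ).2
  · have := hco k (by omega) hk
    rw [if_neg (by omega)] at this
    exact (mul_eq_zero.1 this).resolve_left hq1'
end model
end HS

namespace HS

section mat
variable {F : Type} [Field F] [CharZero F] {W : Type} [Fintype W] [DecidableEq W]

theorem idem_trace {P : Matrix W W F} (h : P * P = P) : ∃ k : ℕ, P.trace = k ∧ (k = 0 → P = 0) := by
  have he : IsIdempotentElem (Matrix.toLin' P) := by
    change Matrix.toLin' P ∘ₗ Matrix.toLin' P = _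
    rw [← Matrix.toLin'_mul, h]
  have h2 := (LinearMap.IsIdempotentElem.isProj_range _ he).trace
  refine ⟨_, (Matrix.trace_toLin'_eq P).symm.trans h2, fun h0 => ?_⟩
  have h3 : LinearMap.trace F _ (Matrix.toLin' P) = 0 := by rw [h2, h0]; simp
  have h4 := LinearMap.IsIdempotentElem.eq_zero_of_trace_eq_zero he h3
  exact Matrix.toLin'.map_eq_zero_iff.1 h4

theorem nil_of_trace (φ : ℝ →+* F) (γ : W → ℝ) (hγ : ∀ w, 0 < γ w) {m : Matrix W W F}
    (hc : Matrix.diagonal (fun w => φ (γ w)) * m = m * Matrix.diagonal (fun w => φ (γ w)))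
    (ht : ∀ j, 1 ≤ j → (Matrix.diagonal (fun w => φ (γ w)) * m ^ j).trace = 0) : ∃ a, m ^ a = 0 := by
  set G := Matrix.diagonal (fun w => φ (γ w)) with hG
  obtain ⟨h, hh, hnd⟩ := Polynomial.exists_eq_pow_rootMultiplicity_mul_and_not_dvd (minpoly F m)
    (minpoly.ne_zero (Algebra.IsIntegral.isIntegral m)) 0
  set a := (minpoly F m).rootMultiplicity 0
  rw [Polynomial.C_0, sub_zero] at hh hnd
  have hco : IsCoprime (Polynomial.X ^ (a+1)) h :=
    ((Polynomial.prime_X (R := F)).coprime_iff_not_dvd.2 hnd).pow_left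
  obtain ⟨u, v, huv⟩ := hco
  have hz : Polynomial.aeval m (Polynomial.X ^ a * h) = 0 := by rw [← hh]; exact minpoly.aeval F m
  set P := Polynomial.aeval m (u * Polynomial.X ^ (a+1)) with hP
  have hP2 : P * P = P := by
    have : u * Polynomial.X ^ (a+1) * (u * Polynomial.X ^ (a+1)) = u * Polynomial.X ^ (a+1) - (u * v * Polynomial.X) * (Polynomial.X ^ a * h) := by
      linear_combination (u * Polynomial.X ^ (a+1)) * huv
    rw [hP, ← map_mul, this, map_sub, map_mul _ _ (Polynomial.X ^ a * h), hz, mul_zero, sub_zero]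
  have hcP : Commute G P := by
    have hc' : Commute m G := hc.symm
    rw [hP]
    refine Polynomial.induction_on (motive := fun p => Commute G (Polynomial.aeval m p)) _ ?_ ?_ ?_
    · intro c; rw [Polynomial.aeval_C]; exact (Algebra.commutes c G).symm
    · intro p p' h1 h2; rw [map_add]; exact h1.add_right h2
    · intro n c _
      rw [map_mul, map_pow, Polynomial.aeval_C, Polynomial.aeval_X]
      exact (show Commute G _ from (Algebra.commutes c G).symm).mul_right (hc'.symm.pow_right _)
  have htP : (G * P).trace = 0 := by
    have h1 : ∀ p : F[X], (G * Polynomial.aeval m (p * Polynomial.X ^ (a+1))).trace = 0 := by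
      intro p
      induction p using Polynomial.induction_on' with
      | add p p' h1 h2 => rw [add_mul, map_add, mul_add, Matrix.trace_add, h1, h2, add_zero]
      | monomial k c =>
        rw [← Polynomial.C_mul_X_pow_eq_monomial, mul_assoc, ← pow_add, map_mul, Polynomial.aeval_C, map_pow, Polynomial.aeval_X,
          ← Algebra.smul_def, mul_smul_comm, Matrix.trace_smul, ht _ (by omega), smul_zero]
    exact h1 u
  -- commuting blocks
  have hent : ∀ w w', γ w ≠ γ w' → P w w' = 0 := by
    intro w w' hne
    have h1 := congrFun (congrFun hcP.eq w) w'
    rw [hG, Matrix.diagonal_mul, Matrix.mul_diagonal, mul_comm (P w w'), ← sub_eq_zero, ← sub_mul, ← map_sub] at h1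
    refine (mul_eq_zero.1 h1).resolve_left ?_
    rw [map_eq_zero]
    exact sub_ne_zero.2 hne
  have hblk : ∀ lam : ℝ, ∃ k : ℕ, (∑ w, if γ w = lam then P w w else 0) = (k : F) ∧ (k = 0 → ∀ w w', γ w = lam → P w w' = 0) := by
    intro lam
    set E : Matrix W W F := fun w w' => if γ w = lam then P w w' else 0 with hE
    have hE2 : E * E = E := by
      ext w w'
      rw [Matrix.mul_apply]
      simp only [hE]
      by_cases h1 : γ w = lam
      · simp only [h1, if_true]
        conv_rhs => rw [← hP2, Matrix.mul_apply]
        refine Finset.sum_congr rfl (fun x _ => ?_)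
        by_cases h2 : γ x = lam
        · rw [if_pos h2]
        · rw [if_neg h2, hent w x (by rw [h1]; exact Ne.symm h2)]; simp
      · simp [h1]
    obtain ⟨k, hk, hk0⟩ := idem_trace hE2
    refine ⟨k, hk, fun h0 w w' hw => ?_⟩
    have := congrFun (congrFun (hk0 h0) w) w'
    simpa [hE, hw] using this
  choose k hk hk0 using hblk
  have hsum : φ (∑ lam ∈ Finset.univ.image γ, lam * k lam) = 0 := by
    rw [← htP, Matrix.trace, map_sum]
    simp only [Matrix.diag_apply, hG, Matrix.diagonal_mul]
    rw [← Finset.sum_fiberwise_of_maps_to (s := Finset.univ) (t := Finset.univ.image γ) (g := γ) (fun w hw => Finset.mem_image_of_mem γ hw)]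
    refine Finset.sum_congr rfl (fun lam _ => ?_)
    rw [map_mul, map_natCast, ← hk, Finset.mul_sum, Finset.sum_filter]
    refine Finset.sum_congr rfl (fun w _ => ?_)
    split_ifs with h1
    · rw [h1]
    · simp
  rw [map_eq_zero] at hsum
  have hP0 : P = 0 := by
    ext w w'
    rw [Finset.sum_eq_zero_iff_of_nonneg] at hsum
    · have h1 := hsum (γ w) (Finset.mem_image_of_mem γ (Finset.mem_univ w))
      have h2 : (k (γ w) : ℝ) = 0 := (mul_eq_zero.1 h1).resolve_left (hγ w).ne'
      exact hk0 (γ w) (by exact_mod_cast h2) w w' rfl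
    · intro lam hl
      obtain ⟨w, -, rfl⟩ := Finset.mem_image.1 hl
      exact mul_nonneg (hγ w).le (Nat.cast_nonneg _)
  refine ⟨a, ?_⟩
  have h5 : (Polynomial.X : F[X]) ^ a = Polynomial.X ^ a * (u * Polynomial.X ^ (a+1)) + v * (Polynomial.X ^ a * h) := by
    linear_combination (-(Polynomial.X : F[X]) ^ a) * huv
  have h6 := congrArg (Polynomial.aeval m) h5
  rwa [map_add, map_mul, map_mul _ v, hz, ← hP, hP0, mul_zero, mul_zero, add_zero, map_pow, Polynomial.aeval_X] at h6
end mat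

theorem gw_map {F : Type} [Field F] {ι : Type} [Fintype ι] [DecidableEq ι] (φ : ℝ →+* F) (γ : ι → ℝ) : ∀ (n : ℕ) (w : Wd ι n), Lv.gw (fun a => φ (γ a)) n w = φ (Lv.gw γ n w)
  | 0, w => by rw [Lv.gw_0, Lv.gw_0, map_one]
  | n + 1, (a, w) => by rw [Lv.gw_s, Lv.gw_s, map_mul, gw_map φ γ n w]

theorem gw_pos {ι : Type} [Fintype ι] [DecidableEq ι] (γ : ι → ℝ) (h : ∀ a, 0 < γ a) : ∀ (n : ℕ) (w : Wd ι n), 0 < Lv.gw γ n w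
  | 0, w => by rw [Lv.gw_0]; exact one_pos
  | n + 1, (a, w) => by rw [Lv.gw_s]; exact mul_pos (h a) (gw_pos γ h n w)

namespace Dat
variable {F : Type} [Field F] {q : F} {ι B : Type} [Fintype ι] [DecidableEq ι] [Ring B] [Algebra F B] [Nontrivial B]

theorem mt_pow (D : Dat F q ι B) {N : ℕ} {z : H F q} (hz : z ∈ HN N) (j : ℕ) :
    (D.l.pw N).mt F (D.ρ (z ^ j)) = (D.l.pw N).mt F (D.ρ z) ^ j := by
  induction j with
  | zero => rw [pow_zero, pow_zero, map_one, Lv.mt_one]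
  | succ j ih =>
    have h1 : (D.l.pw N).Sc F (D.ρ (z ^ j)) := D.S_ρ (pow_mem hz j)
    rw [pow_succ, map_mul D.ρ, Lv.mt_mul h1, ih, pow_succ]

theorem tt_mt (D : Dat F q ι B) (g : ι → F) (N : ℕ) (z : H F q) :
    D.tt g N z = (Matrix.diagonal (Lv.gw g N) * (D.l.pw N).mt F (D.ρ z)).trace := by
  rw [tt_apply, tb_apply, Lv.ptN_eq, Lv.tr_mt]

theorem mt_G_comm {D : Dat F q ι B} {g : ι → F} (hg : D.GC g) {N : ℕ} {z : H F q} (hz : z ∈ HN N) :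
    Matrix.diagonal (Lv.gw g N) * (D.l.pw N).mt F (D.ρ z) = (D.l.pw N).mt F (D.ρ z) * Matrix.diagonal (Lv.gw g N) :=
  Lv.mt_comm _ (D.S_ρ hz) (Gel_comm hg hz)

theorem rho_nil [CharZero F] {D : Dat F q ι B} (φ : ℝ →+* F) (γ : ι → ℝ) (hγ : ∀ a, 0 < γ a) (hg : D.GC (fun a => φ (γ a)))
    {N : ℕ} {z : H F q} (hz : z ∈ HN N) (ht : ∀ j, 1 ≤ j → D.tt (fun a => φ (γ a)) N (z ^ j) = 0) : ∃ a, D.ρ (z ^ a) = 0 := by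
  have hw : Lv.gw (fun a => φ (γ a)) N = fun w => φ (Lv.gw γ N w) := funext (gw_map φ γ N)
  obtain ⟨a, ha⟩ := nil_of_trace φ (Lv.gw γ N) (gw_pos γ hγ N) (m := (D.l.pw N).mt F (D.ρ z))
    (by rw [← hw]; exact mt_G_comm hg hz) (fun j hj => by
      have := ht j hj
      rwa [tt_mt, mt_pow D hz, hw] at this)
  refine ⟨a, ?_⟩
  rw [← mt_pow D hz] at ha
  exact Lv.mt_inj (D.S_ρ (pow_mem hz a)) ha

theorem tt_nil {D : Dat F q ι B} {g : ι → F} (hg : D.GC g) {N : ℕ} {z : H F q} (hz : z ∈ HN N) {a : ℕ} (ha : z ^ a = 0) : D.tt g N z = 0 := by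
  rw [tt_mt]
  have h1 : (D.l.pw N).mt F (D.ρ z) ^ a = 0 := by rw [← mt_pow D hz, ha, map_zero, map_zero]
  have h2 : IsNilpotent (Matrix.diagonal (Lv.gw g N) * (D.l.pw N).mt F (D.ρ z)) :=
    ⟨a, by rw [Commute.mul_pow (mt_G_comm hg hz), h1, mul_zero]⟩
  exact (Matrix.isNilpotent_trace_of_isNilpotent h2).eq_zero

end Dat

section pair
variable {F : Type} [Field F] [CharZero F] [IsAlgClosed F] {q : F}
variable {ι B : Type} [Fintype ι] [DecidableEq ι] [Ring B] [Algebra F B] [Nontrivial B]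
variable {ι' B' : Type} [Fintype ι'] [DecidableEq ι'] [Ring B'] [Algebra F B'] [Nontrivial B']

structure Pair (D : Dat F q ι B) (D' : Dat F q ι' B') (φ : ℝ →+* F) (γ : ι → ℝ) (γ' : ι' → ℝ) : Prop where
  q0 : q ≠ 0
  q1 : q ≠ 1
  qn : ∀ n, qn q (n+1) ≠ 0
  pos : ∀ a, 0 < γ a
  pos' : ∀ a, 0 < γ' a
  gc : D.GC (fun a => φ (γ a))
  gc' : D'.GC (fun a => φ (γ' a))
  pk : ∀ k, 1 ≤ k → D.pk (fun a => φ (γ a)) k = D'.pk (fun a => φ (γ' a)) k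

namespace Pair
variable {D : Dat F q ι B} {D' : Dat F q ι' B'} {φ : ℝ →+* F} {γ : ι → ℝ} {γ' : ι' → ℝ} (h : Pair D D' φ γ γ')

theorem tt_eq (h : Pair D D' φ γ γ') {N : ℕ} {x : H F q} (hx : x ∈ HN N) :
    D.tt (fun a => φ (γ a)) N x = D'.tt (fun a => φ (γ' a)) N x :=
  IsTr.uniq (Dat.isTr h.gc N) (Dat.isTr h.gc' N) (fun k hk _ => h.pk k hk) N le_rfl x hx

theorem exists_tau (h : Pair D D' φ γ γ') (N : ℕ) : ∃ (t : ℕ → H F q →ₗ[F] F) (p : ℕ → F), IsTr N t p ∧ p 1 = 1 ∧ (∀ k, 2 ≤ k → k ≤ N → p k = 0) ∧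
    ∀ n, ∀ z ∈ HN (K := F) (q := q) n, ∀ a, z ^ a = 0 → t n z = 0 := by
  obtain ⟨n, hn, g, h1, h2⟩ := tau_exists h.q1 h.qn N
  refine ⟨_, _, Dat.isTr (mD_GC _ _ g) N, h1, h2, fun k z hz a ha => Dat.tt_nil (mD_GC _ _ g) hz ha⟩

/-- joint faithfulness -/
def Fa (D : Dat F q ι B) (D' : Dat F q ι' B') (N : ℕ) : Prop := ∀ x ∈ HN (K := F) (q := q) N, D.ρ x = 0 → D'.ρ x = 0 → x = 0

theorem nil (h : Pair D D' φ γ γ') {N : ℕ} (hF : Fa D D' N) {x : H F q} (hx : x ∈ HN N)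
    (h0 : ∀ y ∈ HN (K := F) (q := q) N, D.tt (fun a => φ (γ a)) N (x * y) = 0) : x = 0 := by
  obtain ⟨t, p, hT, hp1, hp, hn⟩ := h.exists_tau N
  refine gram_nondeg h.q0 hT hp1 hp le_rfl hx (fun y hy => ?_)
  rw [hT.tr N le_rfl _ hy _ hx]
  have hz : x * y ∈ HN (K := F) (q := q) N := mul_mem hx hy
  have h1 : ∀ j, 1 ≤ j → D.tt (fun a => φ (γ a)) N ((x * y) ^ j) = 0 := by
    intro j hj
    obtain ⟨j, rfl⟩ : ∃ i, j = i + 1 := ⟨j - 1, by omega⟩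
    rw [pow_succ', mul_assoc]
    exact h0 _ (mul_mem hy (pow_mem hz j))
  obtain ⟨a, ha⟩ := Dat.rho_nil φ γ h.pos h.gc hz h1
  obtain ⟨b, hb⟩ := Dat.rho_nil φ γ' h.pos' h.gc' hz (fun j hj => by rw [← h.tt_eq (pow_mem hz j)]; exact h1 j hj)
  refine hn N _ hz (a + b) (hF _ (pow_mem hz _) ?_ ?_)
  · rw [pow_add, map_mul, ha, zero_mul]
  · rw [pow_add, map_mul, hb, mul_zero]

theorem not_Fa (h : Pair D D' φ γ γ') : ∃ N, ¬ Fa D D' N := by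
  set A : ℕ := Fintype.card ι ^ 2 + Fintype.card ι' ^ 2 with hA
  obtain ⟨N, hN, hN1⟩ : ∃ N : ℕ, A ^ N < N.factorial ∧ 1 ≤ N := by
    have h1 := FloorSemiring.tendsto_pow_div_factorial_atTop (A : ℝ)
    have h2 := (h1.eventually (gt_mem_nhds (show (0:ℝ) < 1 by norm_num))).and (Filter.eventually_ge_atTop 1)
    obtain ⟨N, hN, hN1⟩ := h2.exists
    refine ⟨N, ?_, hN1⟩
    rw [div_lt_one (by positivity)] at hN
    exact_mod_cast hN
  refine ⟨N, fun hF => ?_⟩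
  obtain ⟨t, p, hT, hp1, hp, hn⟩ := h.exists_tau N
  obtain ⟨C, i1, i2, hb, yb, κ, hcard, hhb, hyb, hκ, hg, hsp⟩ := gram h.q0 hT hp1 hp N le_rfl
  let f : (C → F) →ₗ[F] H F q := Fintype.linearCombination F hb
  have hf : ∀ c, f c = 0 → c = 0 := by
    intro c hc
    funext i
    have h1 : t N (yb i * f c) = 0 := by rw [hc, mul_zero, map_zero]
    rw [Fintype.linearCombination_apply, Finset.mul_sum, map_sum] at h1
    simp only [mul_smul_comm, map_smul, hg, smul_eq_mul, mul_ite, mul_zero, Finset.sum_ite_eq', Finset.mem_univ, if_true] at h1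
    exact (mul_eq_zero.1 h1).resolve_right (hκ i)
  have hfm : ∀ c, f c ∈ HN (K := F) (q := q) N := by
    intro c
    rw [Fintype.linearCombination_apply]
    exact Subalgebra.sum_mem _ (fun i _ => Subalgebra.smul_mem _ (hhb i) _)
  let G : (C → F) →ₗ[F] Matrix (Wd ι N) (Wd ι N) F × Matrix (Wd ι' N) (Wd ι' N) F :=
    (((D.l.pw N).mt F ∘ₗ D.ρ.toLinearMap).prod ((D'.l.pw N).mt F ∘ₗ D'.ρ.toLinearMap)) ∘ₗ f
  have hG : Function.Injective G := by
    rw [injective_iff_map_eq_zero]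
    intro c hc
    have h1 : (D.l.pw N).mt F (D.ρ (f c)) = 0 := congrArg Prod.fst hc
    have h2 : (D'.l.pw N).mt F (D'.ρ (f c)) = 0 := congrArg Prod.snd hc
    exact hf c (hF _ (hfm c) (Lv.mt_inj (D.S_ρ (hfm c)) h1) (Lv.mt_inj (D'.S_ρ (hfm c)) h2))
  have h3 := LinearMap.finrank_le_finrank_of_injective hG
  rw [Module.finrank_prod, Module.finrank_matrix, Module.finrank_matrix, Module.finrank_fintype_fun_eq_card, hcard, Wd.card, Wd.card, Module.finrank_self] at h3
  have h4 : ∀ a b : ℕ, a ^ N + b ^ N ≤ (a + b) ^ N := fun a b => pow_add_pow_le (Nat.zero_le a) (Nat.zero_le b) (by omega)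
  have h5 := h4 (Fintype.card ι ^ 2) (Fintype.card ι' ^ 2)
  rw [← pow_mul, ← pow_mul, mul_comm 2, pow_mul, pow_mul, ← hA] at h5
  simp only [mul_one, ← sq] at h3
  omega

end Pair
end pair
end HS

namespace HS

section dec
variable {K : Type} [Field K] {q : K}

theorem S4_dec {n : ℕ} {x : H K q} (hx : x ∈ HN (n + 1)) :
    ∃ (J : Type) (_ : Fintype J) (a b : J → H K q) (b0 : H K q), (∀ j, a j ∈ HN (K := K) (q := q) n) ∧
      (∀ j, b j ∈ HN (K := K) (q := q) n) ∧ b0 ∈ HN (K := K) (q := q) n ∧ x = ∑ j, sh 1 (a j) * b j + c1 n * b0 := by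
  have := S4 hx
  clear hx
  induction this using Submodule.span_induction with
  | mem x h =>
    rcases h with ⟨a, ha, b, hb, rfl⟩ | ⟨b, hb, rfl⟩
    · exact ⟨Unit, inferInstance, fun _ => a, fun _ => b, 0, fun _ => ha, fun _ => hb, zero_mem _, by simp⟩
    · exact ⟨Empty, inferInstance, fun _ => 0, fun _ => 0, b, fun _ => zero_mem _, fun _ => zero_mem _, hb, by simp⟩
  | zero => exact ⟨Empty, inferInstance, fun _ => 0, fun _ => 0, 0, fun _ => zero_mem _, fun _ => zero_mem _, zero_mem _, by simp⟩
  | add x y _ _ hx hy =>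
    obtain ⟨J, i, a, b, b0, h1, h2, h3, rfl⟩ := hx
    obtain ⟨J', i', a', b', b0', h1', h2', h3', rfl⟩ := hy
    refine ⟨J ⊕ J', inferInstance, Sum.elim a a', Sum.elim b b', b0 + b0', ?_, ?_, add_mem h3 h3', ?_⟩
    · rintro (j | j); exacts [h1 j, h1' j]
    · rintro (j | j); exacts [h2 j, h2' j]
    · rw [Fintype.sum_sum_type, mul_add]; simp only [Sum.elim_inl, Sum.elim_inr]; abel
  | smul c x _ hx =>
    obtain ⟨J, i, a, b, b0, h1, h2, h3, rfl⟩ := hx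
    refine ⟨J, i, a, fun j => c • b j, c • b0, h1, fun j => Subalgebra.smul_mem _ (h2 j) _, Subalgebra.smul_mem _ h3 _, ?_⟩
    simp only [mul_smul_comm, Finset.smul_sum, smul_add]

theorem S3_dec {n : ℕ} {x : H K q} (hx : x ∈ HN (n + 1)) :
    ∃ (J : Type) (_ : Fintype J) (a b : J → H K q) (b0 : H K q), (∀ j, a j ∈ HN (K := K) (q := q) n) ∧
      (∀ j, b j ∈ HN (K := K) (q := q) n) ∧ b0 ∈ HN (K := K) (q := q) n ∧ x = ∑ j, sh 1 (a j) * T 0 * sh 1 (b j) + sh 1 b0 := by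
  have := S3' hx
  clear hx
  induction this using Submodule.span_induction with
  | mem x h =>
    rcases h with ⟨b, hb, rfl⟩ | ⟨a, ha, b, hb, rfl⟩
    · exact ⟨Empty, inferInstance, fun _ => 0, fun _ => 0, b, fun _ => zero_mem _, fun _ => zero_mem _, hb, by simp⟩
    · exact ⟨Unit, inferInstance, fun _ => a, fun _ => b, 0, fun _ => ha, fun _ => hb, zero_mem _, by simp⟩
  | zero => exact ⟨Empty, inferInstance, fun _ => 0, fun _ => 0, 0, fun _ => zero_mem _, fun _ => zero_mem _, zero_mem _, by simp⟩
  | add x y _ _ hx hy =>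
    obtain ⟨J, i, a, b, b0, h1, h2, h3, rfl⟩ := hx
    obtain ⟨J', i', a', b', b0', h1', h2', h3', rfl⟩ := hy
    refine ⟨J ⊕ J', inferInstance, Sum.elim a a', Sum.elim b b', b0 + b0', ?_, ?_, add_mem h3 h3', ?_⟩
    · rintro (j | j); exacts [h1 j, h1' j]
    · rintro (j | j); exacts [h2 j, h2' j]
    · rw [Fintype.sum_sum_type, map_add]; simp only [Sum.elim_inl, Sum.elim_inr]; abel
  | smul c x _ hx =>
    obtain ⟨J, i, a, b, b0, h1, h2, h3, rfl⟩ := hx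
    refine ⟨J, i, a, fun j => c • b j, c • b0, h1, fun j => Subalgebra.smul_mem _ (h2 j) _, Subalgebra.smul_mem _ h3 _, ?_⟩
    simp only [map_smul, mul_smul_comm, Finset.smul_sum, smul_add]

theorem sh_conj (hq : q ≠ 0) {M : ℕ} {E : H K q} (hE : E ∈ HN M) (s : ℕ) :
    ∃ u ∈ HN (K := K) (q := q) (M + s), ∃ u' ∈ HN (K := K) (q := q) (M + s), sh s E = u * E * u' := by
  induction s with
  | zero => exact ⟨1, one_mem _, 1, one_mem _, by rw [sh_zero]; simp⟩
  | succ s ih =>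
    obtain ⟨u, hu, u', hu', h⟩ := ih
    obtain ⟨y, hy, h1, h2⟩ := c1_inv (K := K) hq (M + s)
    refine ⟨c1 (M+s) * u, mul_mem (c1_mem _) (HN_mono (by omega) hu), u' * y, mul_mem (HN_mono (by omega) hu') hy, ?_⟩
    have h3 := c1_conj (sh_mem (m := s) hE)
    rw [sh_sh, add_comm 1 s] at h3
    calc sh (s+1) E = sh (s+1) E * (c1 (M+s) * y) := by rw [h1, mul_one]
      _ = c1 (M+s) * sh s E * y := by rw [← mul_assoc, h3]
      _ = _ := by rw [h]; noncomm_ring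
end dec

namespace Pair
variable {F : Type} [Field F] [CharZero F] [IsAlgClosed F] {q : F}
variable {ι B : Type} [Fintype ι] [DecidableEq ι] [Ring B] [Algebra F B] [Nontrivial B]
variable {ι' B' : Type} [Fintype ι'] [DecidableEq ι'] [Ring B'] [Algebra F B'] [Nontrivial B']
variable {D : Dat F q ι B} {D' : Dat F q ι' B'} {φ : ℝ →+* F} {γ : ι → ℝ} {γ' : ι' → ℝ}

theorem exists_z (h : Pair D D' φ γ γ') : ∃ N : ℕ, Fa D D' (N+1) ∧ ∃ z ∈ HN (K := F) (q := q) (N+2), D.ρ z = 0 ∧ D'.ρ z = 0 ∧ z ≠ 0 := by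
  classical
  have hr := Nat.find_spec h.not_Fa
  have hm : ∀ m < Nat.find h.not_Fa, Fa D D' m := fun m hm => not_not.1 (Nat.find_min h.not_Fa hm)
  set r := Nat.find h.not_Fa
  have hr2 : 2 ≤ r := by
    by_contra hlt
    refine hr (fun x hx h1 _ => ?_)
    obtain ⟨c, rfl⟩ := HN_le_one (by omega) hx
    rw [AlgHom.commutes] at h1
    have : c = 0 := by
      by_contra hc
      have h2 := congrArg (fun z => algebraMap F B c⁻¹ * z) h1
      simp only [mul_zero, ← map_mul, inv_mul_cancel₀ hc, map_one] at h2
      exact one_ne_zero h2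
    rw [this, map_zero]
  obtain ⟨N, hN⟩ : ∃ N, r = N + 2 := ⟨r - 2, by omega⟩
  rw [Fa] at hr
  push Not at hr
  rw [hN] at hr
  exact ⟨N, hm _ (by omega), hr⟩

theorem delta (h : Pair D D' φ γ γ') (C : D.Cl) (C' : D'.Cl) : C.δ = C'.δ := by
  obtain ⟨N, hF, z, hz, h1, h2, hne⟩ := h.exists_z
  obtain ⟨t, p, hT, hp1, hp, hn⟩ := h.exists_tau (N+2)
  by_contra hδ
  refine hne (gram_nondeg h.q0 hT hp1 hp le_rfl hz (fun y hy => ?_))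
  have hyz : y * z ∈ HN (K := F) (q := q) (N+2) := mul_mem hy hz
  obtain ⟨J, i, a, b, b0, ha, hb, hb0, e⟩ := S3_dec hyz
  have key : b0 = 0 := by
    refine h.nil hF hb0 (fun w hw => ?_)
    have e1 : D.ρ (y * z) = 0 := by rw [map_mul D.ρ, h1, mul_zero]
    have e2 : D'.ρ (y * z) = 0 := by rw [map_mul D'.ρ, h2, mul_zero]
    rw [e] at e1 e2
    replace e1 := congrArg C.ctr e1
    replace e2 := congrArg C'.ctr e2
    rw [map_add, map_sum, map_add, map_sum, map_zero, Dat.Cl.ctr_sh] at e1 e2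
    simp only [Dat.Cl.ctr_shT] at e1 e2
    rw [← map_sum, ← map_smul, ← map_add] at e1 e2
    set s := ∑ j, a j * b j with hs
    have hsm : s ∈ HN (K := F) (q := q) (N+1) := Subalgebra.sum_mem _ (fun j _ => mul_mem (ha j) (hb j))
    have f1 : D.tt (fun a => φ (γ a)) (N+1) ((s + C.δ • b0) * w) = 0 := by
      rw [Dat.tt_apply, map_mul D.ρ, e1, zero_mul, map_zero]
    have f2 : D'.tt (fun a => φ (γ' a)) (N+1) ((s + C'.δ • b0) * w) = 0 := by
      rw [Dat.tt_apply, map_mul D'.ρ, e2, zero_mul, map_zero]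
    rw [add_mul, smul_mul_assoc, map_add, map_smul] at f1 f2
    rw [← h.tt_eq (mul_mem hsm hw), ← h.tt_eq (mul_mem hb0 hw)] at f2
    have f3 : (C.δ - C'.δ) * D.tt (fun a => φ (γ a)) (N+1) (b0 * w) = 0 := by
      rw [smul_eq_mul] at f1 f2; linear_combination f1 - f2
    exact (mul_eq_zero.1 f3).resolve_left (sub_ne_zero.2 hδ)
  rw [e, key, map_zero, add_zero, map_sum]
  exact Finset.sum_eq_zero (fun j _ => tau_T0' hT hp N le_rfl (ha j) (hb j))

theorem exists_PP1 (h : Pair D D' φ γ γ') (C : D.Cl) (C' : D'.Cl) : ∃ (N : ℕ) (e : H F q) (J : Type) (_ : Fintype J) (h2 h1 : J → H F q),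
    e ∈ HN (K := F) (q := q) (N+1) ∧ (∀ j, h2 j ∈ HN (K := F) (q := q) (N+1)) ∧ (∀ j, h1 j ∈ HN (K := F) (q := q) (N+1)) ∧
    C.PP 1 e h2 h1 ∧ C'.PP 1 e h2 h1 ∧ D.tt (fun a => φ (γ a)) (N+1) e ≠ 0 := by
  obtain ⟨N, hF, z, hz, h1, h2, hne⟩ := h.exists_z
  obtain ⟨t, p, hT, hp1, hp, hn⟩ := h.exists_tau (N+2)
  by_contra hcon
  obtain ⟨cv, hcv, hc1, hc2⟩ := Dw_inv (K := F) h.q0 (N+1)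
  obtain ⟨χ, hχ, hχ1, hχ2⟩ := c1_inv (K := F) h.q0 N
  refine hne (gram_nondeg h.q0 hT hp1 hp le_rfl hz (fun y hy => ?_))
  have hyz : z * (y * cv) ∈ HN (K := F) (q := q) (N+2) := mul_mem hz (mul_mem hy hcv)
  obtain ⟨J, i, a, b, b0, ha, hb, hb0, e⟩ := S4_dec hyz
  have key : b0 = 0 := by
    refine h.nil hF hb0 (fun w hw => ?_)
    by_contra hne2
    have hneg : ∀ j, -(b j * w) ∈ HN (K := F) (q := q) (N+1) := fun j => neg_mem (mul_mem (hb j) hw)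
    refine hcon ⟨N, b0 * w, J, i, fun j => a j * χ, fun j => -(b j * w), mul_mem hb0 hw, fun j => mul_mem (ha j) hχ, hneg, ?_, ?_, hne2⟩
    · refine C.PP1 _ a (mul_mem hb0 hw) hneg ha hχ hχ2 ?_
      have e1 : D.ρ (z * (y * cv) * w) = 0 := by rw [map_mul D.ρ, map_mul D.ρ, h1, zero_mul, zero_mul]
      rw [e, add_mul, Finset.sum_mul, map_add, map_sum, add_comm, ← eq_neg_iff_add_eq_zero, mul_assoc] at e1
      rw [e1, ← Finset.sum_neg_distrib]
      exact Finset.sum_congr rfl (fun j _ => by rw [mul_neg, map_neg, mul_assoc])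
    · refine C'.PP1 _ a (mul_mem hb0 hw) hneg ha hχ hχ2 ?_
      have e1 : D'.ρ (z * (y * cv) * w) = 0 := by rw [map_mul D'.ρ, map_mul D'.ρ, h2, zero_mul, zero_mul]
      rw [e, add_mul, Finset.sum_mul, map_add, map_sum, add_comm, ← eq_neg_iff_add_eq_zero, mul_assoc] at e1
      rw [e1, ← Finset.sum_neg_distrib]
      exact Finset.sum_congr rfl (fun j _ => by rw [mul_neg, map_neg, mul_assoc])
  rw [key, mul_zero, add_zero] at e
  rw [hT.tr _ le_rfl _ hy _ hz]
  have e3 : z * y = ∑ j, sh 1 (a j) * (b j * Dw (N+1) 0) := by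
    calc z * y = z * (y * cv) * Dw (N+1) 0 := by rw [mul_assoc, mul_assoc, hc2, mul_one]
      _ = _ := by rw [e, Finset.sum_mul]; exact Finset.sum_congr rfl (fun j _ => by rw [mul_assoc])
  rw [e3, map_sum]
  refine Finset.sum_eq_zero (fun j _ => ?_)
  rw [hT.tr _ le_rfl _ (sh1_mem (ha j)) _ (mul_mem (HN_mono (by omega) (hb j)) (Dw_mem _ _)), mul_assoc, Dw_conj (ha j),
    Dw_succ (Nat.zero_le _), ← mul_assoc, ← mul_assoc]
  exact tau_T2 hT hp le_rfl (mul_mem (hb j) (ha j)) (Dw_mem _ _)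

theorem exists_PPk (h : Pair D D' φ γ γ') (C : D.Cl) (C' : D'.Cl) (k : ℕ) : ∃ (M : ℕ) (E : H F q) (J : Type) (_ : Fintype J) (h2 h1 : J → H F q),
    k ≤ M ∧ E ∈ HN (K := F) (q := q) M ∧ (∀ j, h2 j ∈ HN (K := F) (q := q) M) ∧ (∀ j, h1 j ∈ HN (K := F) (q := q) M) ∧
    C.PP k E h2 h1 ∧ C'.PP k E h2 h1 ∧ D.tt (fun a => φ (γ a)) M E ≠ 0 := by
  obtain ⟨N, e, J, i, h2, h1, he, hh2, hh1, hP, hP', hne⟩ := h.exists_PP1 C C'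
  induction k with
  | zero =>
    refine ⟨0, 1, Unit, inferInstance, fun _ => 1, fun _ => 1, le_rfl, one_mem _, fun _ => one_mem _, fun _ => one_mem _, C.PP0, C'.PP0, ?_⟩
    rw [(Dat.isTr h.gc 0).one]; exact one_ne_zero
  | succ k ih =>
    obtain ⟨M, E, J', i', g2, g1, hk, hE, hg2, hg1, gP, gP', gne⟩ := ih
    obtain ⟨u, hu, u', hu', hs⟩ := sh_conj h.q0 hE N
    have s1 := C.PPconj gP u u'
    have s2 := C'.PPconj gP' u u'
    rw [← hs] at s1 s2
    have m1 : ∀ j : J × J', h2 j.1 * sh 1 (u * g2 j.2) ∈ HN (K := F) (q := q) (N + 1 + M) := by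
      intro j
      have a1 : u * g2 j.2 ∈ HN (K := F) (q := q) (M + N) := mul_mem hu (HN_mono (by omega) (hg2 _))
      have a2 : M + N + 1 ≤ N + 1 + M := by omega
      have a3 : N + 1 ≤ N + 1 + M := by omega
      exact mul_mem (HN_mono a3 (hh2 _)) (HN_mono a2 (sh1_mem a1))
    have m2 : ∀ j : J × J', sh 1 (g1 j.2 * u') * h1 j.1 ∈ HN (K := F) (q := q) (N + 1 + M) := by
      intro j
      have a1 : g1 j.2 * u' ∈ HN (K := F) (q := q) (M + N) := mul_mem (HN_mono (by omega) (hg1 _)) hu'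
      have a2 : M + N + 1 ≤ N + 1 + M := by omega
      have a3 : N + 1 ≤ N + 1 + M := by omega
      exact mul_mem (HN_mono a2 (sh1_mem a1)) (HN_mono a3 (hh1 _))
    have r1 := C.PPstep hh2 hP s1
    have r2 := C'.PPstep hh2 hP' s2
    refine ⟨N + 1 + M, sh (N+1) E * e, J × J', inferInstance, fun j => h2 j.1 * sh 1 (u * g2 j.2), fun j => sh 1 (g1 j.2 * u') * h1 j.1,
      by omega, ?_, m1, m2, r1, r2, ?_⟩
    · have a2 : M + (N + 1) ≤ N + 1 + M := by omega
      have a3 : N + 1 ≤ N + 1 + M := by omega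
      have a4 : sh (N+1) E ∈ HN (K := F) (q := q) (M + (N+1)) := sh_mem hE
      have a5 : sh (N+1) E ∈ HN (K := F) (q := q) (N + 1 + M) := HN_mono a2 a4
      have a6 : e ∈ HN (K := F) (q := q) (N + 1 + M) := HN_mono a3 he
      exact mul_mem a5 a6
    · rw [← comm_sh he le_rfl, Dat.tt_mul _ _ _ he]
      exact mul_ne_zero hne gne

theorem dual (h : Pair D D' φ γ γ') (C : D.Cl) (C' : D'.Cl) (k : ℕ) (hk : 1 ≤ k) :
    D.pk (fun a => φ (γ a)⁻¹) k = D'.pk (fun a => φ (γ' a)⁻¹) k := by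
  obtain ⟨M, E, J, i, h2, h1, hkM, hE, hh2, hh1, hP, hP', hne⟩ := h.exists_PPk C C' k
  obtain ⟨k, rfl⟩ : ∃ j, k = j + 1 := ⟨k - 1, by omega⟩
  refine Dat.dual_eq C C' (h.delta C C') (g := fun a => φ (γ a)) (g' := fun a => φ (γ' a)) ?_ ?_ h.gc h.gc' h.pk hkM hE (c1_mem k) hP hP' hh1 hh2 hne
  · intro a; rw [← map_mul, mul_inv_cancel₀ (h.pos a).ne', map_one]
  · intro a; rw [← map_mul, mul_inv_cancel₀ (h.pos' a).ne', map_one]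
end Pair
end HS

namespace HS
section mk
variable {K : Type} [Field K] {V : Type} [AddCommGroup V] [Module K V]
variable {ι : Type} [Fintype ι] [DecidableEq ι] (bs : Module.Basis ι K V) (R : V ⊗[K] V →ₗ[K] V ⊗[K] V)

def Rm (a b c d : ι) : K := (bs.tensorProduct bs).repr (R (bs c ⊗ₜ bs d)) (a, b)

theorem Rm_sum (c d : ι) : R (bs c ⊗ₜ bs d) = ∑ a, ∑ b, Rm bs R a b c d • (bs a ⊗ₜ[K] bs b) := by
  conv_lhs => rw [← (bs.tensorProduct bs).sum_repr (R (bs c ⊗ₜ bs d))]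
  rw [Fintype.sum_prod_type]
  simp only [Module.Basis.tensorProduct_apply]
  rfl

variable {B : Type} [Ring B] [Algebra K B] (l : Lv ι B)

def X1 : V →ₗ[K] B := bs.constr K l.e
def X2 : V ⊗[K] V →ₗ[K] B := TensorProduct.lift ((LinearMap.mul K B).compl₁₂ (X1 bs l) (X1 bs l))
def X3 : (V ⊗[K] V) ⊗[K] V →ₗ[K] B := TensorProduct.lift ((LinearMap.mul K B).compl₁₂ (X2 bs l) (X1 bs l))

theorem X1_b (a : ι) : X1 bs l (bs a) = l.e a := by rw [X1, Module.Basis.constr_basis]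
theorem X2_t (v w : V) : X2 bs l (v ⊗ₜ w) = X1 bs l v * X1 bs l w := rfl
theorem X3_t (u : V ⊗[K] V) (w : V) : X3 bs l (u ⊗ₜ w) = X2 bs l u * X1 bs l w := rfl

theorem X2_R (u : V ⊗[K] V) : l.T0 (Rm bs R) * X2 bs l u = X2 bs l (R u) := by
  have : LinearMap.mulLeft K (l.T0 (Rm bs R)) ∘ₗ X2 bs l = X2 bs l ∘ₗ R := by
    refine (bs.tensorProduct bs).ext (fun i => ?_)
    rw [Module.Basis.tensorProduct_apply, LinearMap.comp_apply, LinearMap.comp_apply, LinearMap.mulLeft_apply, X2_t, X1_b, X1_b,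
      Lv.T0_e, Rm_sum, map_sum]
    refine Finset.sum_congr rfl (fun a _ => ?_)
    rw [map_sum]
    refine Finset.sum_congr rfl (fun b _ => ?_)
    rw [map_smul, X2_t, X1_b, X1_b]
  exact LinearMap.congr_fun this u

theorem X3_R1 (t : (V ⊗[K] V) ⊗[K] V) : l.T0 (Rm bs R) * X3 bs l t = X3 bs l (TensorProduct.map R LinearMap.id t) := by
  induction t with
  | zero => simp
  | add x y hx hy => rw [map_add, mul_add, hx, hy, map_add, map_add]
  | tmul u w => rw [X3_t, ← mul_assoc, X2_R, TensorProduct.map_tmul, X3_t]; rfl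

theorem s_X1 (x : B) (v : V) : l.s x * X1 bs l v = X1 bs l v * x := by
  have : LinearMap.mulLeft K (l.s x) ∘ₗ X1 bs l = LinearMap.mulRight K x ∘ₗ X1 bs l := by
    refine bs.ext (fun i => ?_)
    rw [LinearMap.comp_apply, LinearMap.comp_apply, LinearMap.mulLeft_apply, LinearMap.mulRight_apply, X1_b, Lv.s_e]
  exact LinearMap.congr_fun this v

theorem X3_as (v : V) (u : V ⊗[K] V) : X3 bs l ((TensorProduct.assoc K V V V).symm (v ⊗ₜ u)) = X1 bs l v * X2 bs l u := by
  induction u with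
  | zero => simp
  | add x y hx hy => rw [tmul_add, map_add, map_add, hx, hy, map_add, mul_add]
  | tmul a b => rw [TensorProduct.assoc_symm_tmul, X3_t, X2_t, X2_t, mul_assoc]

theorem X3_R2 (t : (V ⊗[K] V) ⊗[K] V) : l.s (l.T0 (Rm bs R)) * X3 bs l t = X3 bs l (((TensorProduct.assoc K V V V).symm.toLinearMap ∘ₗ
        TensorProduct.map LinearMap.id R ∘ₗ (TensorProduct.assoc K V V V).toLinearMap) t) := by
  obtain ⟨t, rfl⟩ := (TensorProduct.assoc K V V V).symm.surjective t
  simp only [LinearMap.comp_apply, LinearEquiv.coe_coe, LinearEquiv.apply_symm_apply]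
  induction t with
  | zero => simp
  | add x y hx hy => simp only [map_add, mul_add, hx, hy]
  | tmul v u => rw [X3_as, TensorProduct.map_tmul, X3_as, ← mul_assoc, s_X1, mul_assoc, X2_R]; rfl

variable {bs R} {q : K} (hR : IsHeckeSymmetry K V q R)

def mkDat (hR : IsHeckeSymmetry K V q R) : Dat K q ι B :=
  { l with
    R := Rm bs R
    hecke := by
      obtain ⟨_, _, h, _⟩ := hR
      refine l.eq_of_e (fun a => l.eq_of_e (fun b => ?_))
      have h1 : X2 bs l (((R + LinearMap.id) ∘ₗ (R - q • LinearMap.id)) (bs a ⊗ₜ bs b)) = 0 := by rw [h]; simp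
      have h2 : l.e a * l.e b = X2 bs l (bs a ⊗ₜ bs b) := by rw [X2_t, X1_b, X1_b]
      rw [mul_assoc, mul_assoc _ (l.e a), h2]
      simp only [LinearMap.comp_apply, LinearMap.add_apply, LinearMap.sub_apply, LinearMap.smul_apply, LinearMap.id_apply, map_add, map_sub, map_smul, ← X2_R] at h1
      set x := X2 bs l (bs a ⊗ₜ bs b)
      set T := l.T0 (Rm bs R)
      change T * T * x = ((q - 1) • T + algebraMap K B q) * x
      rw [add_mul, smul_mul_assoc, ← Algebra.smul_def, sub_smul, one_smul, mul_assoc]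
      rw [smul_add] at h1
      rw [← sub_eq_zero, ← h1]; abel
    braid := by
      obtain ⟨_, h, _⟩ := hR
      refine l.eq_of_e (fun a => l.eq_of_e (fun b => l.eq_of_e (fun c => ?_)))
      have h2 : l.e a * l.e b * l.e c = X3 bs l ((bs a ⊗ₜ bs b) ⊗ₜ bs c) := by rw [X3_t, X2_t, X1_b, X1_b, X1_b]
      have h1 := congrArg (fun f => X3 bs l (f ((bs a ⊗ₜ bs b) ⊗ₜ bs c))) h
      rw [LinearMap.comp_apply, ← X3_R1, LinearMap.comp_apply, ← X3_R2, ← X3_R1, LinearMap.comp_apply, ← X3_R2, LinearMap.comp_apply, ← X3_R1, ← X3_R2] at h1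
      set x := X3 bs l ((bs a ⊗ₜ bs b) ⊗ₜ bs c)
      set T := l.T0 (Rm bs R)
      change T * l.s T * T * l.e a * l.e b * l.e c = l.s T * T * l.s T * l.e a * l.e b * l.e c
      calc _ = T * (l.s T * (T * x)) := by rw [← h2]; noncomm_ring
        _ = _ := by rw [h1, ← h2]; noncomm_ring }

theorem mkDat_l : (mkDat (bs := bs) l hR).l = l := rfl
theorem mkDat_R : (mkDat (bs := bs) l hR).R = Rm bs R := rfl

theorem Rm_G [FiniteDimensional K V] (hR : IsHeckeSymmetry K V q R) : ∃ G : Module.Dual K V ⊗[K] V →ₗ[K] (V →ₗ[K] V),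
    Function.Injective G ∧ ∀ ξ v w, G (ξ ⊗ₜ[K] v) w = TensorProduct.lid K V (TensorProduct.map ξ LinearMap.id (R (v ⊗ₜ[K] w))) := by
  obtain ⟨_, _, _, Rs, hRs, hp⟩ := hR
  refine ⟨dualTensorHom K V V ∘ₗ (TensorProduct.comm K V (Module.Dual K V)).toLinearMap ∘ₗ Rs, ?_, hp⟩
  have h1 : Function.Injective (dualTensorHom K V V) := (dualTensorHomEquiv K V V).injective
  exact h1.comp ((TensorProduct.comm K V (Module.Dual K V)).injective.comp hRs.1)

theorem Rm_key (ξ : Module.Dual K V) (v : ι) (hξ : ∀ c, ξ (bs c) = if c = v then 1 else 0) (a x : ι) :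
    TensorProduct.lid K V (TensorProduct.map ξ LinearMap.id (R (bs a ⊗ₜ[K] bs x))) = ∑ b, Rm bs R v b a x • bs b := by
  rw [Rm_sum]
  simp only [map_sum, map_smul, TensorProduct.map_tmul, TensorProduct.lid_tmul, LinearMap.id_apply]
  rw [Finset.sum_eq_single v]
  · refine Finset.sum_congr rfl (fun b _ => ?_)
    rw [hξ, if_pos rfl, one_smul]
  · intro c _ hc
    refine Finset.sum_eq_zero (fun b _ => ?_)
    rw [hξ, if_neg hc, zero_smul, smul_zero]
  · simp

theorem tens_li {W : Type} [AddCommGroup W] [Module K W] (b1 : Module.Basis ι K W) (b2 : Module.Basis ι K V) (z : ι → ι → K)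
    (h : ∑ v, ∑ a, z v a • (b1 v ⊗ₜ[K] b2 a) = 0) : ∀ v a, z v a = 0 := by
  intro v a
  have h2 := (b1.tensorProduct b2).linearIndependent
  refine Fintype.linearIndependent_iff.1 h2 (fun i => z i.1 i.2) ?_ (v, a)
  rw [Fintype.sum_prod_type]
  simp only [Module.Basis.tensorProduct_apply]
  exact h

theorem Rm_inj [FiniteDimensional K V] (hR : IsHeckeSymmetry K V q R) (z : ι → ι → K)
    (h : ∀ b x, ∑ v, ∑ a, Rm bs R v b a x * z v a = 0) : ∀ v a, z v a = 0 := by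
  obtain ⟨G, hinj, hp⟩ := Rm_G hR
  have key' : ∀ x v a, G (bs.dualBasis v ⊗ₜ[K] bs a) (bs x) = ∑ b, Rm bs R v b a x • bs b := fun x v a => by
    rw [hp]
    exact Rm_key (bs := bs) (R := R) (bs.dualBasis v) v (fun c => Module.Basis.dualBasis_apply_self bs v c) a x
  have hz : G (∑ v, ∑ a, z v a • (bs.dualBasis v ⊗ₜ[K] bs a)) = 0 := by
    refine bs.ext (fun x => ?_)
    rw [LinearMap.zero_apply]
    have e1 : G (∑ v, ∑ a, z v a • (bs.dualBasis v ⊗ₜ[K] bs a)) (bs x) = ∑ v, ∑ a, ∑ b, (Rm bs R v b a x * z v a) • bs b := by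
      rw [map_sum, LinearMap.sum_apply]
      refine Finset.sum_congr rfl (fun v _ => ?_)
      rw [map_sum, LinearMap.sum_apply]
      refine Finset.sum_congr rfl (fun a _ => ?_)
      rw [map_smul, LinearMap.smul_apply, key', Finset.smul_sum]
      refine Finset.sum_congr rfl (fun b _ => ?_)
      rw [smul_smul, mul_comm]
    rw [e1, Finset.sum_congr rfl (fun v _ => Finset.sum_comm), Finset.sum_comm]
    refine Finset.sum_eq_zero (fun b _ => ?_)
    simp only [← Finset.sum_smul]
    rw [h b x, zero_smul]
  have h1 := hinj (hz.trans (map_zero G).symm)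
  exact tens_li bs.dualBasis bs z h1

theorem mkDat_Cl [FiniteDimensional K V] : Nonempty (mkDat (bs := bs) l hR).Cl :=
  Cl_of_inj _ (fun z h => Rm_inj (bs := bs) hR z h)

end mk
end HS

namespace HS
section lam
variable {K : Type} [Field K] {V : Type} [AddCommGroup V] [Module K V]
variable {ι : Type} [Fintype ι] [DecidableEq ι] (bs : Module.Basis ι K V) (R : V ⊗[K] V →ₗ[K] V ⊗[K] V)

theorem sgn_sh1 {q : K} (x : H K q) : sgn (sh 1 x) = sgn x := by
  have : (sgn (K := K) (q := q)).comp (sh 1) = sgn := hom_ext (fun i => by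
    rw [AlgHom.comp_apply, sh_T, sgn_T, sgn_T])
  exact DFunLike.congr_fun this x

def xg (a : ι) : RingQuot (lambdaRel K V R) := RingQuot.mkAlgHom K (lambdaRel K V R) (TensorAlgebra.ι K (bs a))

def lw : ∀ n, Wd ι n → RingQuot (lambdaRel K V R)
  | 0, _ => 1
  | n + 1, w => xg bs R w.1 * lw n w.2

theorem lw_s (n : ℕ) (a : ι) (w : Wd ι n) : lw bs R (n+1) (a, w) = xg bs R a * lw bs R n w := rfl
theorem lw_0 (w : Wd ι 0) : lw bs R 0 w = 1 := rfl

theorem span_xg : Submodule.map (RingQuot.mkAlgHom K (lambdaRel K V R)).toLinearMap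
    (LinearMap.range (TensorAlgebra.ι K : V →ₗ[K] TensorAlgebra K V)) = Submodule.span K (Set.range (xg bs R)) := by
  rw [LinearMap.range_eq_map, ← bs.span_eq, Submodule.map_span, Submodule.map_span, ← Set.range_comp, ← Set.range_comp]
  rfl

theorem span_lw (k : ℕ) : lambdaGrade K V R k = Submodule.span K (Set.range (lw bs R k)) := by
  rw [lambdaGrade]
  have h0 : Submodule.map (RingQuot.mkAlgHom K (lambdaRel K V R)).toLinearMap
    (LinearMap.range (TensorAlgebra.ι K : V →ₗ[K] TensorAlgebra K V) ^ k) = (Submodule.span K (Set.range (xg bs R))) ^ k := by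
    rw [← span_xg]; exact Submodule.map_pow _ _ _
  rw [h0]
  induction k with
  | zero =>
    rw [pow_zero, Submodule.one_eq_span]
    congr 1
    ext z
    constructor
    · rintro rfl; exact ⟨Wd.nil, rfl⟩
    · rintro ⟨w, rfl⟩; rfl
  | succ k ih =>
    have h1 : Submodule.map (RingQuot.mkAlgHom K (lambdaRel K V R)).toLinearMap
      (LinearMap.range (TensorAlgebra.ι K : V →ₗ[K] TensorAlgebra K V) ^ k) = (Submodule.span K (Set.range (xg bs R))) ^ k := by
      rw [← span_xg]; exact Submodule.map_pow _ _ _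
    rw [pow_succ', ih h1, Submodule.span_mul_span]
    congr 1
    ext z
    constructor
    · rintro ⟨_, ⟨a, rfl⟩, _, ⟨w, rfl⟩, rfl⟩; exact ⟨(a, w), rfl⟩
    · rintro ⟨⟨a, w⟩, rfl⟩; exact ⟨_, ⟨a, rfl⟩, _, ⟨w, rfl⟩, rfl⟩

theorem xg_rel (c d : ι) : ∑ a, ∑ b, Rm bs R a b c d • (xg bs R a * xg bs R b) + xg bs R c * xg bs R d = 0 := by
  have h := RingQuot.mkAlgHom_rel K (s := lambdaRel K V R) (x := mulTwo K V ((R + (LinearMap.id : V ⊗[K] V →ₗ[K] V ⊗[K] V)) (bs c ⊗ₜ bs d))) (y := 0) ⟨rfl, _, rfl⟩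
  rw [map_zero, LinearMap.add_apply, Rm_sum bs R, LinearMap.id_apply, map_add, map_add] at h
  have hm : ∀ a b, RingQuot.mkAlgHom K (lambdaRel K V R) (mulTwo K V (bs a ⊗ₜ bs b)) = xg bs R a * xg bs R b := by
    intro a b
    rw [xg, xg, ← map_mul]; rfl
  rw [hm] at h
  rw [← h]
  congr 1
  rw [map_sum, map_sum]
  refine Finset.sum_congr rfl (fun a _ => ?_)
  rw [map_sum, map_sum]
  refine Finset.sum_congr rfl (fun b _ => ?_)
  rw [map_smul, map_smul, hm]

variable {B : Type} [Ring B] [Algebra K B] (l : Lv ι B)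

def ee (k : ℕ) : Module.Dual K (RingQuot (lambdaRel K V R)) →ₗ[K] B where
  toFun f := ∑ w, f (lw bs R k w) • (l.pw k).d w
  map_add' f g := by simp [add_smul, Finset.sum_add_distrib]
  map_smul' c f := by simp [Finset.smul_sum, smul_smul]

theorem ee_apply (k : ℕ) (f : Module.Dual K (RingQuot (lambdaRel K V R))) :
    ee bs R l k f = ∑ w, f (lw bs R k w) • (l.pw k).d w := rfl

def lm (z : RingQuot (lambdaRel K V R)) (f : Module.Dual K (RingQuot (lambdaRel K V R))) :
    Module.Dual K (RingQuot (lambdaRel K V R)) := f ∘ₗ LinearMap.mulLeft K z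

theorem ee_s (k : ℕ) (f : Module.Dual K (RingQuot (lambdaRel K V R))) :
    ee bs R l (k+1) f = ∑ a, ee bs R l k (lm R (xg bs R a) f) * l.d a := by
  rw [ee_apply, Wd.sum_succ]
  refine Finset.sum_congr rfl (fun a _ => ?_)
  rw [ee_apply, Finset.sum_mul]
  refine Finset.sum_congr rfl (fun w _ => ?_)
  rw [smul_mul_assoc, Lv.pw_d, lw_s]; rfl

theorem ee_T0 (k : ℕ) (f : Module.Dual K (RingQuot (lambdaRel K V R))) :
    ee bs R l (k+2) f * l.T0 (Rm bs R) = - ee bs R l (k+2) f := by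
  have h1 : ∀ f, ee bs R l (k+2) f = ∑ a, ∑ b, ee bs R l k (lm R (xg bs R a * xg bs R b) f) * (l.d b * l.d a) := by
    intro f
    rw [ee_s]
    refine Finset.sum_congr rfl (fun a _ => ?_)
    rw [ee_s, Finset.sum_mul]
    refine Finset.sum_congr rfl (fun b _ => ?_)
    rw [mul_assoc]; congr 2
    ext z; simp [lm, mul_assoc]
  have h2 : ∀ a b, l.d b * l.d a * l.T0 (Rm bs R) = ∑ c, ∑ d, Rm bs R a b c d • (l.d d * l.d c) := by
    intro a b
    rw [mul_assoc, Lv.d_T0, Finset.mul_sum, Finset.sum_eq_single b]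
    · rw [Finset.mul_sum]
      refine Finset.sum_congr rfl (fun c _ => ?_)
      rw [Finset.mul_sum]
      refine Finset.sum_congr rfl (fun d _ => ?_)
      rw [mul_smul_comm, ← mul_assoc, l.de, if_pos rfl, one_mul]
    · intro b' _ hb
      simp only [Finset.mul_sum, mul_smul_comm, ← mul_assoc, l.de, if_neg hb.symm, zero_mul, smul_zero, Finset.sum_const_zero]
    · simp
  have h3 : ∀ c d, ∑ a, ∑ b, Rm bs R a b c d • lm R (xg bs R a * xg bs R b) f = - lm R (xg bs R c * xg bs R d) f := by
    intro c d
    ext z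
    have := congrArg (fun u => f (u * z)) (xg_rel bs R c d)
    simp only [Finset.sum_mul, map_sum, smul_mul_assoc, map_smul, add_mul, map_add, zero_mul, map_zero] at this
    rw [LinearMap.neg_apply, ← add_eq_zero_iff_eq_neg, ← this]
    simp only [LinearMap.sum_apply, LinearMap.smul_apply]; rfl
  calc ee bs R l (k+2) f * l.T0 (Rm bs R)
      = ∑ a, ∑ b, ∑ c, ∑ d, (Rm bs R a b c d • ee bs R l k (lm R (xg bs R a * xg bs R b) f)) * (l.d d * l.d c) := by
        rw [h1, Finset.sum_mul]
        refine Finset.sum_congr rfl (fun a _ => ?_)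
        rw [Finset.sum_mul]
        refine Finset.sum_congr rfl (fun b _ => ?_)
        rw [mul_assoc, h2, Finset.mul_sum]
        refine Finset.sum_congr rfl (fun c _ => ?_)
        rw [Finset.mul_sum]
        refine Finset.sum_congr rfl (fun d _ => ?_)
        rw [mul_smul_comm, smul_mul_assoc]
    _ = ∑ c, ∑ d, ∑ a, ∑ b, (Rm bs R a b c d • ee bs R l k (lm R (xg bs R a * xg bs R b) f)) * (l.d d * l.d c) := by
        rw [Finset.sum_congr rfl (fun a _ => Finset.sum_comm), Finset.sum_comm]
        refine Finset.sum_congr rfl (fun c _ => ?_)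
        rw [Finset.sum_congr rfl (fun a _ => Finset.sum_comm), Finset.sum_comm]
    _ = ∑ c, ∑ d, (- ee bs R l k (lm R (xg bs R c * xg bs R d) f)) * (l.d d * l.d c) := by
        refine Finset.sum_congr rfl (fun c _ => Finset.sum_congr rfl (fun d _ => ?_))
        rw [← map_neg, ← h3 c d, map_sum, Finset.sum_mul]
        refine Finset.sum_congr rfl (fun a _ => ?_)
        rw [map_sum, Finset.sum_mul]
        refine Finset.sum_congr rfl (fun b _ => ?_)
        rw [map_smul]
    _ = _ := by
        rw [h1]
        simp only [neg_mul, Finset.sum_neg_distrib]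

variable {bs R l} {q : K} {hR : IsHeckeSymmetry K V q R}

theorem ee_T (i k : ℕ) (h : i + 1 < k) (f : Module.Dual K (RingQuot (lambdaRel K V R))) :
    ee bs R l k f * (mkDat (bs := bs) l hR).ρ (T i) = - ee bs R l k f := by
  induction i generalizing k f with
  | zero =>
    obtain ⟨k, rfl⟩ := Nat.exists_eq_add_of_le h
    rw [Dat.ρ_T0, show 0 + 1 + 1 + k = k + 2 by omega]
    exact ee_T0 bs R l k f
  | succ i ih =>
    obtain ⟨k, rfl⟩ : ∃ k', k = k' + 1 := ⟨k - 1, by omega⟩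
    have h1 : (mkDat (bs := bs) l hR).ρ (T (i+1)) = l.s ((mkDat (bs := bs) l hR).ρ (T i)) := by
      rw [← sh_T 1 i, Dat.ρ_sh]; rfl
    rw [h1, ee_s, Finset.sum_mul, ← Finset.sum_neg_distrib]
    refine Finset.sum_congr rfl (fun a _ => ?_)
    rw [mul_assoc, l.d_s, ← mul_assoc, ih k (by omega), neg_mul]

theorem ee_ρ (k : ℕ) {x : H K q} (hx : x ∈ HN k) (f : Module.Dual K (RingQuot (lambdaRel K V R))) :
    ee bs R l k f * (mkDat (bs := bs) l hR).ρ x = sgn x • ee bs R l k f := by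
  induction hx using Algebra.adjoin_induction with
  | mem x hx => obtain ⟨i, hi, rfl⟩ := hx; rw [ee_T i k hi, sgn_T, neg_one_smul]
  | algebraMap r => rw [AlgHom.commutes, AlgHom.commutes, Algebra.algebraMap_eq_smul_one, mul_smul_comm, mul_one]; rfl
  | add x y _ _ h1 h2 => rw [map_add, map_add, mul_add, h1, h2, add_smul]
  | mul x y _ _ h1 h2 => rw [map_mul, map_mul, ← mul_assoc, h1, smul_mul_assoc, h2, smul_smul]

variable [Nontrivial B]

theorem lw_AS (hq : ∀ n, qn q (n+1) ≠ 0) (k : ℕ) (w : Wd ι k) :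
    ∑ m, (l.pw k).mt K ((mkDat (bs := bs) l hR).ρ (AS k)) m w • lw bs R k m = lw bs R k w := by
  rw [← sub_eq_zero, ← Module.forall_dual_apply_eq_zero_iff K]
  intro f
  have h1 : ee bs R l k f * (mkDat (bs := bs) l hR).ρ (AS k) = ee bs R l k f := by
    rw [ee_ρ k (AS_mem k), sgn_AS hq, one_smul]
  have h2 : ee bs R l k f * (l.pw k).e w = algebraMap K B (f (lw bs R k w)) := by
    rw [ee_apply, Finset.sum_mul, Finset.sum_eq_single w]
    · rw [smul_mul_assoc, (l.pw k).de, if_pos rfl, Algebra.algebraMap_eq_smul_one]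
    · intro m _ hm; rw [smul_mul_assoc, (l.pw k).de, if_neg hm, smul_zero]
    · simp
  have hs : (l.pw k).Sc K ((mkDat (bs := bs) l hR).ρ (AS k)) := (mkDat (bs := bs) l hR).S_ρ (AS_mem k)
  rw [← h1, ee_apply, Finset.sum_mul, Finset.sum_mul] at h2
  have h3 : ∑ m, algebraMap K B (f (lw bs R k m) * (l.pw k).mt K ((mkDat (bs := bs) l hR).ρ (AS k)) m w) = algebraMap K B (f (lw bs R k w)) := by
    rw [← h2]
    refine Finset.sum_congr rfl (fun m _ => ?_)
    rw [smul_mul_assoc, smul_mul_assoc, hs.eq, Algebra.smul_def, map_mul]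
  rw [← map_sum] at h3
  have h4 := FaithfulSMul.algebraMap_injective K B h3
  rw [map_sub, map_sum, ← h4, sub_eq_zero]
  refine Finset.sum_congr rfl (fun m _ => ?_)
  rw [map_smul, smul_eq_mul, mul_comm]

end lam
end HS

namespace HS
section lam
variable {K : Type} [Field K] {V : Type} [AddCommGroup V] [Module K V]
variable {ι : Type} [Fintype ι] [DecidableEq ι] {bs : Module.Basis ι K V} {R : V ⊗[K] V →ₗ[K] V ⊗[K] V}
variable {B : Type} [Ring B] [Algebra K B] {l : Lv ι B} {q : K} 

def opf (bs : Module.Basis ι K V) (l : Lv ι B) (A : ℕ → B) (v : V) (f : ℕ → B) : ℕ → B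
  | 0 => 0
  | n + 1 => A (n+1) * (X1 bs l v * f n)

def op (bs : Module.Basis ι K V) (l : Lv ι B) (A : ℕ → B) : V →ₗ[K] Module.End K (ℕ → B) :=
  LinearMap.mk₂ K (opf bs l A)
    (fun v w f => by funext n; cases n <;> simp [opf, add_mul, mul_add])
    (fun c v f => by funext n; cases n <;> simp [opf])
    (fun v f g => by funext n; cases n <;> simp [opf, mul_add])
    (fun c v f => by funext n; cases n <;> simp [opf])

theorem op_0 (A : ℕ → B) (v : V) (f : ℕ → B) : op bs l A v f 0 = 0 := rfl
theorem op_s (A : ℕ → B) (v : V) (f : ℕ → B) (n : ℕ) : op bs l A v f (n+1) = A (n+1) * (X1 bs l v * f n) := rfl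

theorem op_two (A : ℕ → B) (h1 : ∀ n v, A (n+2) * (X1 bs l v * A (n+1)) = A (n+2) * X1 bs l v) (u : V ⊗[K] V) (f : ℕ → B) (n : ℕ) :
    TensorAlgebra.lift K (op bs l A) (mulTwo K V u) f (n+2) = A (n+2) * (X2 bs l u * f n) := by
  induction u with
  | zero => simp
  | add x y hx hy => rw [map_add, map_add, LinearMap.add_apply, Pi.add_apply, hx, hy, map_add, add_mul, mul_add]
  | tmul v w =>
    have : mulTwo K V (v ⊗ₜ w) = TensorAlgebra.ι K v * TensorAlgebra.ι K w := rfl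
    rw [this, map_mul, TensorAlgebra.lift_ι_apply, TensorAlgebra.lift_ι_apply, Module.End.mul_apply, op_s, op_s, X2_t]
    calc _ = A (n+2) * (X1 bs l v * A (n+1)) * (X1 bs l w * f n) := by simp only [mul_assoc]
      _ = _ := by rw [h1]; simp only [mul_assoc]

theorem op_low (A : ℕ → B) (u : V ⊗[K] V) (f : ℕ → B) (n : ℕ) (hn : n < 2) :
    TensorAlgebra.lift K (op bs l A) (mulTwo K V u) f n = 0 := by
  induction u with
  | zero => simp
  | add x y hx hy => rw [map_add, map_add, LinearMap.add_apply, Pi.add_apply, hx, hy, add_zero]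
  | tmul v w =>
    have : mulTwo K V (v ⊗ₜ w) = TensorAlgebra.ι K v * TensorAlgebra.ι K w := rfl
    rw [this, map_mul, TensorAlgebra.lift_ι_apply, TensorAlgebra.lift_ι_apply, Module.End.mul_apply]
    obtain rfl | rfl : n = 0 ∨ n = 1 := by omega
    · rfl
    · rw [op_s, op_0]; simp

theorem exists_Om (A : ℕ → B) (h1 : ∀ n v, A (n+2) * (X1 bs l v * A (n+1)) = A (n+2) * X1 bs l v)
    (h2 : ∀ n, A (n+2) * l.T0 (Rm bs R) = - A (n+2)) (h0 : A 0 = 1) (h3 : ∀ n a, A (n+1) * (l.e a * A n) = A (n+1) * l.e a) :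
    ∃ Om : RingQuot (lambdaRel K V R) →ₗ[K] (ℕ → B), ∀ k w, Om (lw bs R k w) k = A k * (l.pw k).e w := by
  have hrel : ∀ ⦃x y⦄, lambdaRel K V R x y → TensorAlgebra.lift K (op bs l A) x = TensorAlgebra.lift K (op bs l A) y := by
    rintro x y ⟨rfl, u, rfl⟩
    refine LinearMap.ext (fun f => funext (fun n => ?_))
    rw [map_zero, LinearMap.zero_apply, Pi.zero_apply]
    rcases n with _ | _ | n
    · exact op_low A _ f 0 (by omega)
    · exact op_low A _ f 1 (by omega)
    · change TensorAlgebra.lift K (op bs l A) (mulTwo K V _) f (n+2) = 0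
      rw [op_two A h1, LinearMap.add_apply, LinearMap.id_apply, map_add, ← X2_R, add_mul, mul_add, mul_assoc, ← mul_assoc, h2,
        neg_mul, neg_add_cancel]
  let Ψ := RingQuot.liftAlgHom K (s := lambdaRel K V R) ⟨TensorAlgebra.lift K (op bs l A), hrel⟩
  have hΨ : ∀ a, Ψ (xg bs R a) = op bs l A (bs a) := by
    intro a
    rw [xg, RingQuot.liftAlgHom_mkAlgHom_apply, TensorAlgebra.lift_ι_apply]
  let vac : ℕ → B := fun n => if n = 0 then 1 else 0
  refine ⟨(LinearMap.applyₗ vac) ∘ₗ Ψ.toLinearMap, fun k w => ?_⟩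
  change Ψ (lw bs R k w) vac k = _
  induction k with
  | zero => rw [lw_0, map_one, h0, one_mul]; rfl
  | succ k ih =>
    obtain ⟨a, w⟩ := w
    rw [lw_s, map_mul, hΨ, Module.End.mul_apply, op_s, ih, X1_b, Lv.pw_e]
    calc _ = A (k+1) * (l.e a * A k) * (l.pw k).e w := by simp only [mul_assoc]
      _ = _ := by rw [h3]; simp only [mul_assoc]

variable {hR : IsHeckeSymmetry K V q R} 

theorem AS_X (hq : ∀ n, qn q (n+1) ≠ 0) (n : ℕ) (v : V) :
    (mkDat (bs := bs) l hR).ρ (AS (n+1)) * (X1 bs l v * (mkDat (bs := bs) l hR).ρ (AS n)) = (mkDat (bs := bs) l hR).ρ (AS (n+1)) * X1 bs l v := by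
  have h1 : l.s ((mkDat (bs := bs) l hR).ρ (AS n)) = (mkDat (bs := bs) l hR).ρ (sh 1 (AS n)) := ((mkDat (bs := bs) l hR).ρ_sh (AS n)).symm
  rw [← s_X1, ← mul_assoc, h1, ← map_mul, AS_right (n+1) (sh_mem (AS_mem n)), sgn_sh1, sgn_AS hq, one_smul]

theorem exists_Om' (hq : ∀ n, qn q (n+1) ≠ 0) :
    ∃ Om : RingQuot (lambdaRel K V R) →ₗ[K] (ℕ → B), ∀ k w, Om (lw bs R k w) k = (mkDat (bs := bs) l hR).ρ (AS k) * (l.pw k).e w := by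
  refine exists_Om (fun k => (mkDat (bs := bs) l hR).ρ (AS k)) (fun n v => AS_X hq (n+1) v) (fun n => ?_) ?_ (fun n a => ?_)
  · have : l.T0 (Rm bs R) = (mkDat (bs := bs) l hR).ρ (T 0) := ((mkDat (bs := bs) l hR).ρ_T0).symm
    rw [this, ← map_mul, AS_right (n+2) (T_mem (by omega)), sgn_T, neg_one_smul, map_neg]
  · exact map_one _
  · have := AS_X (hR := hR) (l := l) (bs := bs) hq n (bs a)
    rwa [X1_b] at this

variable [Nontrivial B]

theorem finrank_eq [CharZero K] (hq : ∀ n, qn q (n+1) ≠ 0) (k : ℕ) :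
    (Module.finrank K (lambdaGrade K V R k) : K) = (mkDat (bs := bs) l hR).tt (fun _ => 1) k (AS k) := by
  set A := (l.pw k).mt K ((mkDat (bs := bs) l hR).ρ (AS k)) with hA
  have hs : (l.pw k).Sc K ((mkDat (bs := bs) l hR).ρ (AS k)) := (mkDat (bs := bs) l hR).S_ρ (AS_mem k)
  have hA2 : A * A = A := by
    rw [hA, ← Lv.mt_mul hs, ← map_mul, AS_right k (AS_mem k), sgn_AS hq, one_smul]
  have ht : (mkDat (bs := bs) l hR).tt (fun _ => 1) k (AS k) = A.trace := by
    have hg : ∀ n, Lv.gw (fun _ : ι => (1 : K)) n = fun _ => 1 := by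
      intro n
      induction n with
      | zero => rfl
      | succ n ih => funext w; obtain ⟨a, w⟩ := w; rw [Lv.gw_s, ih, mul_one]
    rw [Dat.tt_mt, hg, Matrix.diagonal_one, one_mul]; rfl
  have he : IsIdempotentElem (Matrix.toLin' A) := by
    change Matrix.toLin' A ∘ₗ Matrix.toLin' A = _
    rw [← Matrix.toLin'_mul, hA2]
  have h2 := (LinearMap.IsIdempotentElem.isProj_range _ he).trace
  rw [ht, ← Matrix.trace_toLin'_eq A, h2]
  congr 1
  let π : (Wd ι k → K) →ₗ[K] RingQuot (lambdaRel K V R) := Fintype.linearCombination K (lw bs R k)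
  have hπ : ∀ f, π f = ∑ w, f w • lw bs R k w := fun f => rfl
  have hr : lambdaGrade K V R k = LinearMap.range π := by
    rw [span_lw bs R, Fintype.range_linearCombination]
  have hker : LinearMap.ker π = LinearMap.ker (Matrix.toLin' A) := by
    ext f
    rw [LinearMap.mem_ker, LinearMap.mem_ker, hπ, Matrix.toLin'_apply]
    constructor
    · intro h
      obtain ⟨Om, hOm⟩ := exists_Om' (bs := bs) (l := l) (hR := hR) hq
      have h3 := congrFun (congrArg Om h) k
      rw [map_sum, map_zero, Finset.sum_apply] at h3
      funext m
      have h4 : algebraMap K B (A.mulVec f m) = 0 := by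
        have h5 := congrArg (fun z => (l.pw k).d m * z) h3
        simp only [Pi.zero_apply, mul_zero, Finset.mul_sum] at h5
        rw [← h5, Matrix.mulVec, dotProduct, map_sum]
        refine Finset.sum_congr rfl (fun w _ => ?_)
        rw [map_smul, Pi.smul_apply, hOm, mul_smul_comm, ← mul_assoc, hs.eq, Algebra.smul_def, map_mul, Algebra.commutes]
      exact (map_eq_zero_iff _ (FaithfulSMul.algebraMap_injective K B)).1 h4
    · intro h
      have h3 : ∑ w, f w • lw bs R k w = ∑ w, f w • ∑ m, A m w • lw bs R k m :=
        Finset.sum_congr rfl (fun w _ => by rw [hA, lw_AS hq])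
      rw [h3]
      simp only [Finset.smul_sum, smul_smul]
      rw [Finset.sum_comm]
      refine Finset.sum_eq_zero (fun m _ => ?_)
      rw [← Finset.sum_smul]
      have h4 := congrFun h m
      rw [Matrix.mulVec, dotProduct, Pi.zero_apply] at h4
      rw [Finset.sum_congr rfl (fun w _ => mul_comm _ _), h4, zero_smul]
  rw [hr]
  have e1 := LinearMap.finrank_range_add_finrank_ker π
  have e2 := LinearMap.finrank_range_add_finrank_ker (Matrix.toLin' A)
  rw [hker] at e1
  omega

end lam
end HS

namespace HS
namespace Dat
section bc
variable {K L : Type} [Field K] [Field L] [Algebra K L] {q : K} {ι B : Type} [Fintype ι] [DecidableEq ι] [Ring B]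
  [Algebra K B] [Algebra L B] [IsScalarTower K L B]
variable (D : Dat K q ι B)

theorem bc_T0 (l : Lv ι B) (R : ι → ι → ι → ι → K) : l.T0 (fun a b c d => algebraMap K L (R a b c d)) = l.T0 R := by
  rw [Lv.T0, Lv.T0]
  simp only [algebraMap_smul]

variable (L) in
def bc : Dat L (algebraMap K L q) ι B :=
  { D.l with
    R := fun a b c d => algebraMap K L (D.R a b c d)
    hecke := by
      have h := D.hecke
      change D.l.T0 (fun a b c d => algebraMap K L (D.R a b c d)) * D.l.T0 (fun a b c d => algebraMap K L (D.R a b c d)) = (algebraMap K L q - 1) • D.l.T0 (fun a b c d => algebraMap K L (D.R a b c d)) + algebraMap L B (algebraMap K L q)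
      rw [bc_T0, ← IsScalarTower.algebraMap_apply, ← map_one (algebraMap K L), ← map_sub, algebraMap_smul]
      exact h
    braid := by
      have h := D.braid
      change D.l.T0 (fun a b c d => algebraMap K L (D.R a b c d)) * D.l.s (D.l.T0 (fun a b c d => algebraMap K L (D.R a b c d))) * D.l.T0 (fun a b c d => algebraMap K L (D.R a b c d)) = D.l.s (D.l.T0 (fun a b c d => algebraMap K L (D.R a b c d))) * D.l.T0 (fun a b c d => algebraMap K L (D.R a b c d)) * D.l.s (D.l.T0 (fun a b c d => algebraMap K L (D.R a b c d)))
      rw [bc_T0]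
      exact h }

theorem bc_l : (D.bc L).l = D.l := rfl
theorem bc_R (a b c d : ι) : (D.bc L).R a b c d = algebraMap K L (D.R a b c d) := rfl

def bcCl (C : D.Cl) : (D.bc L).Cl where
  Dm a v := algebraMap K L (C.Dm a v)
  hD b x := by
    have h := congrArg (algebraMap K L) (C.hD b x)
    simp only [map_sum, map_mul] at h
    simp only [bc_R]
    rw [h]; split_ifs <;> simp
  Ψ a b c d := algebraMap K L (C.Ψ a b c d)
  hΨ v' a' v a := by
    have h := congrArg (algebraMap K L) (C.hΨ v' a' v a)
    simp only [map_sum, map_mul] at h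
    simp only [bc_R]
    rw [h]; split_ifs <;> simp

theorem bc_c1 (n : ℕ) : (D.bc L).ρ (c1 n) = D.ρ (c1 n) := by
  induction n with
  | zero => rw [c1, c1, map_one, map_one]
  | succ n ih =>
    rw [c1_s, c1_s, map_mul, map_mul, ih, ρ_T, ρ_T, bc_l]
    congr 2
    exact bc_T0 D.l D.R

variable [Nontrivial B]

theorem bc_pk (k : ℕ) (hk : 1 ≤ k) : (D.bc L).pk (fun _ => 1) k = algebraMap K L (D.pk (fun _ => 1) k) := by
  have hg : ∀ (F : Type) [Field F] (n : ℕ), Lv.gw (fun _ : ι => (1 : F)) n = fun _ => 1 := by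
    intro F _ n
    induction n with
    | zero => rfl
    | succ n ih => funext w; obtain ⟨a, w⟩ := w; rw [Lv.gw_s, ih, mul_one]
  have hm : (c1 (k-1) : H K q) ∈ HN k := by
    have := c1_mem (K := K) (q := q) (k-1)
    rwa [Nat.sub_add_cancel hk] at this
  have hS : D.l.S K 0 0 (D.l.ptN (fun _ => (1:K)) k (D.ρ (c1 (k-1)))) :=
    Lv.S.ptN k _ (by rw [zero_add]; exact D.S_ρ hm)
  obtain ⟨c, hc⟩ := hS.scalar
  have hL : (D.bc L).l.ptN (fun _ => (1:L)) k ((D.bc L).ρ (c1 (k-1))) = algebraMap L B (algebraMap K L c) := by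
    rw [← IsScalarTower.algebraMap_apply, ← hc, bc_c1, bc_l, Lv.ptN_eq, Lv.ptN_eq, hg, hg]
    simp only [one_smul]
  rw [pk, pk, tt_apply, tt_apply, tb_apply, tb_apply, hL, hc, Algebra.algebraMap_eq_smul_one, map_smul, eps_one,
    Algebra.algebraMap_eq_smul_one (A := B), map_smul, eps_one]
  simp

end bc
end Dat


theorem exists_L (K : Type) [Field K] [CharZero K] : ∃ (L : Type) (_ : Field L) (_ : CharZero L) (_ : IsAlgClosed L) (_ : Algebra K L), Nonempty (ℝ →+* L) := by
  letI : Algebra ℚ K := DivisionRing.toRatAlgebra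
  obtain ⟨I, hI⟩ := Ideal.exists_maximal (K ⊗[ℚ] ℝ)
  letI : Field ((K ⊗[ℚ] ℝ) ⧸ I) := Ideal.Quotient.field I
  let f : K →+* AlgebraicClosure ((K ⊗[ℚ] ℝ) ⧸ I) := (algebraMap _ (AlgebraicClosure ((K ⊗[ℚ] ℝ) ⧸ I))).comp ((Ideal.Quotient.mk I).comp (algebraMap K (K ⊗[ℚ] ℝ)))
  let g : ℝ →+* AlgebraicClosure ((K ⊗[ℚ] ℝ) ⧸ I) := (algebraMap _ (AlgebraicClosure ((K ⊗[ℚ] ℝ) ⧸ I))).comp ((Ideal.Quotient.mk I).comp (Algebra.TensorProduct.includeRight : ℝ →ₐ[ℚ] K ⊗[ℚ] ℝ).toRingHom)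
  exact ⟨AlgebraicClosure ((K ⊗[ℚ] ℝ) ⧸ I), inferInstance, charZero_of_injective_ringHom f.injective, inferInstance, f.toAlgebra, ⟨g⟩⟩

end HS

namespace HS
section ps
variable {F : Type} [Field F]

def LP {n : ℕ} (s : Fin n → F) : PowerSeries F := ∏ i, (1 + PowerSeries.C (s i) * PowerSeries.X)

theorem LP_rescale {n : ℕ} (c : F) (s : Fin n → F) : PowerSeries.rescale c (LP s) = LP (fun i => c * s i) := by
  rw [LP, map_prod]
  exact Finset.prod_congr rfl (fun i _ => rescale_lin c (s i))

theorem LP_cc {n : ℕ} (s : Fin n → F) : PowerSeries.constantCoeff (LP s) = 1 := by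
  rw [LP, map_prod]
  exact Finset.prod_eq_one (fun i _ => by simp)

theorem LP_ne {n : ℕ} (s : Fin n → F) : LP s ≠ 0 := by
  intro h
  have := LP_cc s
  rw [h, map_zero] at this
  exact zero_ne_one this

theorem LP_map {F' : Type} [Field F'] (φ : F →+* F') {n : ℕ} (s : Fin n → F) : PowerSeries.map φ (LP s) = LP (fun i => φ (s i)) := by
  rw [LP, map_prod]
  exact Finset.prod_congr rfl (fun i _ => by simp)

theorem LP_coe {n : ℕ} (s : Fin n → F) : ((∏ i, (1 + Polynomial.C (s i) * Polynomial.X) : F[X]) : PowerSeries F) = LP s := by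
  rw [← Polynomial.coeToPowerSeries.ringHom_apply, map_prod]
  refine Finset.prod_congr rfl (fun i _ => ?_)
  rw [Polynomial.coeToPowerSeries.ringHom_apply, Polynomial.coe_add, Polynomial.coe_mul, Polynomial.coe_one, Polynomial.coe_C, Polynomial.coe_X]

theorem LP_append {m n : ℕ} (s : Fin (m+n) → F) : LP s = LP (fun i : Fin m => s (Fin.castAdd n i)) * LP (fun j : Fin n => s (Fin.natAdd m j)) :=
  Fin.prod_univ_add _

theorem LP_c1 {n : ℕ} (s : Fin n → F) : PowerSeries.coeff 1 (LP s) = ∑ i, s i := by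
  induction n with
  | zero => rw [LP]; simp [PowerSeries.coeff_one]
  | succ n ih =>
    have h1 : LP s = (1 + PowerSeries.C (s 0) * PowerSeries.X) * LP (fun i : Fin n => s i.succ) := Fin.prod_univ_succ _
    have h2 : PowerSeries.coeff 0 (LP (fun i : Fin n => s i.succ)) = 1 := by
      rw [PowerSeries.coeff_zero_eq_constantCoeff_apply, LP_cc]
    rw [h1, add_mul, one_mul, map_add, ih, mul_assoc, PowerSeries.coeff_C_mul, mul_comm PowerSeries.X, PowerSeries.coeff_succ_mul_X, h2,
      Fin.sum_univ_succ]
    ring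

theorem newton_ps {q : F} {p f : ℕ → F} (h : ∀ n, qn q (n+1) * f (n+1) =
      ∑ i ∈ Finset.range (n+1), (-1) ^ (n - i) * q ^ i * f i * p (1 + (n - i))) :
    Phi q p * PowerSeries.rescale (-q) (PowerSeries.mk f) = PowerSeries.rescale (-1) (PowerSeries.mk f) := by
  ext N
  rw [mul_comm, PowerSeries.coeff_mul, Finset.Nat.sum_antidiagonal_eq_sum_range_succ_mk, PowerSeries.coeff_rescale, PowerSeries.coeff_mk,
    Finset.sum_range_succ]
  simp only [PowerSeries.coeff_rescale, Phi, PowerSeries.coeff_mk, Nat.sub_self, if_true, mul_one]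
  rcases N with _ | n
  · simp
  · have hq : (q - 1) * qn q (n+1) = q ^ (n+1) - 1 := by rw [qn]; exact mul_geom_sum q (n+1)
    have h1 : ∑ i ∈ Finset.range (n+1), (-q) ^ i * f i * (if n + 1 - i = 0 then 1 else (q - 1) * p (n + 1 - i)) =
        (-1) ^ n * (q - 1) * (qn q (n+1) * f (n+1)) := by
      rw [h, Finset.mul_sum]
      refine Finset.sum_congr rfl (fun i hi => ?_)
      rw [Finset.mem_range] at hi
      obtain ⟨j, rfl⟩ := Nat.exists_eq_add_of_le (Nat.lt_succ_iff.1 hi)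
      rw [if_neg (by omega), show i + j + 1 - i = 1 + (i + j - i) by omega, Nat.add_sub_cancel_left, neg_pow q i, pow_add]
      have : ((-1 : F) ^ j) * (-1) ^ j = 1 := by rw [← mul_pow]; simp
      linear_combination (-((-1) ^ i * q ^ i * f i * (q - 1) * p (1 + j))) * this
    rw [h1, mul_assoc, ← mul_assoc (q - 1), hq, neg_pow q (n+1), pow_succ]
    ring

theorem inv_eq {q : F} (hq : ∀ n, 1 ≤ n → q ^ n ≠ 1) {W W' : PowerSeries F} (h1 : PowerSeries.constantCoeff W = 1)
    (h2 : PowerSeries.constantCoeff W' = 1) (h : W * PowerSeries.rescale q W' = PowerSeries.rescale q W * W') : W = W' := by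
  have hW' : W' ≠ 0 := by rintro rfl; simp at h2
  have hrW' : PowerSeries.rescale q W' ≠ 0 := by
    intro h0
    have := congrArg (PowerSeries.coeff 0) h0
    rw [PowerSeries.coeff_rescale, PowerSeries.coeff_zero_eq_constantCoeff_apply, h2] at this
    simp at this
  have hZ : W * W'⁻¹ * W' = W := by
    rw [mul_assoc, PowerSeries.inv_mul_cancel W' (by rw [h2]; exact one_ne_zero), mul_one]
  set Z := W * W'⁻¹ with hZd
  have hZr : Z = PowerSeries.rescale q Z := by
    apply mul_right_cancel₀ hW'
    apply mul_right_cancel₀ hrW'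
    rw [hZ, h, mul_right_comm, ← map_mul, hZ]
  have hZ1 : Z = 1 := by
    ext n
    rcases Nat.eq_zero_or_pos n with rfl | hn
    · have := congrArg PowerSeries.constantCoeff hZ
      rw [map_mul, h1, h2, mul_one] at this
      simpa using this
    · have := congrArg (PowerSeries.coeff n) hZr
      rw [PowerSeries.coeff_rescale] at this
      have h3 : (1 - q ^ n) * PowerSeries.coeff n Z = 0 := by linear_combination this
      rw [(mul_eq_zero.1 h3).resolve_left (sub_ne_zero.2 (hq n hn).symm), PowerSeries.coeff_one, if_neg (by omega)]
  rw [← hZ, hZ1, one_mul]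

end ps

section poly

theorem refl_prod {n : ℕ} (s : Fin n → ℝ) : (∏ i, (1 + Polynomial.C (s i) * Polynomial.X)).natDegree ≤ n ∧
    Polynomial.reflect n (∏ i, (1 + Polynomial.C (s i) * Polynomial.X)) = ∏ i, (Polynomial.X + Polynomial.C (s i)) := by
  induction n with
  | zero => simp
  | succ n ih =>
    obtain ⟨h1, h2⟩ := ih (fun i => s i.succ)
    have hd : (1 + Polynomial.C (s 0) * Polynomial.X : ℝ[X]).natDegree ≤ 1 := by compute_degree
    rw [Fin.prod_univ_succ, Fin.prod_univ_succ]
    refine ⟨(Polynomial.natDegree_mul_le_of_le hd h1).trans (by omega), ?_⟩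
    refine (congrArg (fun k => Polynomial.reflect k _) (add_comm n 1)).trans ?_
    refine (Polynomial.reflect_mul _ _ hd h1).trans ?_
    rw [h2]
    congr 1
    ext i
    rw [Polynomial.coeff_reflect]
    rcases i with _ | _ | i
    · rw [Polynomial.revAt_le (by omega)]; simp [Polynomial.coeff_one, Polynomial.coeff_X]
    · rw [Polynomial.revAt_le (by omega)]; simp [Polynomial.coeff_one, Polynomial.coeff_X, Polynomial.coeff_C]
    · rw [Polynomial.revAt_eq_self_of_lt (by omega)]; simp [Polynomial.coeff_one, Polynomial.coeff_X, Polynomial.coeff_C]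

theorem rev_sum {n : ℕ} {p : ℝ[X]} (hp : p.natDegree ≤ n) :
    ∑ i ∈ Finset.range (n+1), Polynomial.C (p.coeff (n - i)) * Polynomial.X ^ i = Polynomial.reflect n p := by
  ext k
  rw [Polynomial.finset_sum_coeff, Polynomial.coeff_reflect]
  simp only [Polynomial.coeff_C_mul_X_pow]
  rw [Finset.sum_ite_eq]
  split_ifs with h
  · rw [Polynomial.revAt_le (by simpa [Nat.lt_succ_iff] using h)]
  · rw [Finset.mem_range] at h
    rw [Polynomial.revAt_eq_self_of_lt (by omega), Polynomial.coeff_eq_zero_of_natDegree_lt (by omega)]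

theorem top_coeff {n : ℕ} (s : Fin n → ℝ) : (∏ i, (1 + Polynomial.C (s i) * Polynomial.X)).coeff n = ∏ i, s i := by
  have h := congrArg (fun p => Polynomial.coeff p 0) (refl_prod s).2
  simp only [Polynomial.coeff_reflect] at h
  rw [Polynomial.revAt_le (by omega), Nat.sub_zero] at h
  rw [h, Polynomial.coeff_zero_prod]
  simp

theorem prod_inv {n : ℕ} (s : Fin n → ℝ) (hs : ∀ i, s i ≠ 0) : ∏ i, (Polynomial.X + Polynomial.C (s i)) =
    Polynomial.C (∏ i, s i) * ∏ i, (1 + Polynomial.C (s i)⁻¹ * Polynomial.X) := by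
  rw [map_prod, ← Finset.prod_mul_distrib]
  refine Finset.prod_congr rfl (fun i _ => ?_)
  rw [mul_add, ← mul_assoc, ← map_mul, mul_inv_cancel₀ (hs i), map_one]
  ring

theorem final_alg (m n : ℕ) (x : Fin m → ℝ) (y : Fin n → ℝ)
    (hx : ∀ i, 0 < x i) (hy : ∀ j, 0 < y j)
    (P Q Pt Qt : Polynomial ℝ)
    (hP : P = ∏ i : Fin m, (1 + Polynomial.C (x i) * Polynomial.X))
    (hQ : Q = ∏ j : Fin n, (1 + Polynomial.C (-(y j)) * Polynomial.X))
    (hPt : Pt = ∑ i ∈ Finset.range (m + 1), Polynomial.C (P.coeff (m - i)) * Polynomial.X ^ i)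
    (hQt : Qt = ∑ j ∈ Finset.range (n + 1),
        Polynomial.C ((-1 : ℝ) ^ j * ((-1 : ℝ) ^ (n - j) * Q.coeff (n - j))) * Polynomial.X ^ j)
    (key : P * ∏ j : Fin n, (1 + Polynomial.C (-(y j))⁻¹ * Polynomial.X) = Q * ∏ i : Fin m, (1 + Polynomial.C (x i)⁻¹ * Polynomial.X)) :
    Polynomial.C ((-1 : ℝ) ^ n * Q.coeff n) * (Pt * Q) =
      Polynomial.C (P.coeff m) * (Qt * P) := by
  have e1 : Pt = Polynomial.C (∏ i, x i) * ∏ i, (1 + Polynomial.C (x i)⁻¹ * Polynomial.X) := by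
    rw [hPt, ← prod_inv x (fun i => (hx i).ne'), ← (refl_prod x).2, hP, rev_sum (refl_prod x).1]
  have e2 : Qt = Polynomial.C ((-1) ^ n) * (Polynomial.C (∏ j, -(y j)) * ∏ j, (1 + Polynomial.C (-(y j))⁻¹ * Polynomial.X)) := by
    rw [← prod_inv (fun j => -(y j)) (fun i => neg_ne_zero.2 (hy i).ne'), ← (refl_prod _).2, ← rev_sum (refl_prod _).1, ← hQ, hQt, Finset.mul_sum]
    refine Finset.sum_congr rfl (fun j hj => ?_)
    rw [Finset.mem_range] at hj
    rw [← mul_assoc ((-1) ^ j), ← pow_add, show j + (n - j) = n by omega, map_mul, mul_assoc]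
  have e3 : P.coeff m = ∏ i, x i := by rw [hP, top_coeff]
  have e4 : Q.coeff n = ∏ j, -(y j) := by rw [hQ, top_coeff]
  rw [e1, e2, e3, e4, map_mul]
  linear_combination (-Polynomial.C ((-1) ^ n) * Polynomial.C (∏ j, -(y j)) * Polynomial.C (∏ i, x i)) * key

end poly
end HS

namespace HS

section mdl
variable {F : Type} [Field F]

def sgv (q : F) (m n : ℕ) : Fin (m+n) → F := Fin.append (fun _ : Fin m => q) (fun _ : Fin n => -1)

theorem sgv_h (q : F) (m n : ℕ) (a : Fin (m+n)) : sgv q m n a = q ∨ sgv q m n a = -1 := by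
  refine Fin.addCases (fun i => Or.inl ?_) (fun j => Or.inr ?_) a <;> simp [sgv]

theorem mdl_Phi (q : F) {m n : ℕ} {B : Type} [Ring B] [Algebra F B] [Nontrivial B] (l : Lv (Fin (m+n)) B)
    (g : Fin (m+n) → F) (x : Fin m → F) (y : Fin n → F) (hx : ∀ i, g (Fin.castAdd n i) = x i) (hy : ∀ j, g (Fin.natAdd m j) = y j) :
    Phi q ((mD q (sgv q m n) l (sgv_h q m n)).pk g) * (LP (fun i => -q * x i) * LP y) =
      LP (fun i => -x i) * LP (fun j => q * y j) := by
  have h := mD_Phi l (sgv_h q m n) g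
  have e1 : ∏ b, (1 - PowerSeries.C (sgv q m n b * g b) * PowerSeries.X) = LP (fun i => -q * x i) * LP y := by
    rw [show ∏ b, (1 - PowerSeries.C (sgv q m n b * g b) * PowerSeries.X) = LP (fun b => -(sgv q m n b * g b)) from
      Finset.prod_congr rfl (fun b _ => by rw [map_neg]; ring), LP_append]
    simp [sgv, hx, hy]
  have e2 : ∏ b, (1 + PowerSeries.C ((q - 1 - sgv q m n b) * g b) * PowerSeries.X) = LP (fun i => -x i) * LP (fun j => q * y j) := by
    rw [show ∏ b, (1 + PowerSeries.C ((q - 1 - sgv q m n b) * g b) * PowerSeries.X) = LP (fun b => (q - 1 - sgv q m n b) * g b) from rfl, LP_append]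
    simp [sgv, hx, hy]
  rwa [e1, e2] at h

end mdl

theorem core (K : Type) [Field K] [CharZero K]
    (V : Type) [AddCommGroup V] [Module K V] [FiniteDimensional K V]
    (q : K) (hq0 : q ≠ 0) (hq : ∀ n : ℕ, 1 < n → q ^ n ≠ 1)
    (R : V ⊗[K] V →ₗ[K] V ⊗[K] V) (hR : IsHeckeSymmetry K V q R)
    {ι : Type} [Fintype ι] [DecidableEq ι] [Nonempty ι] (bs : Module.Basis ι K V)
    (m n : ℕ) [Nonempty (Fin (m+n))] (x : Fin m → ℝ) (y : Fin n → ℝ)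
    (hx : ∀ i, 0 < x i) (hy : ∀ j, 0 < y j)
    (heq : poincareLambda K V R * LP (fun j => -(y j)) = LP x) :
    LP x * LP (fun j => -(y j)⁻¹) = LP (fun j => -(y j)) * LP (fun i => (x i)⁻¹) := by
  obtain ⟨L, _, _, _, _, ⟨φ⟩⟩ := exists_L K
  have hq1 : q ≠ 1 := fun h => hq 2 (by omega) (by rw [h, one_pow])
  have hqn : ∀ n, 1 ≤ n → q ^ n ≠ 1 := by
    intro n hn
    rcases Nat.eq_or_lt_of_le hn with h | h
    · rw [← h, pow_one]; exact hq1
    · exact hq n h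
  have inj : Function.Injective (algebraMap K L) := (algebraMap K L).injective
  set Q := algebraMap K L q with hQ
  have hQ0 : Q ≠ 0 := by rw [hQ, Ne, map_eq_zero]; exact hq0
  have hQ1 : Q ≠ 1 := fun h => hq1 (inj (h.trans (map_one _).symm))
  have hQn : ∀ n, 1 ≤ n → Q ^ n ≠ 1 := by
    intro n hn h
    rw [hQ, ← map_pow] at h
    exact hqn n hn (inj (h.trans (map_one _).symm))
  have hqq : ∀ n, qn q (n+1) ≠ 0 := by
    intro n h
    have h1 : (q - 1) * qn q (n+1) = q ^ (n+1) - 1 := by rw [qn]; exact mul_geom_sum q (n+1)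
    rw [h, mul_zero] at h1
    exact hqn (n+1) (by omega) (sub_eq_zero.1 h1.symm)
  have hQQ : ∀ n, qn Q (n+1) ≠ 0 := by
    intro n h
    have h1 : (Q - 1) * qn Q (n+1) = Q ^ (n+1) - 1 := by rw [qn]; exact mul_geom_sum Q (n+1)
    rw [h, mul_zero] at h1
    exact hQn (n+1) (by omega) (sub_eq_zero.1 h1.symm)
  obtain ⟨C0⟩ := mkDat_Cl (bs := bs) (lvF L ι) hR
  have hfr := fun k => finrank_eq (bs := bs) (l := lvF L ι) (hR := hR) hqq k
  set D0 := mkDat (bs := bs) (lvF L ι) hR with hD0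
  have hgc0 : D0.GC (fun _ => 1) := fun a b c d => rfl
  have hnewt : ∀ N, qn Q (N+1) * (Module.finrank K (lambdaGrade K V R (N+1)) : L) =
      ∑ i ∈ Finset.range (N+1), (-1) ^ (N - i) * Q ^ i * (Module.finrank K (lambdaGrade K V R i) : L) * (D0.bc L).pk (fun _ => 1) (1 + (N - i)) := by
    intro N
    have h := congrArg (algebraMap K L) (newton hqq (D0.isTr hgc0 (N+1)) N le_rfl)
    simp only [← hfr, map_mul, map_sum, map_pow, map_neg, map_one, map_natCast, qn] at h
    rw [qn]
    rw [h]
    exact Finset.sum_congr rfl (fun i _ => by rw [D0.bc_pk _ (by omega)])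
  have hN := newton_ps (q := Q) (p := (D0.bc L).pk (fun _ => 1)) (f := fun k => (Module.finrank K (lambdaGrade K V R k) : L)) hnewt
  set Fs : PowerSeries L := PowerSeries.mk (fun k => (Module.finrank K (lambdaGrade K V R k) : L)) with hFs
  have hFm : PowerSeries.map φ (poincareLambda K V R) = Fs := by
    ext k
    rw [PowerSeries.coeff_map, poincareLambda, hFs, PowerSeries.coeff_mk, PowerSeries.coeff_mk, map_natCast]
  have hFL : Fs * LP (fun j => -φ (y j)) = LP (fun i => φ (x i)) := by
    have h := congrArg (PowerSeries.map φ) heq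
    rw [map_mul, hFm, LP_map, LP_map] at h
    simpa using h
  have h1 := congrArg (PowerSeries.rescale (-Q)) hFL
  have h2 := congrArg (PowerSeries.rescale (-1 : L)) hFL
  rw [map_mul, LP_rescale, LP_rescale] at h1 h2
  simp only [neg_mul, one_mul, mul_neg, neg_neg] at h1 h2
  have hP1 : Phi Q ((D0.bc L).pk (fun _ => 1)) * (LP (fun i => -Q * φ (x i)) * LP (fun j => φ (y j))) =
      LP (fun i => -φ (x i)) * LP (fun j => Q * φ (y j)) := by
    simp only [neg_mul]
    rw [← h1, ← h2, ← hN]; ring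
  -- the model
  set l' := lvF L (Fin (m+n))
  set D' := mD Q (sgv Q m n) l' (sgv_h Q m n) with hD'
  obtain ⟨C'⟩ := mD_Cl l' (sgv_h Q m n) hQ0
  set γ' : Fin (m+n) → ℝ := Fin.append x y with hγ'
  have hM1 := mdl_Phi Q l' (fun a => φ (γ' a)) (fun i => φ (x i)) (fun j => φ (y j)) (fun i => by simp [hγ']) (fun i => by simp [hγ'])
  have hM2 := mdl_Phi Q l' (fun a => φ (γ' a)⁻¹) (fun i => φ (x i)⁻¹) (fun j => φ (y j)⁻¹) (fun i => by simp [hγ']) (fun i => by simp [hγ'])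
  have hPP : Phi Q ((D0.bc L).pk (fun _ => 1)) = Phi Q (D'.pk (fun a => φ (γ' a))) :=
    mul_right_cancel₀ (mul_ne_zero (LP_ne _) (LP_ne _)) (hP1.trans hM1.symm)
  have hpair : Pair (D0.bc L) D' φ (fun _ => 1) γ' :=
    { q0 := hQ0
      q1 := hQ1
      qn := hQQ
      pos := fun _ => one_pos
      pos' := fun a => by
        refine Fin.addCases (fun i => ?_) (fun j => ?_) a
        · simpa [hγ'] using hx i
        · simpa [hγ'] using hy j
      gc := fun a b c d => rfl
      gc' := mD_GC l' (sgv_h Q m n) _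
      pk := fun k hk => by
        have := Phi_inj hQ1 hPP k hk
        simpa using this }
  have hdual := hpair.dual (D0.bcCl C0) C'
  have hPP2 : Phi Q (D'.pk (fun a => φ (γ' a))) = Phi Q (D'.pk (fun a => φ (γ' a)⁻¹)) := by
    rw [← hPP]
    ext k
    rw [Phi, Phi, PowerSeries.coeff_mk, PowerSeries.coeff_mk]
    split_ifs with hk
    · rfl
    · rw [← hdual k (by omega)]; simp
  rw [← hPP2] at hM2
  have hW : LP (fun i => -φ (x i)) * LP (fun j => φ (y j)⁻¹) = LP (fun j => φ (y j)) * LP (fun i => -φ (x i)⁻¹) := by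
    refine inv_eq hQn (by rw [map_mul, LP_cc, LP_cc, one_mul]) (by rw [map_mul, LP_cc, LP_cc, one_mul]) ?_
    rw [map_mul, map_mul, LP_rescale, LP_rescale, LP_rescale, LP_rescale]
    simp only [mul_neg]
    simp only [neg_mul] at hM1 hM2
    refine mul_left_cancel₀ (a := Phi Q (D'.pk (fun a => φ (γ' a)))) ?_ ?_
    · intro h0
      have := congrArg (PowerSeries.coeff 0) h0
      rw [Phi, PowerSeries.coeff_mk] at this
      simp at this
    · linear_combination (LP (fun i => -φ (x i)) * LP (fun j => Q * φ (y j))) * hM2 - (LP (fun i => -φ (x i)⁻¹) * LP (fun j => Q * φ (y j)⁻¹)) * hM1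
  have hW2 : LP (fun i => -x i) * LP (fun j => (y j)⁻¹) = LP y * LP (fun i => -(x i)⁻¹) := by
    have hinj : Function.Injective (PowerSeries.map φ) := by
      intro f g h
      ext k
      have := congrArg (PowerSeries.coeff k) h
      rw [PowerSeries.coeff_map, PowerSeries.coeff_map] at this
      exact φ.injective this
    apply hinj
    rw [map_mul, map_mul, LP_map, LP_map, LP_map, LP_map]
    simp only [map_neg]
    exact hW
  have h3 := congrArg (PowerSeries.rescale (-1 : ℝ)) hW2
  rw [map_mul, map_mul, LP_rescale, LP_rescale, LP_rescale, LP_rescale] at h3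
  simpa using h3

theorem main (K : Type) [Field K] [CharZero K]
    (V : Type) [AddCommGroup V] [Module K V] [FiniteDimensional K V]
    (q : K) (hq0 : q ≠ 0) (hq : ∀ n : ℕ, 1 < n → q ^ n ≠ 1)
    (R : V ⊗[K] V →ₗ[K] V ⊗[K] V) (hR : IsHeckeSymmetry K V q R)
    (m n : ℕ) (x : Fin m → ℝ) (y : Fin n → ℝ)
    (hx : ∀ i, 0 < x i) (hy : ∀ j, 0 < y j)
    (heq : poincareLambda K V R * LP (fun j => -(y j)) = LP x) :
    LP x * LP (fun j => -(y j)⁻¹) = LP (fun j => -(y j)) * LP (fun i => (x i)⁻¹) := by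
  by_cases hmn : Nonempty (Fin (m+n))
  · set bs := Module.finBasis K V
    by_cases hι : Nonempty (Fin (Module.finrank K V))
    · exact core K V q hq0 hq R hR bs m n x y hx hy heq
    · exfalso
      have hemp := not_nonempty_iff.1 hι
      have hf1 : Module.finrank K (lambdaGrade K V R 1) = 0 := by
        have he : IsEmpty (Wd (Fin (Module.finrank K V)) 1) := ⟨fun w => hemp.false w.1⟩
        rw [span_lw bs R 1, Set.range_eq_empty, Submodule.span_empty, finrank_bot]
      have h0 := congrArg (PowerSeries.coeff 0) heq
      have h1 := congrArg (PowerSeries.coeff 1) heq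
      rw [PowerSeries.coeff_mul, Finset.Nat.sum_antidiagonal_eq_sum_range_succ_mk] at h0 h1
      rw [Finset.sum_range_one, PowerSeries.coeff_zero_eq_constantCoeff_apply, PowerSeries.coeff_zero_eq_constantCoeff_apply, LP_cc, PowerSeries.coeff_zero_eq_constantCoeff_apply, LP_cc] at h0
      rw [Finset.sum_range_succ, Finset.sum_range_one] at h1
      have h2 : PowerSeries.coeff 1 (poincareLambda K V R) = 0 := by
        rw [poincareLambda, PowerSeries.coeff_mk, hf1]; simp
      simp only [Nat.sub_zero, PowerSeries.coeff_zero_eq_constantCoeff_apply, LP_c1, h2, zero_mul, add_zero] at h1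
      rw [mul_one] at h0
      rw [h0, one_mul, Finset.sum_neg_distrib] at h1
      have hp : 0 < ∑ a, Fin.append x y a := by
        refine Finset.sum_pos (fun a _ => ?_) ⟨hmn.some, Finset.mem_univ _⟩
        refine Fin.addCases (fun i => ?_) (fun j => ?_) a
        · simpa using hx i
        · simpa using hy j
      rw [Fin.sum_univ_add] at hp
      simp only [Fin.append_left, Fin.append_right] at hp
      linarith
  · have : m + n = 0 := by
      by_contra h
      exact hmn ⟨⟨0, by omega⟩⟩
    obtain ⟨rfl, rfl⟩ : m = 0 ∧ n = 0 := by omega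
    simp [LP]

end HS

/-- With `P = ∏ (1 + xᵢ t) = ∑ aᵢ tⁱ`, `Q = ∏ (1 - yⱼ t) = ∑ (-1)ʲ bⱼ tʲ` and the
reversed polynomials `P̃ = ∑ a_{m-i} tⁱ`, `Q̃ = ∑ (-1)ʲ b_{n-j} tʲ`, the identity
`bₙ · P̃ · Q = a_m · Q̃ · P` holds. -/
theorem poincare_series_lambda_functional_equation
    (K : Type) [Field K] [CharZero K]
    (V : Type) [AddCommGroup V] [Module K V] [FiniteDimensional K V]
    (q : K) (hq0 : q ≠ 0) (hq : ∀ n : ℕ, 1 < n → q ^ n ≠ 1)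
    (R : V ⊗[K] V →ₗ[K] V ⊗[K] V) (hR : IsHeckeSymmetry K V q R)
    (m n : ℕ) (x : Fin m → ℝ) (y : Fin n → ℝ)
    (hx : ∀ i, 0 < x i) (hy : ∀ j, 0 < y j)
    (P Q Pt Qt : Polynomial ℝ)
    (hP : P = ∏ i : Fin m, (1 + Polynomial.C (x i) * Polynomial.X))
    (hQ : Q = ∏ j : Fin n, (1 - Polynomial.C (y j) * Polynomial.X))
    (hPt : Pt = ∑ i ∈ Finset.range (m + 1), Polynomial.C (P.coeff (m - i)) * Polynomial.X ^ i)
    (hQt : Qt = ∑ j ∈ Finset.range (n + 1),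
        Polynomial.C ((-1 : ℝ) ^ j * ((-1 : ℝ) ^ (n - j) * Q.coeff (n - j))) * Polynomial.X ^ j)
    (heq : poincareLambda K V R * (Q : PowerSeries ℝ) = (P : PowerSeries ℝ)) :
    Polynomial.C ((-1 : ℝ) ^ n * Q.coeff n) * (Pt * Q) =
      Polynomial.C (P.coeff m) * (Qt * P) := by
  have hQ2 : Q = ∏ j : Fin n, (1 + Polynomial.C (-(y j)) * Polynomial.X) := by
    rw [hQ]
    exact Finset.prod_congr rfl (fun j _ => by rw [map_neg]; ring)
  have cP : (P : PowerSeries ℝ) = HS.LP x := by rw [hP]; exact HS.LP_coe x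
  have cQ : (Q : PowerSeries ℝ) = HS.LP (fun j => -(y j)) := by rw [hQ2]; exact HS.LP_coe (fun j => -(y j))
  refine HS.final_alg m n x y hx hy P Q Pt Qt hP hQ2 hPt hQt ?_
  apply Polynomial.coe_injective
  rw [Polynomial.coe_mul, Polynomial.coe_mul, HS.LP_coe (fun j => (-(y j))⁻¹), HS.LP_coe (fun i => (x i)⁻¹), cP, cQ]
  simp only [inv_neg]
  refine HS.main K V q hq0 hq R hR m n x y hx hy ?_
  rw [← cP, ← cQ]
  exact heq

end
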